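/- arXiv:1811.09183 — 2 statements merged into one kernel-verified Lean document; each statement's English description precedes it below -/
import Mathlib

section
/- Let E be an infinite dimensional Banach space and let b ≥ 1 satisfy b ≥ (cot E)*. Then for no a with b ≤ a < ∞ is the identity map id_E : E → E absolutely (a,b)-summing; equivalently, inf{a : id_E is absolutely (a,b)-summing} = ∞. -/
open scoped ENNReal NNReal BigOperators ZeroAtInfty

noncomputable section

/-- The `k`-th Rademacher function on `[0,1]`. -/
def Rademacher (k : ℕ) (t : ℝ) : ℝ := (-1 : ℝ) ^ ⌊(2 : ℝ) ^ (k + 1) * t⌋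

/-- A Banach space `E` has cotype `q` (for `2 ≤ q < ∞`). -/
def HasCotype (q : ℝ) (E : Type*) [NormedAddCommGroup E] [NormedSpace ℝ E] : Prop :=
  2 ≤ q ∧ ∃ C > 0, ∀ (n : ℕ) (x : Fin n → E),
    (∑ k : Fin n, ‖x k‖ ^ q) ^ (1 / q) ≤
      C * (∫ t in (0:ℝ)..(1:ℝ), ‖∑ k : Fin n, Rademacher k.1 t • x k‖ ^ 2) ^ ((1:ℝ) / 2)

/-- `cot E`, the infimum of the cotypes of `E` (`∞` if `E` has no finite cotype). -/
def cot (E : Type*) [NormedAddCommGroup E] [NormedSpace ℝ E] : ℝ≥0∞ :=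
  sInf {c : ℝ≥0∞ | ∃ q : ℝ, HasCotype q E ∧ c = ENNReal.ofReal q}

/-- Conjugate exponent in `ℝ≥0∞` : `p* = p/(p-1)`, with `1* = ∞` and `∞* = 1`. -/
def conjE (p : ℝ≥0∞) : ℝ≥0∞ := 1 + 1 / (p - 1)

/-- A sequence is weakly `p`-summable. -/
def WeaklySummable {E : Type*} [NormedAddCommGroup E] [NormedSpace ℝ E]
    (p : ℝ) (x : ℕ → E) : Prop :=
  ∀ φ : E →L[ℝ] ℝ, Summable fun j => |φ (x j)| ^ p

/-- `u : E → F` is absolutely `(q,p)`-summing. -/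
def AbsolutelySumming {E F : Type*} [NormedAddCommGroup E] [NormedSpace ℝ E]
    [NormedAddCommGroup F] [NormedSpace ℝ F] (q p : ℝ) (u : E →L[ℝ] F) : Prop :=
  ∀ x : ℕ → E, WeaklySummable p x → Summable fun j => ‖u (x j)‖ ^ q

/-- The weak `ℓ_p` norm of a sequence. -/
def weakNorm {E : Type*} [NormedAddCommGroup E] [NormedSpace ℝ E] (p : ℝ) (x : ℕ → E) : ℝ :=
  ⨆ φ : {φ : E →L[ℝ] ℝ // ‖φ‖ ≤ 1}, (∑' j, |φ.1 (x j)| ^ p) ^ (1 / p)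

/-- A continuous `m`-linear operator is multiple `(q,p)`-summing. -/
def MultipleSumming {m : ℕ} {E : Fin m → Type*} [∀ i, NormedAddCommGroup (E i)]
    [∀ i, NormedSpace ℝ (E i)] {F : Type*} [NormedAddCommGroup F] [NormedSpace ℝ F]
    (q p : ℝ) (T : ContinuousMultilinearMap ℝ E F) : Prop :=
  ∃ C > 0, ∀ x : (i : Fin m) → ℕ → E i, (∀ i, WeaklySummable p (x i)) →
    (Summable fun j : Fin m → ℕ => ‖T (fun i => x i (j i))‖ ^ q) ∧
    (∑' j : Fin m → ℕ, ‖T (fun i => x i (j i))‖ ^ q) ^ (1 / q) ≤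
      C * ∏ i, weakNorm p (x i)


section SignAverages

open Finset Real

/-- Averaging over a finite group is compatible with surjective homomorphisms. -/
lemma expect_comp_monoidHom {G H : Type*} [Group G] [Group H] [Fintype G] [Fintype H]
    (p : G →* H) (hp : Function.Surjective p) (f : H → ℝ) :
    𝔼 g, f (p g) = 𝔼 h, f h := by
  have key : ∀ h : H, 𝔼 g, f (p g) = 𝔼 g, f (p g * h) := by
    intro h
    obtain ⟨g₀, rfl⟩ := hp h
    refine (Fintype.expect_equiv (Equiv.mulRight g₀) _ _ fun g => ?_).symm
    simp
  calc 𝔼 g, f (p g) = 𝔼 _h : H, 𝔼 g, f (p g) := (Fintype.expect_const _).symm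
    _ = 𝔼 h : H, 𝔼 g, f (p g * h) := expect_congr rfl fun h _ => key h
    _ = 𝔼 g, 𝔼 h : H, f (p g * h) := expect_comm _ _ _
    _ = 𝔼 _g : G, 𝔼 h : H, f h := by
        refine expect_congr rfl fun g _ => ?_
        exact Fintype.expect_equiv (Equiv.mulLeft (p g)) _ _ fun h => by simp
    _ = 𝔼 h, f h := Fintype.expect_const _

variable {ι κ : Type*} [Fintype ι] [Fintype κ] [DecidableEq ι] [DecidableEq κ]

/-- The marginal of uniform signs along an injection is again uniform. -/
lemma expect_signs_comp {f : κ → ι} (hf : Function.Injective f) (h : (κ → ℤˣ) → ℝ) :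
    𝔼 ε : ι → ℤˣ, h (ε ∘ f) = 𝔼 δ : κ → ℤˣ, h δ :=
  expect_comp_monoidHom
    { toFun := fun ε : ι → ℤˣ => ε ∘ f, map_one' := rfl, map_mul' := fun _ _ => rfl }
    hf.surjective_comp_right h

lemma expect_signs_mul (η : ι → ℤˣ) (h : (ι → ℤˣ) → ℝ) :
    𝔼 ε : ι → ℤˣ, h (fun i => η i * ε i) = 𝔼 ε : ι → ℤˣ, h ε :=
  Fintype.expect_equiv (Equiv.mulLeft η) _ _ fun _ => rfl

lemma expect_signs_mul_eq (i j : ι) :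
    𝔼 ε : ι → ℤˣ, ((ε i : ℤ) : ℝ) * ((ε j : ℤ) : ℝ) = if i = j then 1 else 0 := by
  split_ifs with h
  · subst h
    rw [← Fintype.expect_const (ι := ι → ℤˣ) (1 : ℝ)]
    refine expect_congr rfl fun ε _ => ?_
    rcases Int.units_eq_one_or (ε i) with h | h <;> simp [h]
  · have := expect_signs_mul (Function.update 1 i (-1))
      (fun ε : ι → ℤˣ => ((ε i : ℤ) : ℝ) * ((ε j : ℤ) : ℝ))
    simp only [Function.update_self, Function.update_of_ne (Ne.symm h), Pi.one_apply, one_mul,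
      neg_mul, Units.val_neg, Int.cast_neg, expect_neg_distrib] at this
    linarith

lemma expect_sq_signs (t : ι → ℝ) :
    𝔼 ε : ι → ℤˣ, (∑ i, ε i • t i) ^ 2 = ∑ i, t i ^ 2 := by
  have h1 : ∀ ε : ι → ℤˣ, (∑ i, ε i • t i) ^ 2 =
      ∑ i, ∑ j, t i * t j * (((ε i : ℤ) : ℝ) * ((ε j : ℤ) : ℝ)) := by
    intro ε
    rw [sq, sum_mul_sum]
    refine sum_congr rfl fun i _ => sum_congr rfl fun j _ => ?_
    simp only [Units.smul_def, zsmul_eq_mul]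
    ring
  simp_rw [h1, expect_sum_comm, ← mul_expect, expect_signs_mul_eq]
  simp [sq]

lemma expect_sq_le_expect_sq {α : Type*} (s : Finset α) (hs : s.Nonempty) (f : α → ℝ) :
    (𝔼 i ∈ s, f i) ^ 2 ≤ 𝔼 i ∈ s, f i ^ 2 := by
  rw [expect_eq_sum_div_card, expect_eq_sum_div_card, div_pow]
  have hc : (0 : ℝ) < #s := by exact_mod_cast hs.card_pos
  rw [div_le_div_iff₀ (by positivity) hc]
  have := sq_sum_le_card_mul_sum_sq (s := s) (f := f)
  nlinarith

lemma expect_le_sqrt_expect_sq {α : Type*} (s : Finset α) (hs : s.Nonempty) (f : α → ℝ) :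
    𝔼 i ∈ s, f i ≤ √(𝔼 i ∈ s, f i ^ 2) :=
  Real.le_sqrt_of_sq_le (expect_sq_le_expect_sq s hs f)

variable {E : Type*} [NormedAddCommGroup E]

/-- The average of `‖∑ ± xᵢ‖²` over all choices of signs. -/
def radSq (x : ι → E) : ℝ := 𝔼 ε : ι → ℤˣ, ‖∑ i, ε i • x i‖ ^ 2

lemma radSq_nonneg (x : ι → E) : 0 ≤ radSq x := expect_nonneg fun _ _ => sq_nonneg _

variable [NormedSpace ℝ E]

lemma radSq_smul (r : ℝ) (x : ι → E) : radSq (fun i => r • x i) = r ^ 2 * radSq x := by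
  simp only [radSq, smul_comm _ r, ← smul_sum, norm_smul, mul_pow, ← mul_expect, norm_eq_abs,
    sq_abs]

/-- Passing to a subfamily decreases the sign average. -/
lemma radSq_comp_le {f : κ → ι} (hf : Function.Injective f) (x : ι → E) :
    radSq (x ∘ f) ≤ radSq x := by
  classical
  let A : (ι → ℤˣ) → E := fun ε => ∑ i with i ∈ Set.range f, ε i • x i
  let B : (ι → ℤˣ) → E := fun ε => ∑ i with i ∉ Set.range f, ε i • x i
  have hA : radSq (x ∘ f) = 𝔼 ε : ι → ℤˣ, ‖A ε‖ ^ 2 := by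
    rw [radSq, ← expect_signs_comp hf]
    refine expect_congr rfl fun ε _ => ?_
    have : (univ.filter fun i => i ∈ Set.range f) = univ.map ⟨f, hf⟩ := by ext; simp
    simp only [A, this, sum_map, Function.Embedding.coeFn_mk, Function.comp_apply]
  have hAB : ∀ ε, ∑ i, ε i • x i = A ε + B ε := fun ε => (sum_filter_add_sum_filter_not _ _ _).symm
  have h1 : radSq x = 𝔼 ε : ι → ℤˣ, ‖A ε + B ε‖ ^ 2 := by simp only [radSq, hAB]
  have h2 : radSq x = 𝔼 ε : ι → ℤˣ, ‖A ε - B ε‖ ^ 2 := by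
    rw [radSq, ← expect_signs_mul (fun i => if i ∈ Set.range f then 1 else -1)]
    refine expect_congr rfl fun ε _ => ?_
    rw [hAB, sub_eq_add_neg]
    congr 3
    · exact sum_congr rfl fun i hi => by beta_reduce; rw [if_pos (mem_filter.1 hi).2, one_mul]
    · simp only [B, ← sum_neg_distrib]
      exact sum_congr rfl fun i hi => by rw [if_neg (mem_filter.1 hi).2]; simp
  have h3 : 𝔼 ε : ι → ℤˣ, ‖A ε‖ ^ 2 ≤
      𝔼 ε : ι → ℤˣ, (‖A ε + B ε‖ ^ 2 + ‖A ε - B ε‖ ^ 2) / 2 := by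
    refine expect_le_expect fun ε _ => ?_
    have : ‖(2 : ℝ) • A ε‖ ≤ ‖A ε + B ε‖ + ‖A ε - B ε‖ := by
      refine le_trans (le_of_eq ?_) (norm_add_le _ _)
      congr 1
      rw [two_smul]; abel
    rw [norm_smul] at this
    norm_num at this
    nlinarith [norm_nonneg (A ε), sq_nonneg (‖A ε + B ε‖ - ‖A ε - B ε‖)]
  rw [← expect_div, expect_add_distrib, ← h1, ← h2, ← hA] at h3
  linarith

lemma norm_le_sqrt_radSq (x : ι → E) (i : ι) : ‖x i‖ ≤ √(radSq x) := by
  refine Real.le_sqrt_of_sq_le ?_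
  refine le_trans (le_of_eq ?_) (radSq_comp_le (f := fun _ : Unit => i)
    (fun _ _ _ => rfl) x)
  simp [radSq, norm_units_zsmul]

lemma abs_apply_units_smul (φ : E →L[ℝ] ℝ) (u : ℤˣ) (x : E) : |φ (u • x)| = |φ x| := by
  rcases Int.units_eq_one_or u with rfl | rfl <;> simp

lemma sum_sq_le_radSq (x : ι → E) (φ : E →L[ℝ] ℝ) (hφ : ‖φ‖ ≤ 1) :
    ∑ i, φ (x i) ^ 2 ≤ radSq x := by
  rw [← expect_sq_signs]
  refine expect_le_expect fun ε _ => ?_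
  have : ∑ i, ε i • φ (x i) = φ (∑ i, ε i • x i) := by
    simp [map_sum, Units.smul_def]
  rw [this, sq_le_sq, abs_norm, ← norm_eq_abs]
  exact φ.le_of_opNorm_le_of_le hφ le_rfl |>.trans (by simp)

omit [DecidableEq ι] in
lemma norm_sum_signs_le {x : ι → E} {S : ℝ}
    (hS : ∀ φ : E →L[ℝ] ℝ, ‖φ‖ ≤ 1 → ∑ i, |φ (x i)| ≤ S) (ε : ι → ℤˣ) :
    ‖∑ i, ε i • x i‖ ≤ S := by
  obtain ⟨φ, hφ, h⟩ := exists_dual_vector'' ℝ (∑ i, ε i • x i)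
  have h' : ‖∑ i, ε i • x i‖ = φ (∑ i, ε i • x i) := h.symm
  rw [h', map_sum]
  refine (sum_le_sum fun i _ => le_abs_self _).trans ?_
  simpa only [abs_apply_units_smul] using hS φ hφ

lemma sqrt_radSq_le {x : ι → E} {S : ℝ}
    (hS : ∀ φ : E →L[ℝ] ℝ, ‖φ‖ ≤ 1 → ∑ i, |φ (x i)| ≤ S) : √(radSq x) ≤ S := by
  have h0 : 0 ≤ S := by simpa using hS 0 (by simp)
  refine Real.sqrt_le_iff.2 ⟨h0, ?_⟩
  refine expect_le univ_nonempty fun ε _ => ?_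
  gcongr
  exact norm_sum_signs_le hS ε

end SignAverages

section Contraction

open Finset

variable {T : Type*} [Nonempty T]

/-- The two-point case of the contraction principle. -/
lemma ciSup_add_abs_add_ciSup_sub_abs_le {g h : T → ℝ}
    (h₁ : BddAbove (Set.range fun t => g t + h t)) (h₂ : BddAbove (Set.range fun t => g t - h t)) :
    (⨆ t, (g t + |h t|)) + ⨆ t, (g t - |h t|) ≤ (⨆ t, (g t + h t)) + ⨆ t, (g t - h t) := by
  rw [← le_sub_iff_add_le]
  refine ciSup_le fun t => ?_
  rw [le_sub_comm]
  refine ciSup_le fun s => ?_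
  have a1 : ∀ u, g u + h u ≤ _ := le_ciSup h₁
  have a2 : ∀ u, g u - h u ≤ _ := le_ciSup h₂
  rcases abs_cases (h t) with ⟨ht, _⟩ | ⟨ht, _⟩
  · linarith [le_abs_self (h s), a1 t, a2 s]
  · linarith [neg_abs_le (h s), a2 t, a1 s]

variable {ι : Type*} [Fintype ι]

omit [Nonempty T] in
lemma bddAbove_range_sum_signs {k : ι → T → ℝ} (hk : ∀ i, ∃ C, ∀ t, |k i t| ≤ C) (ε : ι → ℤˣ) :
    BddAbove (Set.range fun t => ∑ i, ε i • k i t) := by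
  choose C hC using hk
  refine ⟨∑ i, C i, ?_⟩
  rintro _ ⟨t, rfl⟩
  refine sum_le_sum fun i _ => (le_abs_self _).trans ?_
  rw [← Real.norm_eq_abs, norm_units_zsmul]
  exact hC i t

variable [DecidableEq ι]

lemma expect_ciSup_update_abs_le {k : ι → T → ℝ} (hk : ∀ i, ∃ C, ∀ t, |k i t| ≤ C) (a : ι) :
    𝔼 ε : ι → ℤˣ, (⨆ t, ∑ i, ε i • Function.update k a (fun t => |k a t|) i t) ≤
      𝔼 ε : ι → ℤˣ, ⨆ t, ∑ i, ε i • k i t := by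
  have hsplit : ∀ (k' : ι → T → ℝ), 𝔼 ε : ι → ℤˣ, (⨆ t, ∑ i, ε i • k' i t) =
      𝔼 ε : ι → ℤˣ, ((⨆ t, (∑ i ∈ univ.erase a, ε i • k' i t + k' a t)) +
        ⨆ t, (∑ i ∈ univ.erase a, ε i • k' i t - k' a t)) / 2 := by
    intro k'
    have h1 := expect_signs_mul (Function.update 1 a (-1))
      (fun ε : ι → ℤˣ => ⨆ t, ∑ i, ε i • k' i t)
    rw [← expect_div, eq_div_iff two_ne_zero, mul_two]
    nth_rewrite 2 [← h1]
    rw [← expect_add_distrib]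
    refine expect_congr rfl fun ε _ => ?_
    have h2 : ∀ ε : ι → ℤˣ, ∀ t, ∑ i, ε i • k' i t =
        ∑ i ∈ univ.erase a, ε i • k' i t + ε a • k' a t := fun ε t =>
      (sum_erase_add _ _ (mem_univ a)).symm
    have h3 : ∀ t, ∑ i ∈ univ.erase a, ((Function.update 1 a (-1) : ι → ℤˣ) i * ε i) • k' i t =
        ∑ i ∈ univ.erase a, ε i • k' i t := fun t =>
      sum_congr rfl fun i hi => by rw [Function.update_of_ne (ne_of_mem_erase hi)]; simp
    simp only [h2, h3, Function.update_self]
    rcases Int.units_eq_one_or (ε a) with h | h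
    · simp [h, sub_eq_add_neg]
    · simp [h, sub_eq_add_neg, add_comm]
  rw [hsplit, hsplit]
  refine expect_le_expect fun ε _ => ?_
  have h4 : ∀ t, ∑ i ∈ univ.erase a, ε i • Function.update k a (fun t => |k a t|) i t =
      ∑ i ∈ univ.erase a, ε i • k i t := fun t =>
    sum_congr rfl fun i hi => by rw [Function.update_of_ne (ne_of_mem_erase hi)]
  simp only [h4, Function.update_self]
  have hb : ∀ u : ℤˣ, BddAbove (Set.range fun t =>
      ∑ i ∈ univ.erase a, ε i • k i t + u • k a t) := by
    intro u
    convert bddAbove_range_sum_signs hk (Function.update ε a u) using 3 with t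
    rw [← sum_erase_add _ _ (mem_univ a), Function.update_self]
    congr 1
    exact sum_congr rfl fun i hi => by rw [Function.update_of_ne (ne_of_mem_erase hi)]
  gcongr ?_ / 2
  exact ciSup_add_abs_add_ciSup_sub_abs_le (by simpa using hb 1)
    (by simpa [sub_eq_add_neg] using hb (-1))

/-- The contraction principle for sign averages and the absolute value. -/
lemma expect_ciSup_abs_le {k : ι → T → ℝ} (hk : ∀ i, ∃ C, ∀ t, |k i t| ≤ C) :
    𝔼 ε : ι → ℤˣ, (⨆ t, ∑ i, ε i • |k i t|) ≤ 𝔼 ε : ι → ℤˣ, ⨆ t, ∑ i, ε i • k i t := by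
  suffices H : ∀ s : Finset ι, 𝔼 ε : ι → ℤˣ,
      (⨆ t, ∑ i, ε i • (if i ∈ s then |k i t| else k i t)) ≤
        𝔼 ε : ι → ℤˣ, ⨆ t, ∑ i, ε i • k i t by
    simpa using H univ
  intro s
  induction s using Finset.induction_on with
  | empty => simp
  | insert a s ha ih =>
    refine le_trans (le_of_eq ?_) ((expect_ciSup_update_abs_le
      (k := fun i t => if i ∈ s then |k i t| else k i t) ?_ a).trans ih)
    · refine expect_congr rfl fun ε _ => iSup_congr fun t => sum_congr rfl fun i _ => ?_
      by_cases hi : i = a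
      · subst hi; simp [ha]
      · simp [hi]
    · intro i
      obtain ⟨C, hC⟩ := hk i
      refine ⟨C, fun t => ?_⟩
      split_ifs
      · rw [abs_abs]; exact hC t
      · exact hC t

end Contraction

section Selection

open Finset Real

variable {α κ : Type*} [Fintype α] [Fintype κ] [DecidableEq α] [DecidableEq κ]
  {E : Type*} [NormedAddCommGroup E] [NormedSpace ℝ E]

omit [DecidableEq κ] in
/-- Exchanging two independent selections in some coordinates does not change the average. -/
lemma expect_ciSup_sub_eq {T : Type*} (f : α → κ → T → ℝ) (ε : α → ℤˣ) :
    𝔼 c : α → κ, 𝔼 c' : α → κ, (⨆ t, ∑ i, (f i (c i) t - f i (c' i) t)) =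
      𝔼 c : α → κ, 𝔼 c' : α → κ, ⨆ t, ∑ i, ε i • (f i (c i) t - f i (c' i) t) := by
  let e : (α → κ) × (α → κ) → (α → κ) × (α → κ) := fun p =>
    (fun i => if ε i = 1 then p.1 i else p.2 i, fun i => if ε i = 1 then p.2 i else p.1 i)
  have he : Function.Involutive e := fun p => by
    refine Prod.ext (funext fun i => ?_) (funext fun i => ?_) <;>
      by_cases h : ε i = 1 <;> simp [e, h]
  rw [← expect_product', ← expect_product', univ_product_univ]
  refine Fintype.expect_equiv he.toPerm _ _ fun p => ?_
  refine iSup_congr fun t => sum_congr rfl fun i _ => ?_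
  rcases Int.units_eq_one_or (ε i) with h | h
  · simp [e, h]
  · simp [e, h]

omit [NormedSpace ℝ E] in
/-- A random transversal of an array carries only a small part of the sign average. -/
lemma expect_expect_norm_selection_le [AddCommGroup κ] {B : ℝ} (hB : 0 ≤ B) (x : α × κ → E)
    (hP : ∀ y : κ → E, ∑ b, ‖y b‖ ≤ B * √(radSq y)) :
    𝔼 c : α → κ, 𝔼 ε : α → ℤˣ, ‖∑ i, ε i • x (i, c i)‖ ≤
      B / Fintype.card κ * √(radSq x) := by
  have hK : (0 : ℝ) < Fintype.card κ := by exact_mod_cast Fintype.card_pos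
  have hshift : 𝔼 c : α → κ, 𝔼 ε : α → ℤˣ, ‖∑ i, ε i • x (i, c i)‖ =
      𝔼 c : α → κ, 𝔼 b : κ, 𝔼 ε : α → ℤˣ, ‖∑ i, ε i • x (i, c i + b)‖ := by
    rw [expect_comm univ (univ : Finset κ),
      ← Fintype.expect_const (ι := κ) (𝔼 c : α → κ, _)]
    refine expect_congr rfl fun b _ => ?_
    exact (Fintype.expect_equiv (Equiv.addRight (fun _ : α => b)) _ _ fun c => rfl).symm
  rw [hshift]
  refine expect_le univ_nonempty fun c _ => ?_
  let y : (α × κ → ℤˣ) → κ → E := fun δ b => ∑ i, δ (i, c i + b) • x (i, c i + b)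
  have h1 : ∀ b : κ, 𝔼 ε : α → ℤˣ, ‖∑ i, ε i • x (i, c i + b)‖ =
      𝔼 δ : α × κ → ℤˣ, ‖y δ b‖ := fun b =>
    (expect_signs_comp (f := fun i : α => ((i, c i + b) : α × κ))
      (fun i j h => (Prod.mk.inj h).1) (fun ε => ‖∑ i, ε i • x (i, c i + b)‖)).symm
  simp_rw [h1]
  rw [expect_comm]
  have h2 : ∀ δ, 𝔼 b : κ, ‖y δ b‖ ≤ B / Fintype.card κ * √(radSq (y δ)) := by
    intro δ
    rw [Fintype.expect_eq_sum_div_card, div_mul_eq_mul_div]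
    gcongr
    exact hP _
  have h3 : 𝔼 δ, radSq (y δ) = radSq x := by
    simp only [radSq]
    rw [expect_comm, ← Fintype.expect_const (ι := κ → ℤˣ) (𝔼 δ : α × κ → ℤˣ, _)]
    refine expect_congr rfl fun η _ => ?_
    rw [← expect_signs_mul (fun p : α × κ => η (p.2 - c p.1))
      (fun δ : α × κ → ℤˣ => ‖∑ i, δ i • x i‖ ^ 2)]
    refine expect_congr rfl fun δ _ => ?_
    congr 2
    rw [Fintype.sum_prod_type, ]
    simp only [y, smul_sum, smul_smul]
    rw [sum_comm]
    refine sum_congr rfl fun i _ => ?_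
    exact Fintype.sum_equiv (Equiv.addLeft (c i)) _ _ fun b => by simp
  calc 𝔼 δ, 𝔼 b : κ, ‖y δ b‖ ≤ 𝔼 δ, B / Fintype.card κ * √(radSq (y δ)) :=
        expect_le_expect fun δ _ => h2 δ
    _ = B / Fintype.card κ * 𝔼 δ, √(radSq (y δ)) := (mul_expect _ _ _).symm
    _ ≤ B / Fintype.card κ * √(radSq x) := by
        gcongr
        refine (expect_le_sqrt_expect_sq univ univ_nonempty _).trans (le_of_eq ?_)
        rw [← h3]
        congr 1
        exact expect_congr rfl fun δ _ => sq_sqrt (radSq_nonneg _)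

/-- Every array has a transversal whose weak `ℓ₁` norm is controlled by its sign average. -/
lemma exists_selection [AddCommGroup κ] {B : ℝ} (hB : 0 ≤ B) (x : α × κ → E)
    (hP : ∀ y : κ → E, ∑ b, ‖y b‖ ≤ B * √(radSq y)) :
    ∃ c : α → κ, ∀ φ : E →L[ℝ] ℝ, ‖φ‖ ≤ 1 → ∑ i, |φ (x (i, c i))| ≤
      (√(Fintype.card α / Fintype.card κ) + 2 * (B / Fintype.card κ)) * √(radSq x) := by
  have hK : (0 : ℝ) < Fintype.card κ := by exact_mod_cast Fintype.card_pos
  let T := {φ : E →L[ℝ] ℝ // ‖φ‖ ≤ 1}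
  have : Nonempty T := ⟨⟨0, by simp⟩⟩
  have hT : ∀ (φ : T) (v : E), |φ.1 v| ≤ ‖v‖ := fun φ v => by
    simpa using φ.1.le_of_opNorm_le_of_le φ.2 (le_refl ‖v‖)
  let N : (α → κ) → ℝ := fun c => ⨆ φ : T, ∑ i, |φ.1 (x (i, c i))|
  have hNb : ∀ c : α → κ, BddAbove (Set.range fun φ : T => ∑ i, |φ.1 (x (i, c i))|) := by
    rintro c
    refine ⟨∑ i, ‖x (i, c i)‖, ?_⟩
    rintro _ ⟨φ, rfl⟩
    exact sum_le_sum fun i _ => hT φ _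
  let D : (α → κ) → (α → κ) → ℝ := fun c c' =>
    ⨆ φ : T, ∑ i, (|φ.1 (x (i, c i))| - |φ.1 (x (i, c' i))|)
  have hDb : ∀ c c' : α → κ, BddAbove (Set.range fun φ : T =>
      ∑ i, (|φ.1 (x (i, c i))| - |φ.1 (x (i, c' i))|)) := by
    rintro c c'
    refine ⟨∑ i, ‖x (i, c i)‖, ?_⟩
    rintro _ ⟨φ, rfl⟩
    exact sum_le_sum fun i _ => by linarith [hT φ (x (i, c i)), abs_nonneg (φ.1 (x (i, c' i)))]
  set w : ℝ := √(Fintype.card α / Fintype.card κ) * √(radSq x) with hw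
  have hmean : ∀ φ : T, 𝔼 c : α → κ, ∑ i, |φ.1 (x (i, c i))| ≤ w := by
    intro φ
    have h1 : ∀ i, 𝔼 c : α → κ, |φ.1 (x (i, c i))| = 𝔼 b : κ, |φ.1 (x (i, b))| := by
      intro i
      rw [← Fintype.expect_const (ι := α → κ) (𝔼 b : κ, |φ.1 (x (i, b))|)]
      calc 𝔼 c : α → κ, |φ.1 (x (i, c i))|
          = 𝔼 b : κ, 𝔼 c : α → κ, |φ.1 (x (i, c i + b))| := by
            rw [← Fintype.expect_const (ι := κ) (𝔼 c : α → κ, _)]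
            refine expect_congr rfl fun b _ => ?_
            exact (Fintype.expect_equiv (Equiv.addRight (fun _ : α => b)) _ _ fun c => rfl).symm
        _ = 𝔼 c : α → κ, 𝔼 b : κ, |φ.1 (x (i, c i + b))| := expect_comm _ _ _
        _ = _ := by
            refine expect_congr rfl fun c _ => ?_
            exact Fintype.expect_equiv (Equiv.addLeft (c i)) _ _ fun b => rfl
    rw [expect_sum_comm]
    simp_rw [h1, Fintype.expect_eq_sum_div_card]
    rw [← sum_div, ← Fintype.sum_prod_type', div_le_iff₀ hK]
    have h2 : (∑ p : α × κ, |φ.1 (x p)|) ^ 2 ≤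
        (Fintype.card α * Fintype.card κ) * radSq x := by
      refine (sq_sum_le_card_mul_sum_sq (s := univ) (f := fun p => |φ.1 (x p)|)).trans ?_
      simp only [sq_abs, card_univ, Fintype.card_prod, Nat.cast_mul]
      gcongr
      exact sum_sq_le_radSq x φ.1 φ.2
    refine (Real.le_sqrt_of_sq_le h2).trans (le_of_eq ?_)
    rw [Real.sqrt_mul (by positivity), hw, Real.sqrt_mul (by positivity),
      Real.sqrt_div (by positivity), div_mul_eq_mul_div, div_mul_eq_mul_div,
      eq_div_iff (by positivity)]
    linear_combination (√(Fintype.card α) * √(radSq x)) * Real.mul_self_sqrt hK.le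
  have hND : ∀ c, N c ≤ w + 𝔼 c' : α → κ, D c c' := by
    intro c
    refine ciSup_le fun φ => ?_
    have h1 : ∑ i, |φ.1 (x (i, c i))| = 𝔼 c' : α → κ, ∑ i, |φ.1 (x (i, c' i))| +
        𝔼 c' : α → κ, ∑ i, (|φ.1 (x (i, c i))| - |φ.1 (x (i, c' i))|) := by
      rw [← expect_add_distrib, ← Fintype.expect_const (ι := α → κ) (∑ i, |φ.1 (x (i, c i))|)]
      refine expect_congr rfl fun c' _ => ?_
      simp
    rw [h1]
    exact add_le_add (hmean φ) (expect_le_expect fun c' _ => le_ciSup (hDb c c') φ)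
  have hsymm : ∀ ε : α → ℤˣ, 𝔼 c : α → κ, 𝔼 c' : α → κ, D c c' =
      𝔼 c : α → κ, 𝔼 c' : α → κ,
        ⨆ φ : T, ∑ i, ε i • (|φ.1 (x (i, c i))| - |φ.1 (x (i, c' i))|) := fun ε =>
    expect_ciSup_sub_eq (fun i k (φ : T) => |φ.1 (x (i, k))|) ε
  have hN2 : ∀ ε : α → ℤˣ, 𝔼 c : α → κ, 𝔼 c' : α → κ, D c c' ≤
      𝔼 c : α → κ, (⨆ φ : T, ∑ i, ε i • |φ.1 (x (i, c i))|) +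
      𝔼 c : α → κ, (⨆ φ : T, ∑ i, (-ε) i • |φ.1 (x (i, c i))|) := by
    intro ε
    have hb : ∀ (ε : α → ℤˣ) (c : α → κ),
        BddAbove (Set.range fun φ : T => ∑ i, ε i • |φ.1 (x (i, c i))|) := fun ε c =>
      bddAbove_range_sum_signs (k := fun i (φ : T) => |φ.1 (x (i, c i))|)
        (fun i => ⟨‖x (i, c i)‖, fun φ => (abs_abs _).le.trans (hT φ _)⟩) ε
    rw [hsymm ε]
    have : ∀ c : α → κ, 𝔼 c' : α → κ,
        (⨆ φ : T, ∑ i, ε i • (|φ.1 (x (i, c i))| - |φ.1 (x (i, c' i))|)) ≤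
        (⨆ φ : T, ∑ i, ε i • |φ.1 (x (i, c i))|) +
        𝔼 c : α → κ, (⨆ φ : T, ∑ i, (-ε) i • |φ.1 (x (i, c i))|) := by
      intro c
      rw [← Fintype.expect_const (ι := α → κ) (⨆ φ : T, ∑ i, ε i • |φ.1 (x (i, c i))|),
        ← expect_add_distrib]
      refine expect_le_expect fun c' _ => ciSup_le fun φ => ?_
      refine le_trans (le_of_eq ?_) (add_le_add (le_ciSup (hb ε c) φ) (le_ciSup (hb (-ε) c') φ))
      simp [sum_add_distrib, sub_eq_add_neg]
    refine (expect_le_expect fun c _ => this c).trans (le_of_eq ?_)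
    rw [expect_add_distrib, Fintype.expect_const]
  have hD : 𝔼 c : α → κ, 𝔼 c' : α → κ, D c c' ≤ 2 * (B / Fintype.card κ * √(radSq x)) := by
    have hcontr : 𝔼 ε : α → ℤˣ, 𝔼 c : α → κ, (⨆ φ : T, ∑ i, ε i • |φ.1 (x (i, c i))|) ≤
        B / Fintype.card κ * √(radSq x) := by
      refine le_trans ?_ (expect_expect_norm_selection_le hB x hP)
      rw [expect_comm]
      refine expect_le_expect fun c _ => ?_
      refine (expect_ciSup_abs_le (k := fun i (φ : T) => φ.1 (x (i, c i)))
        fun i => ⟨‖x (i, c i)‖, fun φ => hT φ _⟩).trans ?_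
      refine expect_le_expect fun ε _ => ciSup_le fun φ => ?_
      refine le_trans (le_of_eq ?_) ((le_abs_self _).trans (hT φ _))
      simp [map_sum, Units.smul_def]
    have hneg : 𝔼 ε : α → ℤˣ, 𝔼 c : α → κ, (⨆ φ : T, ∑ i, (-ε) i • |φ.1 (x (i, c i))|) =
        𝔼 ε : α → ℤˣ, 𝔼 c : α → κ, (⨆ φ : T, ∑ i, ε i • |φ.1 (x (i, c i))|) :=
      Fintype.expect_equiv (Equiv.neg _) _ _ fun ε => rfl
    have := expect_le_expect fun (ε : α → ℤˣ) (_ : ε ∈ univ) => hN2 ε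
    rw [Fintype.expect_const, expect_add_distrib, hneg] at this
    linarith
  have hN : 𝔼 c, N c ≤ w + 2 * (B / Fintype.card κ * √(radSq x)) := by
    refine (expect_le_expect fun c _ => hND c).trans ?_
    rw [expect_add_distrib, Fintype.expect_const]
    linarith
  obtain ⟨c, hc⟩ : ∃ c, N c ≤ w + 2 * (B / Fintype.card κ * √(radSq x)) := by
    obtain ⟨c, -, hc⟩ := exists_le_of_expect_le univ_nonempty hN
    exact ⟨c, hc⟩
  refine ⟨c, fun φ hφ => (le_ciSup (hNb c) ⟨φ, hφ⟩).trans (hc.trans (le_of_eq ?_))⟩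
  rw [hw]; ring

end Selection

section LowerEstimates

open Finset Real

lemma sum_le_sum_range_of_exists_le {ι : Type*} (f : ι → ℝ) (g : ℕ → ℝ) (s : Finset ι)
    (h : ∀ t ⊆ s, t.Nonempty → ∃ i ∈ t, f i ≤ g #t) :
    ∑ i ∈ s, f i ≤ ∑ k ∈ range #s, g (k + 1) := by
  classical
  induction hn : #s generalizing s with
  | zero => simp [card_eq_zero.1 hn]
  | succ n ih =>
    obtain ⟨i, hi, hfi⟩ := h s subset_rfl (card_pos.1 (by omega))
    rw [sum_range_succ, ← sum_erase_add _ _ hi]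
    refine add_le_add (ih _ (fun t ht => h t (ht.trans (erase_subset _ _))) ?_) (hn ▸ hfi)
    rw [card_erase_of_mem hi, hn, Nat.add_sub_cancel]

lemma half_le_natFloor {t : ℝ} (ht : 1 ≤ t) : t / 2 ≤ ⌊t⌋₊ := by
  have h1 : (1 : ℝ) ≤ ⌊t⌋₊ := by exact_mod_cast (Nat.one_le_floor_iff t).2 ht
  linarith [Nat.lt_floor_add_one t]

variable (E : Type*) [NormedAddCommGroup E] [NormedSpace ℝ E]

/-- The sign averages of `n` vectors of norm at least `1` grow at least like `n ^ θ`. -/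
def RadLower (θ : ℝ) : Prop :=
  ∃ c > 0, ∀ (ι : Type) [Fintype ι] [DecidableEq ι] [Nonempty ι] (x : ι → E),
    (∀ i, 1 ≤ ‖x i‖) → c * (Fintype.card ι : ℝ) ^ θ ≤ √(radSq x)

/-- The weak `ℓ₁` norms of `n` vectors of norm at least `1` grow at least like `n ^ ρ`. -/
def SupLower (ρ : ℝ) : Prop :=
  ∃ c > 0, ∀ (ι : Type) [Fintype ι] [DecidableEq ι] [Nonempty ι] (x : ι → E) (S : ℝ),
    (∀ i, 1 ≤ ‖x i‖) → (∀ φ : E →L[ℝ] ℝ, ‖φ‖ ≤ 1 → ∑ i, |φ (x i)| ≤ S) →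
      c * (Fintype.card ι : ℝ) ^ ρ ≤ S

/-- Averages of norms are controlled by sign averages with gain `n ^ (-θ)`. -/
def AvgLower (θ : ℝ) : Prop :=
  ∃ A > 0, ∀ (ι : Type) [Fintype ι] [DecidableEq ι] [Nonempty ι] (x : ι → E),
    ∑ i, ‖x i‖ ≤ A * (Fintype.card ι : ℝ) ^ (1 - θ) * √(radSq x)

variable {E}

lemma radLower_zero : RadLower E 0 := by
  refine ⟨1, one_pos, fun ι _ _ _ x hx => ?_⟩
  simpa using (hx (Classical.arbitrary ι)).trans (norm_le_sqrt_radSq x _)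

lemma avgLower_zero : AvgLower E 0 := by
  refine ⟨1, one_pos, fun ι _ _ _ x => ?_⟩
  refine (sum_le_sum fun i _ => norm_le_sqrt_radSq x i).trans ?_
  simp

lemma RadLower.sum_rpow_le {θ θ' : ℝ} (h : RadLower E θ) (h0 : 0 < θ') (hθ : θ' < θ) :
    ∃ A > 0, ∀ (ι : Type) [Fintype ι] [DecidableEq ι] (x : ι → E),
      ∑ i, ‖x i‖ ^ (1 / θ') ≤ A * √(radSq x) ^ (1 / θ') := by
  obtain ⟨c, hc, h⟩ := h
  have hs : Summable fun k : ℕ => (c⁻¹ * ((k + 1 : ℕ) : ℝ) ^ (-θ)) ^ (1 / θ') := by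
    have h1 : Summable fun k : ℕ => ((k + 1 : ℕ) : ℝ) ^ (-(θ / θ')) :=
      (summable_nat_add_iff 1).2 (Real.summable_nat_rpow.2 (by
        rw [neg_lt_neg_iff, one_lt_div h0]; exact hθ))
    refine (h1.mul_left ((c⁻¹) ^ (1 / θ'))).congr fun k => ?_
    rw [Real.mul_rpow (by positivity) (by positivity), ← Real.rpow_mul (by positivity)]
    congr 2
    ring
  refine ⟨∑' k : ℕ, (c⁻¹ * ((k + 1 : ℕ) : ℝ) ^ (-θ)) ^ (1 / θ'),
    hs.tsum_pos (fun k => by positivity) 0 (by positivity), fun ι _ _ x => ?_⟩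
  refine (sum_le_sum_range_of_exists_le (fun i => ‖x i‖ ^ (1 / θ'))
    (fun k => (c⁻¹ * (k : ℝ) ^ (-θ)) ^ (1 / θ') * √(radSq x) ^ (1 / θ')) univ ?_).trans ?_
  · intro t _ ht
    obtain ⟨i, hi, hmin⟩ := exists_min_image t (fun i => ‖x i‖) ht
    refine ⟨i, hi, ?_⟩
    rw [← Real.mul_rpow (by positivity) (sqrt_nonneg _)]
    refine Real.rpow_le_rpow (norm_nonneg _) ?_ (by positivity)
    rcases (norm_nonneg (x i)).eq_or_lt with h0 | hpos
    · rw [← h0]; positivity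
    have : Nonempty t := ⟨⟨i, hi⟩⟩
    have h1 := h t (fun j => ‖x i‖⁻¹ • x j) fun j => by
      rw [norm_smul, norm_inv, norm_norm, ← div_eq_inv_mul, one_le_div hpos]
      exact hmin j j.2
    rw [radSq_smul, Real.sqrt_mul (sq_nonneg _), Real.sqrt_sq (by positivity),
      Fintype.card_coe] at h1
    have h2 : √(radSq fun j : t => x j) ≤ √(radSq x) :=
      Real.sqrt_le_sqrt (radSq_comp_le Subtype.val_injective x)
    have ht0 : (0 : ℝ) < #t := by exact_mod_cast ht.card_pos
    have h3 : c * (#t : ℝ) ^ θ * ‖x i‖ ≤ √(radSq x) := by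
      calc c * (#t : ℝ) ^ θ * ‖x i‖ ≤ ‖x i‖⁻¹ * √(radSq fun j : t => x j) * ‖x i‖ := by gcongr
        _ = √(radSq fun j : t => x j) := by field_simp
        _ ≤ _ := h2
    rw [Real.rpow_neg ht0.le, ← mul_inv, ← div_eq_inv_mul, le_div_iff₀ (by positivity)]
    linarith
  · rw [← sum_mul]
    gcongr
    exact hs.sum_le_tsum _ fun k _ => by positivity

lemma RadLower.avgLower {θ θ' : ℝ} (h : RadLower E θ) (h0 : 0 < θ') (hθ : θ' < θ)
    (h1 : θ' ≤ 1) : AvgLower E θ' := by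
  obtain ⟨A, hA, h⟩ := h.sum_rpow_le h0 hθ
  refine ⟨A ^ θ', by positivity, fun ι _ _ _ x => ?_⟩
  have h2 := Real.rpow_sum_le_const_mul_sum_rpow univ (fun i => ‖x i‖) (p := 1 / θ')
    ((one_le_div h0).2 h1)
  simp only [abs_norm, card_univ] at h2
  have h3 := h2.trans (mul_le_mul_of_nonneg_left (h ι x) (by positivity))
  have h4 := Real.rpow_le_rpow (by positivity) h3 h0.le
  rw [← Real.rpow_mul (by positivity), one_div_mul_cancel h0.ne', Real.rpow_one,
    Real.mul_rpow (by positivity) (by positivity), Real.mul_rpow (by positivity) (by positivity),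
    ← Real.rpow_mul (by positivity), ← Real.rpow_mul (by positivity), one_div_mul_cancel h0.ne',
    Real.rpow_one] at h4
  have h5 : (1 / θ' - 1) * θ' = 1 - θ' := by field_simp
  rw [h5] at h4
  linarith

/-- Lower estimates for weak `ℓ₁` norms improve lower estimates for sign averages. -/
lemma SupLower.radLower {θ ρ : ℝ} (hρ : SupLower E ρ) (hρ0 : 0 ≤ ρ) (hA : AvgLower E θ)
    (h0 : 0 ≤ θ) (h1 : θ < 1 / 2) :
    RadLower E (((1 - 2 * θ) * ρ + θ) / (2 - 2 * θ)) := by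
  obtain ⟨c, hc, hρ⟩ := hρ
  obtain ⟨A, hA0, hA⟩ := hA
  set e := (1 - 2 * θ) * ρ + θ with he
  have he0 : 0 ≤ e := add_nonneg (mul_nonneg (by linarith) hρ0) h0
  refine ⟨c / (1 + 2 * A) * (1 / 2) ^ ρ * (1 / 2) ^ e, by positivity, fun ι _ _ _ x hx => ?_⟩
  have hn : (1 : ℝ) ≤ Fintype.card ι := by exact_mod_cast Fintype.card_pos
  set n : ℝ := (Fintype.card ι : ℝ) with hn_def
  set K := ⌊n ^ (1 / (2 - 2 * θ))⌋₊ with hK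
  have hd : 0 < 2 - 2 * θ := by linarith
  have hK' : 1 ≤ n ^ (1 / (2 - 2 * θ)) := Real.one_le_rpow hn (by positivity)
  have hK1 : 1 ≤ K := (Nat.one_le_floor_iff _).2 hK'
  have hK1' : (1 : ℝ) ≤ K := by exact_mod_cast hK1
  have hKle : (K : ℝ) ≤ n ^ (1 / (2 - 2 * θ)) := Nat.floor_le (by positivity)
  set m := ⌊(K : ℝ) ^ (1 - 2 * θ)⌋₊ with hm
  have hm' : 1 ≤ (K : ℝ) ^ (1 - 2 * θ) := Real.one_le_rpow hK1' (by linarith)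
  have hm1 : 1 ≤ m := (Nat.one_le_floor_iff _).2 hm'
  have hmle : (m : ℝ) ≤ (K : ℝ) ^ (1 - 2 * θ) := Nat.floor_le (by positivity)
  have hK0 : (0 : ℝ) < K := by linarith
  have hmK : m * K ≤ Fintype.card ι := by
    have : (m : ℝ) * K ≤ n := by
      calc (m : ℝ) * K ≤ (K : ℝ) ^ (1 - 2 * θ) * K := by gcongr
        _ = (K : ℝ) ^ (2 - 2 * θ) := by
          rw [← Real.rpow_add_one hK0.ne']; congr 1; ring
        _ ≤ (n ^ (1 / (2 - 2 * θ))) ^ (2 - 2 * θ) := by gcongr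
        _ = n := by
          rw [← Real.rpow_mul (by positivity), one_div_mul_cancel hd.ne', Real.rpow_one]
    rw [hn_def] at this
    exact_mod_cast this
  have : NeZero K := ⟨by omega⟩
  have : Nonempty (Fin m) := ⟨⟨0, hm1⟩⟩
  obtain ⟨f⟩ : Nonempty (Fin m × Fin K ↪ ι) :=
    Function.Embedding.nonempty_of_card_le (by simpa using hmK)
  obtain ⟨s, hs⟩ := exists_selection (B := A * (K : ℝ) ^ (1 - θ)) (by positivity) (x ∘ f)
    fun y => by simpa using hA (Fin K) y
  have h2 := hρ (Fin m) (fun i => (x ∘ f) (i, s i)) _ (fun i => hx _) hs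
  simp only [Fintype.card_fin] at h2
  have h3 : √((m : ℝ) / K) ≤ (K : ℝ) ^ (-θ) := by
    refine Real.sqrt_le_iff.2 ⟨by positivity, ?_⟩
    rw [div_le_iff₀ hK0, ← Real.rpow_natCast, ← Real.rpow_mul hK0.le, ← Real.rpow_add_one hK0.ne']
    refine hmle.trans (le_of_eq ?_)
    congr 1
    push_cast
    ring
  have h4 : A * (K : ℝ) ^ (1 - θ) / K = A * (K : ℝ) ^ (-θ) := by
    rw [mul_div_assoc, ← Real.rpow_sub_one hK0.ne']
    congr 2
    ring
  rw [h4] at h2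
  have h5 : c * (m : ℝ) ^ ρ ≤ ((1 + 2 * A) * (K : ℝ) ^ (-θ)) * √(radSq x) := by
    refine h2.trans ?_
    gcongr
    · linarith
    · exact radSq_comp_le f.injective x
  have h6 : (1 / 2) ^ ρ * (K : ℝ) ^ ((1 - 2 * θ) * ρ) ≤ (m : ℝ) ^ ρ := by
    rw [Real.rpow_mul hK0.le, ← Real.mul_rpow (by positivity) (by positivity)]
    refine Real.rpow_le_rpow (by positivity) ?_ hρ0
    linarith [half_le_natFloor hm']
  have h7 : (1 / 2) ^ e * n ^ (e / (2 - 2 * θ)) ≤ (K : ℝ) ^ e := by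
    rw [div_eq_inv_mul e, ← one_div, Real.rpow_mul (by positivity),
      ← Real.mul_rpow (by positivity) (by positivity)]
    refine Real.rpow_le_rpow (by positivity) ?_ he0
    linarith [half_le_natFloor hK']
  have h8 : (K : ℝ) ^ e = (K : ℝ) ^ ((1 - 2 * θ) * ρ) * (K : ℝ) ^ θ := by
    rw [he, Real.rpow_add hK0]
  have h9 : (K : ℝ) ^ (-θ) * (K : ℝ) ^ θ = 1 := by
    rw [← Real.rpow_add hK0]; simp
  calc c / (1 + 2 * A) * (1 / 2) ^ ρ * (1 / 2) ^ e * n ^ (e / (2 - 2 * θ))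
      = c / (1 + 2 * A) * (1 / 2) ^ ρ * ((1 / 2) ^ e * n ^ (e / (2 - 2 * θ))) := by ring
    _ ≤ c / (1 + 2 * A) * (1 / 2) ^ ρ * (K : ℝ) ^ e := by gcongr
    _ = (c * ((1 / 2) ^ ρ * (K : ℝ) ^ ((1 - 2 * θ) * ρ))) * (K : ℝ) ^ θ / (1 + 2 * A) := by
      rw [h8]; ring
    _ ≤ (((1 + 2 * A) * (K : ℝ) ^ (-θ)) * √(radSq x)) * (K : ℝ) ^ θ / (1 + 2 * A) :=
      div_le_div_of_nonneg_right (mul_le_mul_of_nonneg_right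
        ((mul_le_mul_of_nonneg_left h6 hc.le).trans h5) (by positivity)) (by positivity)
    _ = √(radSq x) * ((K : ℝ) ^ (-θ) * (K : ℝ) ^ θ) := by field_simp
    _ = √(radSq x) := by rw [h9, mul_one]

end LowerEstimates

section SummingConstants

open Finset Real

variable {E : Type*} [NormedAddCommGroup E] [NormedSpace ℝ E]

lemma exists_one_le_abs_apply {x : E} (hx : 1 ≤ ‖x‖) :
    ∃ φ : E →L[ℝ] ℝ, ‖φ‖ ≤ 1 ∧ 1 ≤ |φ x| := by
  obtain ⟨φ, h1, h2⟩ := exists_dual_vector'' ℝ x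
  exact ⟨φ, h1, by rw [h2]; simpa using hx⟩

lemma AbsolutelySumming.exists_card_le {a b : ℝ} (hb : 1 ≤ b) (hab : b ≤ a)
    (h : AbsolutelySumming a b (ContinuousLinearMap.id ℝ E)) :
    ∃ D > 0, ∀ (ι : Type) [Fintype ι] [Nonempty ι] (x : ι → E) (W : ℝ), (∀ i, 1 ≤ ‖x i‖) →
      (∀ φ : E →L[ℝ] ℝ, ‖φ‖ ≤ 1 → ∑ i, |φ (x i)| ^ b ≤ W) →
        (Fintype.card ι : ℝ) ≤ D * W ^ (a / b) := by
  have hb0 : 0 < b := by linarith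
  by_contra! hcon
  have hcon' (k : ℕ) := hcon ((2 ^ k) ^ (a / b)) (by positivity)
  choose ι hι hne x W hx hW hcard using hcon'
  have hW0 (k : ℕ) : 0 < W k := by
    obtain ⟨φ, h1, h2⟩ := exists_one_le_abs_apply (hx k (Classical.arbitrary _))
    refine lt_of_lt_of_le ?_ (hW k φ h1)
    exact sum_pos' (fun _ _ => by positivity)
      ⟨_, mem_univ (Classical.arbitrary _), Real.rpow_pos_of_pos (by linarith) _⟩
  set l : ℕ → ℝ := fun k => (2 ^ k * W k) ^ (-(1 / b)) with hl
  have hl0 (k : ℕ) : 0 < l k := Real.rpow_pos_of_pos (by have := hW0 k; positivity) _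
  have hlp (k : ℕ) (p : ℝ) : l k ^ p = ((2 ^ k * W k) ^ (p / b))⁻¹ := by
    have := hW0 k
    rw [hl, ← Real.rpow_mul (by positivity), ← Real.rpow_neg (by positivity)]
    congr 1
    ring
  set y : (Σ k, ι k) → E := fun p => l p.1 • x p.1 p.2 with hy
  have hinf : Infinite (Σ k, ι k) :=
    Infinite.of_surjective Sigma.fst fun k => ⟨⟨k, Classical.arbitrary _⟩, rfl⟩
  obtain ⟨hden⟩ := nonempty_denumerable (Σ k, ι k)
  have e : ℕ ≃ Σ k, ι k := (Denumerable.eqv _).symm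
  have hweak : WeaklySummable b (y ∘ e) := by
    intro φ
    refine (e.summable_iff (f := fun p => |φ (y p)| ^ b)).2 ?_
    refine (summable_sigma_of_nonneg fun p => by positivity).2
      ⟨fun k => (hasSum_fintype _).summable, ?_⟩
    refine Summable.of_nonneg_of_le (fun k => tsum_nonneg fun i => by positivity) (fun k => ?_)
      (summable_geometric_two.mul_left ((‖φ‖ + 1) ^ b))
    have hφ : 0 < ‖φ‖ + 1 := by positivity
    have h1 := hW k ((‖φ‖ + 1)⁻¹ • φ) (by
      rw [norm_smul, norm_inv, Real.norm_of_nonneg hφ.le, inv_mul_le_iff₀ hφ]; linarith)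
    have h2 (i : ι k) : |φ (y ⟨k, i⟩)| ^ b
        = l k ^ b * (‖φ‖ + 1) ^ b * |((‖φ‖ + 1)⁻¹ • φ) (x k i)| ^ b := by
      rw [← Real.mul_rpow (hl0 k).le hφ.le, ← Real.mul_rpow (by have := hl0 k; positivity)
        (abs_nonneg _)]
      simp only [hy, map_smul, smul_eq_mul, abs_mul, abs_of_pos (hl0 k),
        smul_apply, abs_inv, abs_of_pos hφ]
      congr 1
      field_simp
    rw [tsum_fintype, sum_congr rfl fun i _ => h2 i, ← mul_sum, hlp, div_self hb0.ne',
      Real.rpow_one]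
    have := hW0 k
    calc (2 ^ k * W k)⁻¹ * (‖φ‖ + 1) ^ b * ∑ i, |((‖φ‖ + 1)⁻¹ • φ) (x k i)| ^ b
        ≤ (2 ^ k * W k)⁻¹ * (‖φ‖ + 1) ^ b * W k := by gcongr
      _ = (‖φ‖ + 1) ^ b * (1 / 2) ^ k := by
        rw [one_div, inv_pow]; field_simp
  have hs : Summable fun p => ‖y p‖ ^ a := (e.summable_iff (f := fun p => ‖y p‖ ^ a)).1 (h _ hweak)
  have hs0 := hs.sigma.tendsto_atTop_zero
  refine absurd (ge_of_tendsto' hs0 fun k => ?_) (not_le.2 (zero_lt_one' ℝ))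
  rw [tsum_fintype]
  have := hW0 k
  have ha : 0 ≤ a := by linarith
  calc (1 : ℝ) = ((2 ^ k) ^ (a / b) * W k ^ (a / b)) * l k ^ a := by
        rw [hlp, ← Real.mul_rpow (by positivity) (by positivity), mul_inv_cancel₀ (by positivity)]
    _ ≤ Fintype.card (ι k) * l k ^ a := by have := hl0 k; gcongr; exact (hcard k).le
    _ = ∑ i : ι k, l k ^ a := by simp
    _ ≤ ∑ i : ι k, ‖y ⟨k, i⟩‖ ^ a := by
      refine sum_le_sum fun i _ => Real.rpow_le_rpow (hl0 k).le ?_ ha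
      rw [hy, norm_smul, Real.norm_of_nonneg (hl0 k).le]
      exact le_mul_of_one_le_right (hl0 k).le (hx k i)

lemma WeaklySummable.mono {b b' : ℝ} (h0 : 0 < b') (hbb : b' ≤ b) {x : ℕ → E}
    (h : WeaklySummable b' x) : WeaklySummable b x := by
  intro φ
  refine (h φ).of_norm_bounded_eventually_nat ?_
  have h1 := (h φ).tendsto_atTop_zero.eventually (gt_mem_nhds one_pos)
  filter_upwards [h1] with j hj
  rw [Real.norm_of_nonneg (by positivity)]
  have h2 : |φ (x j)| ≤ 1 := by
    by_contra! h3
    exact absurd hj (not_lt.2 (Real.one_le_rpow h3.le h0.le))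
  exact Real.rpow_le_rpow_of_exponent_ge' (abs_nonneg _) h2 h0.le hbb

lemma AbsolutelySumming.anti {F : Type*} [NormedAddCommGroup F] [NormedSpace ℝ F] {a b b' : ℝ}
    {u : E →L[ℝ] F} (h : AbsolutelySumming a b u) (h0 : 0 < b') (hbb : b' ≤ b) :
    AbsolutelySumming a b' u := fun x hx => h x (hx.mono h0 hbb)

end SummingConstants

section DvoretzkyRogers

open Finset Module

section Det

variable {H : Type*} [NormedAddCommGroup H] [InnerProductSpace ℝ H] [FiniteDimensional ℝ H]

lemma Submodule.det_id_add_starProjection (V : Submodule ℝ H) :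
    LinearMap.det (LinearMap.id + (V.starProjection : H →ₗ[ℝ] H)) = 2 ^ finrank ℝ V := by
  let e := V.prodEquivOfIsCompl _ V.isCompl_orthogonal
  let b := (finBasis ℝ V).prod (finBasis ℝ Vᗮ)
  have h : LinearMap.toMatrix b b
      (e.symm ∘ₗ (LinearMap.id + (V.starProjection : H →ₗ[ℝ] H)) ∘ₗ e.symm.symm) =
      Matrix.fromBlocks ((2 : ℝ) • 1) 0 0 1 := by
    have h1 (v : V) : e.symm ((v : H) + v) = (v + v, 0) := by
      rw [LinearEquiv.symm_apply_eq]; simp [e]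
    have h2 (v : Vᗮ) : e.symm (v : H) = (0, v) := by
      rw [LinearEquiv.symm_apply_eq]; simp [e]
    have h3 (v : V) : V.starProjection (v : H) = v := V.starProjection_eq_self_iff.2 v.2
    have h4 (v : Vᗮ) : V.starProjection (v : H) = 0 :=
      (V.starProjection_apply_eq_zero_iff).2 v.2
    have h5 (v : V) : e (v, 0) = v := by simp [e]
    have h6 (v : Vᗮ) : e (0, v) = v := by simp [e]
    ext (i | i) (j | j)
    · simp [LinearMap.toMatrix_apply, b, h1, h3, h5, Matrix.one_apply, Finsupp.single_apply,
        eq_comm, ← two_mul]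
    · simp [LinearMap.toMatrix_apply, b, h2, h4, h6]
    · simp [LinearMap.toMatrix_apply, b, h1, h3, h5]
    · simp [LinearMap.toMatrix_apply, b, h2, h4, h6, Matrix.one_apply, Finsupp.single_apply,
        eq_comm]
  rw [← LinearMap.det_conj _ e.symm, ← LinearMap.det_toMatrix b, h, Matrix.det_fromBlocks_zero₂₁,
    Matrix.det_one, mul_one, Matrix.det_smul, Matrix.det_one, mul_one, Fintype.card_fin]

variable {E : Type*} [NormedAddCommGroup E] [NormedSpace ℝ E]

lemma exists_isMaxOn_det {j : H →L[ℝ] E} (hj : Function.Injective j) :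
    ∃ A : H →L[ℝ] H, ‖j ∘L A‖ ≤ 1 ∧ 0 < |A.det| ∧
      ∀ B : H →L[ℝ] H, ‖j ∘L B‖ ≤ 1 → |B.det| ≤ |A.det| := by
  set s : Set (H →L[ℝ] H) := {A | ‖j ∘L A‖ ≤ 1} with hs
  have hcl : IsClosed s :=
    isClosed_le (((ContinuousLinearMap.compL ℝ H H E j).continuous).norm) continuous_const
  obtain ⟨K, -, hK⟩ := (LinearMap.injective_iff_antilipschitz (j : H →ₗ[ℝ] E)).1 hj
  have hb : Bornology.IsBounded s := by
    refine isBounded_iff_forall_norm_le.2 ⟨K, fun A hA => ?_⟩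
    refine A.opNorm_le_bound K.2 fun v => ?_
    have h1 := ZeroHomClass.bound_of_antilipschitz (j : H →ₗ[ℝ] E) hK (A v)
    have h2 := (j ∘L A).le_of_opNorm_le hA v
    exact h1.trans (mul_le_mul_of_nonneg_left (by simpa using h2) K.2)
  have hε : (‖j‖ + 1)⁻¹ • ContinuousLinearMap.id ℝ H ∈ s := by
    have h0 : 0 < ‖j‖ + 1 := by positivity
    simp only [hs, Set.mem_ofPred_eq, ContinuousLinearMap.comp_smul, ContinuousLinearMap.comp_id,
      norm_smul, norm_inv, Real.norm_of_nonneg h0.le]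
    rw [inv_mul_le_iff₀ h0]
    linarith
  obtain ⟨A, hA, hmax⟩ := (Metric.isCompact_of_isClosed_isBounded hcl hb).exists_isMaxOn ⟨_, hε⟩
    (ContinuousLinearMap.continuous_det (𝕜 := ℝ) (E := H)).abs.continuousOn
  refine ⟨A, hA, lt_of_lt_of_le ?_ (hmax hε), fun B hB => hmax hB⟩
  simp only [ContinuousLinearMap.det, ContinuousLinearMap.toLinearMap_smul, LinearMap.det_smul,
    ContinuousLinearMap.coe_id, LinearMap.det_id, mul_one]
  positivity

end Det

variable {E : Type*} [NormedAddCommGroup E] [NormedSpace ℝ E]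

lemma exists_injective_euclideanSpace (hE : ¬ FiniteDimensional ℝ E) (N : ℕ) :
    ∃ j : EuclideanSpace ℝ (Fin N) →L[ℝ] E, Function.Injective j := by
  have h : (N : Cardinal) ≤ Module.rank ℝ E := by
    rw [FiniteDimensional, ← rank_lt_aleph0_iff, not_lt] at hE
    exact (Cardinal.natCast_lt_aleph0).le.trans hE
  obtain ⟨f, hf⟩ := exists_linearIndependent_of_le_rank h
  refine ⟨LinearMap.toContinuousLinearMap
    (Fintype.linearCombination ℝ f ∘ₗ (WithLp.linearEquiv 2 ℝ (Fin N → ℝ)).toLinearMap), ?_⟩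
  exact (linearIndependent_iff_injective_fintypeLinearCombination.1 hf).comp (WithLp.linearEquiv 2 ℝ _).injective

lemma exists_quarter_lt_of_isMax {H : Type*} [NormedAddCommGroup H] [InnerProductSpace ℝ H]
    [FiniteDimensional ℝ H] {j : H →L[ℝ] E} {A : H →L[ℝ] H} (hA : ‖j ∘L A‖ ≤ 1)
    (hdet : 0 < |A.det|) (hmax : ∀ B : H →L[ℝ] H, ‖j ∘L B‖ ≤ 1 → |B.det| ≤ |A.det|)
    (V : Submodule ℝ H) (hV : finrank ℝ H ≤ 2 * finrank ℝ V) (hV0 : 0 < finrank ℝ V) :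
    ∃ v ∈ V, ‖v‖ = 1 ∧ 1 / 4 ≤ ‖j (A v)‖ := by
  by_contra! hcon
  have hsmall (v : H) (hv : v ∈ V) : ‖j (A v)‖ ≤ 1 / 4 * ‖v‖ := by
    rcases eq_or_ne v 0 with rfl | h0
    · simp
    have h0' : 0 < ‖v‖ := norm_pos_iff.2 h0
    have h1 := hcon (‖v‖⁻¹ • v) (V.smul_mem _ hv) (norm_smul_inv_norm h0)
    rw [map_smul, map_smul, norm_smul, norm_inv, norm_norm, inv_mul_lt_iff₀ h0'] at h1
    linarith
  set B : H →L[ℝ] H := (4 / 5 : ℝ) • (A ∘L (ContinuousLinearMap.id ℝ H + V.starProjection))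
  have hB : ‖j ∘L B‖ ≤ 1 := by
    refine ContinuousLinearMap.opNorm_le_bound _ zero_le_one fun v => ?_
    have h1 : (j ∘L B) v = (4 / 5 : ℝ) • (j (A v) + j (A (V.starProjection v))) := by simp [B]
    have h2 := (j ∘L A).le_of_opNorm_le hA v
    have h3 := hsmall _ (V.starProjection_apply_mem v)
    have h4 := V.norm_starProjection_apply_le v
    rw [h1, norm_smul, Real.norm_of_nonneg (by norm_num)]
    have h5 := norm_add_le (j (A v)) (j (A (V.starProjection v)))
    simp only [ContinuousLinearMap.comp_apply] at h2
    linarith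
  have h1 := hmax B hB
  have h2 : B.det = (4 / 5) ^ finrank ℝ H * (A.det * 2 ^ finrank ℝ V) := by
    rw [← V.det_id_add_starProjection]
    simp only [B, ContinuousLinearMap.det, ContinuousLinearMap.toLinearMap_smul,
      LinearMap.det_smul]
    exact congrArg _ (LinearMap.det_comp _ _)
  rw [h2, abs_mul, abs_mul, abs_of_nonneg (by positivity : (0 : ℝ) ≤ (4 / 5) ^ finrank ℝ H),
    abs_of_nonneg (by positivity : (0 : ℝ) ≤ 2 ^ finrank ℝ V)] at h1
  have h3 : ((4 / 5 : ℝ) ^ 2) ^ finrank ℝ V ≤ (4 / 5) ^ finrank ℝ H := by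
    rw [← pow_mul]
    exact pow_le_pow_of_le_one (by norm_num) (by norm_num) hV
  have h4 : (1 : ℝ) < ((4 / 5) ^ 2) ^ finrank ℝ V * 2 ^ finrank ℝ V := by
    rw [← mul_pow]
    exact one_lt_pow₀ (by norm_num) hV0.ne'
  have h5 : ((4 / 5 : ℝ) ^ 2) ^ finrank ℝ V * 2 ^ finrank ℝ V
      ≤ (4 / 5) ^ finrank ℝ H * 2 ^ finrank ℝ V := by gcongr
  nlinarith

/-- Dvoretzky–Rogers lemma. -/
lemma exists_quarter_le_norm_of_infinite (hE : ¬ FiniteDimensional ℝ E) (n : ℕ) :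
    ∃ x : Fin n → E, (∀ i, 1 / 4 ≤ ‖x i‖) ∧
      ∀ φ : E →L[ℝ] ℝ, ‖φ‖ ≤ 1 → ∑ i, |φ (x i)| ^ 2 ≤ 1 := by
  obtain ⟨j, hj⟩ := exists_injective_euclideanSpace hE (2 * n)
  obtain ⟨A, hA, hdet, hmax⟩ := exists_isMaxOn_det hj
  have key : ∀ k ≤ n, ∃ e : Fin k → EuclideanSpace ℝ (Fin (2 * n)),
      Orthonormal ℝ e ∧ ∀ i, 1 / 4 ≤ ‖j (A (e i))‖ := by
    intro k
    induction k with
    | zero => exact fun _ => ⟨Fin.elim0, ⟨fun i => i.elim0, fun i => i.elim0⟩, fun i => i.elim0⟩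
    | succ k ih =>
      intro hk
      obtain ⟨e, he, hq⟩ := ih (by omega)
      have h1 := (Submodule.span ℝ (Set.range e)).finrank_add_finrank_orthogonal
      rw [finrank_span_eq_card he.linearIndependent, Fintype.card_fin,
        finrank_euclideanSpace_fin] at h1
      obtain ⟨v, hv, hv1, hvq⟩ := exists_quarter_lt_of_isMax hA hdet hmax
        (Submodule.span ℝ (Set.range e))ᗮ (by rw [finrank_euclideanSpace_fin]; omega) (by omega)
      have hve (i : Fin k) : inner ℝ (e i) v = 0 :=
        (Submodule.mem_orthogonal _ _).1 hv _ (Submodule.subset_span ⟨i, rfl⟩)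
      refine ⟨Fin.cons v e, ⟨Fin.cases hv1 he.1, ?_⟩, Fin.cases hvq hq⟩
      intro p q hpq
      induction p using Fin.cases with
      | zero =>
        induction q using Fin.cases with
        | zero => exact absurd rfl hpq
        | succ q => rw [real_inner_comm]; exact hve q
      | succ p =>
        induction q using Fin.cases with
        | zero => exact hve p
        | succ q => exact he.2 fun h => hpq (congrArg Fin.succ h)
  obtain ⟨e, he, hq⟩ := key n le_rfl
  refine ⟨fun i => j (A (e i)), hq, fun φ hφ => ?_⟩
  set ψ := φ ∘L (j ∘L A)
  have hψ : ‖ψ‖ ≤ 1 :=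
    (ContinuousLinearMap.opNorm_comp_le _ _).trans (mul_le_one₀ hφ (norm_nonneg _) hA)
  set w := (InnerProductSpace.toDual ℝ (EuclideanSpace ℝ (Fin (2 * n)))).symm ψ
  have hw : ‖w‖ ≤ 1 := by simpa [w] using hψ
  have h1 (i : Fin n) : |φ (j (A (e i)))| = ‖inner ℝ (e i) w‖ := by
    rw [real_inner_comm, InnerProductSpace.toDual_symm_apply]; rfl
  calc ∑ i, |φ (j (A (e i)))| ^ 2 = ∑ i, ‖inner ℝ (e i) w‖ ^ 2 := by simp only [h1]
    _ ≤ ‖w‖ ^ 2 := he.sum_inner_products_le w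
    _ ≤ 1 := pow_le_one₀ (norm_nonneg _) hw

lemma AbsolutelySumming.finiteDimensional {a b : ℝ} (hb : 2 ≤ b) (hab : b ≤ a)
    (h : AbsolutelySumming a b (ContinuousLinearMap.id ℝ E)) : FiniteDimensional ℝ E := by
  by_contra hE
  obtain ⟨D, hD, hcard⟩ := (h.anti two_pos hb).exists_card_le one_le_two (hb.trans hab)
  obtain ⟨n, hn⟩ := exists_nat_gt (D * 16 ^ (a / 2))
  obtain ⟨x, hx, hw⟩ := exists_quarter_le_norm_of_infinite hE n
  have : Nonempty (Fin n) := ⟨⟨0, by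
    rw [← Nat.cast_pos (α := ℝ)]; exact lt_trans (by positivity) hn⟩⟩
  have h1 := hcard (Fin n) (fun i => (4 : ℝ) • x i) 16
    (fun i => by rw [norm_smul, Real.norm_of_nonneg (by norm_num)]; linarith [hx i])
    fun φ hφ => by
      have h2 (i : Fin n) : |φ ((4 : ℝ) • x i)| ^ (2 : ℝ) = 16 * |φ (x i)| ^ 2 := by
        rw [map_smul, smul_eq_mul, abs_mul, Real.rpow_two, mul_pow]; norm_num
      simp only [h2]
      rw [← mul_sum]
      linarith [hw φ hφ]
  rw [Fintype.card_fin] at h1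
  linarith

end DvoretzkyRogers

section WeakLowerEstimates

open Finset Real

lemma exists_pairwiseDisjoint_of_forall_exists {ι : Type*} [Fintype ι] [DecidableEq ι]
    (P : Finset ι → Prop)
    (h : ∀ J : Finset ι, Fintype.card ι ≤ 2 * #J → ∃ B ⊆ J, B.Nonempty ∧ P B) :
    ∃ 𝓑 : Finset (Finset ι), (𝓑 : Set (Finset ι)).PairwiseDisjoint id ∧ (∀ B ∈ 𝓑, P B) ∧
      Fintype.card ι ≤ 2 * ∑ B ∈ 𝓑, #B := by
  classical
  set F : Finset (Finset (Finset ι)) :=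
    {𝓑 | (𝓑 : Set (Finset ι)).PairwiseDisjoint id ∧ ∀ B ∈ 𝓑, P B}
  obtain ⟨𝓑, h𝓑, hmax⟩ := exists_max_image F (fun 𝓑 => ∑ B ∈ 𝓑, #B) ⟨∅, by simp [F]⟩
  simp only [F, mem_filter, mem_univ, true_and] at h𝓑 hmax
  refine ⟨𝓑, h𝓑.1, h𝓑.2, ?_⟩
  by_contra! hlt
  have h1 : #(𝓑.biUnion id) = ∑ B ∈ 𝓑, #B := card_biUnion h𝓑.1
  obtain ⟨B, hB, hne, hPB⟩ := h (𝓑.biUnion id)ᶜ (by rw [card_compl, h1]; omega)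
  have hdisj (C : Finset ι) (hC : C ∈ 𝓑) : Disjoint B C :=
    (disjoint_compl_left (a := 𝓑.biUnion id)).mono hB (subset_biUnion_of_mem id hC)
  have hnot : B ∉ 𝓑 := fun hmem => hne.ne_empty (disjoint_self.1 (hdisj B hmem))
  have h2 := hmax (insert B 𝓑) ⟨by
    rw [coe_insert]
    exact h𝓑.1.insert fun C hC _ => hdisj C hC, fun C hC => by
    rcases mem_insert.1 hC with rfl | hC
    exacts [hPB, h𝓑.2 C hC]⟩
  rw [sum_insert hnot] at h2
  have := hne.card_pos
  omega

lemma sum_range_inv_le {δ : ℝ} (hδ : 0 < δ) {m n : ℕ} (hmn : m ≤ n) (hn : 1 ≤ n) :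
    ∑ k ∈ range m, ((k + 1 : ℕ) : ℝ)⁻¹ ≤ (1 + 1 / δ) * (n : ℝ) ^ δ := by
  have hn' : (1 : ℝ) ≤ n := by exact_mod_cast hn
  have h1 : ∑ k ∈ range m, ((k + 1 : ℕ) : ℝ)⁻¹ ≤ ∑ k ∈ range n, ((k + 1 : ℕ) : ℝ)⁻¹ :=
    sum_le_sum_of_subset_of_nonneg (range_subset_range.2 hmn) fun _ _ _ => by positivity
  have h2 : ∑ k ∈ range n, ((k + 1 : ℕ) : ℝ)⁻¹ ≤ 1 + Real.log n := by
    have := harmonic_le_one_add_log n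
    simpa [harmonic] using this
  have h3 := Real.log_le_rpow_div (Nat.cast_nonneg n) hδ
  have h4 : 1 ≤ (n : ℝ) ^ δ := Real.one_le_rpow hn' hδ.le
  calc _ ≤ 1 + Real.log n := h1.trans h2
    _ ≤ (n : ℝ) ^ δ + (n : ℝ) ^ δ / δ := add_le_add h4 h3
    _ = _ := by ring

variable {E : Type*} [NormedAddCommGroup E] [NormedSpace ℝ E]

lemma AbsolutelySumming.exists_large_block {a b : ℝ} (hb : 1 ≤ b) (hab : b ≤ a)
    (h : AbsolutelySumming a b (ContinuousLinearMap.id ℝ E)) :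
    ∃ c > 0, ∀ (ι : Type) [Fintype ι] [Nonempty ι] (x : ι → E), (∀ i, 1 ≤ ‖x i‖) →
      ∀ J : Finset ι, Fintype.card ι ≤ 2 * #J → ∃ B ⊆ J, B.Nonempty ∧
        ∃ φ : E →L[ℝ] ℝ, ‖φ‖ ≤ 1 ∧
          c * (Fintype.card ι : ℝ) ^ (1 / (2 * a)) * (#B : ℝ) ^ (1 - 1 / b) ≤
            ∑ i ∈ B, |φ (x i)| := by
  have hb0 : 0 < b := by linarith
  have ha0 : 0 < a := by linarith
  obtain ⟨D, hD, hcard⟩ := h.exists_card_le hb hab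
  set δ := b / (2 * a) with hδ
  have hδ0 : 0 < δ := by positivity
  set C := 1 + 1 / δ
  have hC : 0 < C := by positivity
  refine ⟨(4 * D * C ^ (a / b))⁻¹ ^ (1 / a), by positivity, fun ι _ _ x hx J hJ => ?_⟩
  set n := Fintype.card ι
  have hn : 1 ≤ n := Fintype.card_pos
  have hn' : (0 : ℝ) < n := by exact_mod_cast hn
  set L := (4 * D * C ^ (a / b))⁻¹ ^ (1 / a) * (n : ℝ) ^ (1 / (2 * a))
  have hL : 0 < L := by positivity
  by_contra! hcon
  have hJne : 0 < #J := by omega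
  have hw (φ : E →L[ℝ] ℝ) (hφ : ‖φ‖ ≤ 1) :
      ∑ i ∈ J, |φ (x i)| ^ b ≤ L ^ b * (C * (n : ℝ) ^ δ) := by
    refine (sum_le_sum_range_of_exists_le _ (fun k => L ^ b * (k : ℝ)⁻¹) J ?_).trans ?_
    · intro B hB hBne
      obtain ⟨i, hi, hmin⟩ := exists_min_image B (fun i => |φ (x i)|) hBne
      refine ⟨i, hi, ?_⟩
      have hB0 : (0 : ℝ) < #B := by exact_mod_cast hBne.card_pos
      have h1 : #B * |φ (x i)| ≤ L * (#B : ℝ) ^ (1 - 1 / b) := by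
        refine le_trans ?_ (hcon B hB hBne φ hφ).le
        rw [← nsmul_eq_mul]
        exact card_nsmul_le_sum _ _ _ hmin
      have h2 : |φ (x i)| ≤ L * (#B : ℝ) ^ (-(1 / b)) := by
        rw [sub_eq_add_neg, Real.rpow_add hB0, Real.rpow_one] at h1
        exact le_of_mul_le_mul_left (h1.trans_eq (by ring)) hB0
      refine (Real.rpow_le_rpow (abs_nonneg _) h2 hb0.le).trans_eq ?_
      rw [Real.mul_rpow hL.le (by positivity), ← Real.rpow_mul hB0.le, neg_mul,
        one_div_mul_cancel hb0.ne', Real.rpow_neg_one]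
    · rw [← mul_sum]
      gcongr
      exact sum_range_inv_le hδ0 (card_le_univ J) hn
  have : Nonempty J := ⟨⟨_, (card_pos.1 hJne).choose_spec⟩⟩
  have h1 := hcard J (fun i => x i) _ (fun i => hx i) fun φ hφ => by
    have h0 := hw φ hφ
    rwa [← sum_coe_sort J (fun i => |φ (x i)| ^ b)] at h0
  have h2 : (L ^ b * (C * (n : ℝ) ^ δ)) ^ (a / b) = (4 * D)⁻¹ * n := by
    have e1 : b * (a / b) = a := by field_simp
    have e2 : δ * (a / b) = 1 / 2 := by rw [hδ]; field_simp
    have e3 : 1 / (2 * a) * a = 1 / 2 := by field_simp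
    have hLa : L ^ a = (4 * D * C ^ (a / b))⁻¹ * (n : ℝ) ^ (1 / 2 : ℝ) := by
      rw [Real.mul_rpow (by positivity) (by positivity), ← Real.rpow_mul (by positivity),
        ← Real.rpow_mul hn'.le, e3, one_div_mul_cancel ha0.ne', Real.rpow_one]
    rw [Real.mul_rpow (x := L ^ b) (by positivity) (by positivity), ← Real.rpow_mul hL.le, e1,
      hLa, Real.mul_rpow (by positivity) (by positivity), ← Real.rpow_mul hn'.le, e2]
    calc _ = (4 * D * C ^ (a / b))⁻¹ * C ^ (a / b) * ((n : ℝ) ^ (1 / 2 : ℝ) * n ^ (1 / 2 : ℝ)) := by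
          ring
      _ = _ := by
        rw [← Real.rpow_add hn', add_halves, Real.rpow_one]
        field_simp
  rw [h2, Fintype.card_coe] at h1
  have h3 : (n : ℝ) ≤ 2 * #J := by exact_mod_cast hJ
  have h4 : D * ((4 * D)⁻¹ * n) = n / 4 := by field_simp
  rw [h4] at h1
  linarith

lemma exists_norm_sum_eq (φ : E →L[ℝ] ℝ) (hφ : ‖φ‖ ≤ 1) {ι : Type*} (B : Finset ι) (x : ι → E) :
    ∃ y : E, ∑ i ∈ B, |φ (x i)| ≤ ‖y‖ ∧
      ∀ ψ : E →L[ℝ] ℝ, |ψ y| ≤ ∑ i ∈ B, |ψ (x i)| := by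
  refine ⟨∑ i ∈ B, (SignType.sign (φ (x i)) : ℝ) • x i, ?_, fun ψ => ?_⟩
  · have h1 : φ (∑ i ∈ B, (SignType.sign (φ (x i)) : ℝ) • x i) = ∑ i ∈ B, |φ (x i)| := by
      simp [sign_mul_self]
    rw [← h1]
    exact (le_abs_self _).trans ((φ.le_of_opNorm_le hφ _).trans_eq (one_mul _))
  · rw [map_sum]
    refine (abs_sum_le_sum_abs _ _).trans (sum_le_sum fun i _ => ?_)
    rw [map_smul, smul_eq_mul, abs_mul]
    refine mul_le_of_le_one_left (abs_nonneg _) ?_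
    cases SignType.sign (φ (x i)) <;> simp

lemma AbsolutelySumming.supLower {a b θ θ' : ℝ} (hb : 1 ≤ b) (hab : b ≤ a)
    (h : AbsolutelySumming a b (ContinuousLinearMap.id ℝ E)) (hR : RadLower E θ') (h0 : 0 < θ)
    (hθ : θ < θ') (hθb : θ ≤ 1 - 1 / b) : SupLower E (θ + 1 / (2 * a)) := by
  obtain ⟨c, hc, hblock⟩ := h.exists_large_block hb hab
  obtain ⟨A, hA, hR⟩ := hR.sum_rpow_le h0 hθ
  refine ⟨(2 * A)⁻¹ ^ θ * c, by positivity, fun ι _ _ _ x S hx hS => ?_⟩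
  set n := Fintype.card ι
  have hn' : (0 : ℝ) < n := by exact_mod_cast Fintype.card_pos (α := ι)
  set L := c * (n : ℝ) ^ (1 / (2 * a))
  have hL : 0 < L := by positivity
  obtain ⟨𝓑, hdisj, hgood, hcard⟩ := exists_pairwiseDisjoint_of_forall_exists _ (hblock ι x hx)
  choose! φ hφ hφB using hgood
  have hy (B : 𝓑) := exists_norm_sum_eq (φ B) (hφ B B.2) B x
  choose y hy hyψ using hy
  have hS' : √(radSq y) ≤ S := by
    refine sqrt_radSq_le fun ψ hψ => ?_
    calc ∑ B, |ψ (y B)| ≤ ∑ B : 𝓑, ∑ i ∈ (B : Finset ι), |ψ (x i)| :=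
          sum_le_sum fun B _ => hyψ B ψ
      _ = ∑ B ∈ 𝓑, ∑ i ∈ B, |ψ (x i)| := sum_coe_sort 𝓑 fun B => ∑ i ∈ B, |ψ (x i)|
      _ = ∑ i ∈ 𝓑.biUnion id, |ψ (x i)| := (sum_biUnion hdisj).symm
      _ ≤ ∑ i, |ψ (x i)| := sum_le_univ_sum_of_nonneg fun i => abs_nonneg _
      _ ≤ S := hS ψ hψ
  have hS0 : 0 ≤ S := (Real.sqrt_nonneg _).trans hS'
  have hterm (B : 𝓑) : L ^ (1 / θ) * #(B : Finset ι) ≤ ‖y B‖ ^ (1 / θ) := by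
    rcases (Nat.zero_le #(B : Finset ι)).eq_or_lt with h1 | h1
    · simp [← h1, Real.rpow_nonneg]
    have h1' : (1 : ℝ) ≤ #(B : Finset ι) := by exact_mod_cast h1
    calc L ^ (1 / θ) * #(B : Finset ι) = (L * (#(B : Finset ι) : ℝ) ^ θ) ^ (1 / θ) := by
          rw [Real.mul_rpow hL.le (by positivity), ← Real.rpow_mul (by positivity),
            mul_one_div_cancel h0.ne', Real.rpow_one]
      _ ≤ ‖y B‖ ^ (1 / θ) := by
          refine Real.rpow_le_rpow (by positivity) (le_trans ?_ ((hφB B B.2).trans (hy B)))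
            (by positivity)
          gcongr
  have hsum : L ^ (1 / θ) * (n / 2) ≤ A * S ^ (1 / θ) := by
    have h1 : (n : ℝ) / 2 ≤ ∑ B : 𝓑, (#(B : Finset ι) : ℝ) := by
      rw [sum_coe_sort 𝓑 fun B => (#B : ℝ), div_le_iff₀ two_pos, mul_comm]
      exact_mod_cast hcard
    calc L ^ (1 / θ) * (n / 2) ≤ L ^ (1 / θ) * ∑ B : 𝓑, (#(B : Finset ι) : ℝ) := by gcongr
      _ = ∑ B : 𝓑, L ^ (1 / θ) * #(B : Finset ι) := mul_sum _ _ _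
      _ ≤ ∑ B : 𝓑, ‖y B‖ ^ (1 / θ) := sum_le_sum fun B _ => hterm B
      _ ≤ A * √(radSq y) ^ (1 / θ) := hR 𝓑 y
      _ ≤ A * S ^ (1 / θ) := by gcongr
  have hsum' : (2 * A)⁻¹ * n * L ^ (1 / θ) ≤ S ^ (1 / θ) := by
    rw [mul_inv, mul_assoc, mul_assoc, inv_mul_le_iff₀ two_pos, inv_mul_le_iff₀ hA]
    linarith
  have h1 := Real.rpow_le_rpow (by positivity) hsum' h0.le
  rw [← Real.rpow_mul hS0, one_div_mul_cancel h0.ne', Real.rpow_one,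
    Real.mul_rpow (by positivity) (by positivity), Real.mul_rpow (by positivity) (by positivity),
    ← Real.rpow_mul hL.le, one_div_mul_cancel h0.ne', Real.rpow_one] at h1
  refine le_trans (le_of_eq ?_) h1
  rw [Real.rpow_add hn']
  ring

lemma AbsolutelySumming.supLower_one {a : ℝ} (ha : 1 ≤ a)
    (h : AbsolutelySumming a 1 (ContinuousLinearMap.id ℝ E)) : SupLower E (1 / a) := by
  obtain ⟨D, hD, h⟩ := h.exists_card_le le_rfl ha
  refine ⟨D⁻¹ ^ (1 / a), by positivity, fun ι _ _ _ x S hx hS => ?_⟩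
  have hS0 : 0 ≤ S := by simpa using hS 0 (by simp)
  have h1 := h ι x S hx (by simpa using hS)
  rw [div_one] at h1
  rw [← Real.mul_rpow (by positivity) (by positivity)]
  calc (D⁻¹ * (Fintype.card ι : ℝ)) ^ (1 / a) ≤ (S ^ a) ^ (1 / a) :=
        Real.rpow_le_rpow (by positivity) ((inv_mul_le_iff₀ hD).2 h1) (by positivity)
    _ = S := by rw [← Real.rpow_mul hS0, mul_one_div_cancel (by linarith), Real.rpow_one]

end WeakLowerEstimates

section RademacherAverages

open Finset MeasureTheory intervalIntegral

/-- The Rademacher functions with values in `ℤˣ`. -/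
def radSign (n : ℕ) (t : ℝ) (k : Fin n) : ℤˣ := (-1) ^ ⌊(2 : ℝ) ^ (k.1 + 1) * t⌋

lemma radSign_smul {E : Type*} [NormedAddCommGroup E] [NormedSpace ℝ E] {n : ℕ} (t : ℝ)
    (k : Fin n) (x : E) : radSign n t k • x = Rademacher k t • x := by
  rw [radSign, Rademacher]
  rcases Int.even_or_odd ⌊(2 : ℝ) ^ (k.1 + 1) * t⌋ with h | h
  · rw [h.neg_one_zpow, h.neg_one_zpow, one_smul, one_smul]
  · rw [h.neg_one_zpow, h.neg_one_zpow, Units.neg_smul, neg_smul, one_smul, one_smul]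

lemma radSign_add_one (n : ℕ) (t : ℝ) : radSign n (t + 1) = radSign n t := by
  ext1 k
  have h : (2 : ℝ) ^ (k.1 + 1) * (t + 1) = 2 ^ (k.1 + 1) * t + ((2 ^ (k.1 + 1) : ℤ) : ℝ) := by
    push_cast; ring
  have he : Even ((2 : ℤ) ^ (k.1 + 1)) := by simp [Int.even_pow]
  rw [radSign, h, Int.floor_add_intCast, zpow_add, he.neg_one_zpow, mul_one, radSign]

lemma radSign_succ (n : ℕ) (t : ℝ) :
    radSign (n + 1) t = Fin.cons ((-1) ^ ⌊2 * t⌋) (radSign n (2 * t)) := by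
  ext1 k
  induction k using Fin.cases with
  | zero => simp [radSign]
  | succ k => simp only [radSign, Fin.cons_succ, Fin.val_succ, pow_succ _ (k.1 + 1), mul_assoc]

lemma expect_fin_succ (n : ℕ) (G : (Fin (n + 1) → ℤˣ) → ℝ) :
    𝔼 ε, G ε = (𝔼 ε, G (Fin.cons 1 ε) + 𝔼 ε, G (Fin.cons (-1) ε)) / 2 := by
  have h : ∑ ε, G ε = ∑ ε, G (Fin.cons 1 ε) + ∑ ε, G (Fin.cons (-1) ε) := by
    rw [← (Fin.consEquiv fun _ : Fin (n + 1) => ℤˣ).sum_comp, Fintype.sum_prod_type]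
    simp [Fin.consEquiv, UnitsInt.univ]
  simp only [Fintype.expect_eq_sum_div_card, h]
  simp [pow_succ]
  field_simp

lemma intervalIntegrable_and_integral_radSign (n : ℕ) (G : (Fin n → ℤˣ) → ℝ) :
    IntervalIntegrable (fun t => G (radSign n t)) volume 0 1 ∧
      ∫ t in (0 : ℝ)..1, G (radSign n t) = 𝔼 ε, G ε := by
  induction n with
  | zero =>
    have h (t : ℝ) : G (radSign 0 t) = G default := congrArg G (Subsingleton.elim _ _)
    simpa [h] using congrArg G (Subsingleton.elim _ _)
  | succ n ih =>
    set g : ℝ → ℝ := fun u => G (Fin.cons ((-1) ^ ⌊u⌋) (radSign n u)) with hg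
    obtain ⟨hi1, he1⟩ := ih fun ε => G (Fin.cons 1 ε)
    obtain ⟨hi2, he2⟩ := ih fun ε => G (Fin.cons (-1) ε)
    have hc1 : Set.EqOn (fun t => G (Fin.cons 1 (radSign n t))) g (Set.Ioo 0 1) := by
      intro t ht
      have : ⌊t⌋ = 0 := Int.floor_eq_zero_iff.2 ⟨ht.1.le, ht.2⟩
      simp [hg, this]
    have hc2 : Set.EqOn (fun t => G (Fin.cons (-1) (radSign n (t - 1)))) g (Set.Ioo 1 2) := by
      intro t ht
      have h1 : ⌊t⌋ = 1 := Int.floor_eq_iff.2 ⟨by simpa using ht.1.le, by norm_num; exact ht.2⟩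
      have h2 := radSign_add_one n (t - 1)
      rw [sub_add_cancel] at h2
      simp [hg, h1, h2]
    have hae (a b : ℝ) (hab : a ≤ b) {f : ℝ → ℝ} (hf : Set.EqOn f g (Set.Ioo a b)) :
        f =ᵐ[volume.restrict (Set.uIoc a b)] g := by
      rw [Set.uIoc_of_le hab, ← restrict_Ioo_eq_restrict_Ioc]
      exact (ae_restrict_mem measurableSet_Ioo).mono hf
    have hI1 : IntervalIntegrable g volume 0 1 :=
      hi1.congr_ae (hae 0 1 zero_le_one hc1)
    have hi2' : IntervalIntegrable (fun t => G (Fin.cons (-1) (radSign n (t - 1)))) volume 1 2 := by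
      have := hi2.comp_sub_right 1
      norm_num at this
      exact this
    have hI2 : IntervalIntegrable g volume 1 2 :=
      hi2'.congr_ae (hae 1 2 one_le_two hc2)
    have hG (t : ℝ) : G (radSign (n + 1) t) = g (2 * t) := by rw [radSign_succ]
    simp only [hG]
    constructor
    · have := (hI1.trans hI2).comp_mul_left (c := 2)
      norm_num at this
      exact this
    · rw [integral_comp_mul_left _ two_ne_zero, mul_zero, mul_one,
        ← integral_add_adjacent_intervals hI1 hI2, expect_fin_succ, ← he1, ← he2,
        ← integral_congr_ae_restrict (hae 0 1 zero_le_one hc1),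
        ← integral_congr_ae_restrict (hae 1 2 one_le_two hc2),
        integral_comp_sub_right (fun t => G (Fin.cons (-1) (radSign n t)))]
      norm_num
      ring

variable {E : Type*} [NormedAddCommGroup E] [NormedSpace ℝ E]

lemma integral_sq_norm_rademacher {n : ℕ} (x : Fin n → E) :
    ∫ t in (0 : ℝ)..1, ‖∑ k : Fin n, Rademacher k.1 t • x k‖ ^ 2 = radSq x := by
  simp only [← radSign_smul]
  exact (intervalIntegrable_and_integral_radSign n fun ε => ‖∑ i, ε i • x i‖ ^ 2).2

lemma RadLower.hasCotype {θ θ' : ℝ} (h : RadLower E θ) (h0 : 0 < θ') (hθ : θ' < θ)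
    (h1 : θ' ≤ 1 / 2) : HasCotype (1 / θ') E := by
  obtain ⟨A, hA, h⟩ := h.sum_rpow_le h0 hθ
  refine ⟨by rw [le_div_iff₀ h0]; linarith, A ^ θ', by positivity, fun n x => ?_⟩
  rw [integral_sq_norm_rademacher, ← Real.sqrt_eq_rpow, one_div_one_div]
  refine (Real.rpow_le_rpow (by positivity) (h (Fin n) x) h0.le).trans_eq ?_
  rw [Real.mul_rpow hA.le (by positivity), ← Real.rpow_mul (Real.sqrt_nonneg _),
    one_div_mul_cancel h0.ne', Real.rpow_one]

lemma conjE_ofReal {s : ℝ} (hs : 1 < s) :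
    conjE (ENNReal.ofReal s) = ENNReal.ofReal (1 + 1 / (s - 1)) := by
  rw [conjE, ENNReal.ofReal_add zero_le_one (one_div_nonneg.2 (by linarith)),
    ENNReal.ofReal_div_of_pos (by linarith), ENNReal.ofReal_sub s zero_le_one, ENNReal.ofReal_one]

lemma conjE_anti : Antitone conjE := fun p q hpq => by
  unfold conjE
  gcongr

lemma RadLower.le_of_conjE_cot_le {θ b : ℝ} (h : RadLower E θ) (hb : 1 ≤ b) (hb2 : b < 2)
    (hbc : conjE (cot E) ≤ ENNReal.ofReal b) : θ ≤ 1 - 1 / b := by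
  have hb0 : 0 < b := by linarith
  by_contra! hlt
  have hβ : 1 - 1 / b < 1 / 2 := by
    have : 1 / 2 < 1 / b := one_div_lt_one_div_of_lt hb0 hb2
    linarith
  have hβ0 : 0 ≤ 1 - 1 / b := by
    have : 1 / b ≤ 1 := (div_le_one hb0).2 hb
    linarith
  obtain ⟨θ', h1, h2⟩ := exists_between (lt_min hlt hβ)
  have h0 : 0 < θ' := by linarith
  have h3 := (lt_min_iff.1 h2).2
  have hcot : cot E ≤ ENNReal.ofReal (1 / θ') :=
    sInf_le ⟨_, h.hasCotype h0 (lt_min_iff.1 h2).1 h3.le, rfl⟩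
  have h4 : (1 : ℝ) < 1 / θ' := by rw [lt_div_iff₀ h0]; linarith
  have h5 := (conjE_anti hcot).trans hbc
  rw [conjE_ofReal h4, ENNReal.ofReal_le_ofReal_iff hb0.le] at h5
  have h6 : 1 + 1 / (1 / θ' - 1) = 1 / (1 - θ') := by
    have : 1 - θ' ≠ 0 := by linarith
    field_simp
    ring
  rw [h6, div_le_iff₀ (by linarith)] at h5
  have h7 : b * (1 - 1 / b) = b - 1 := by field_simp
  nlinarith

lemma AbsolutelySumming.two_le_of_conjE_cot_le {a b : ℝ} (hb : 1 ≤ b)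
    (hbc : conjE (cot E) ≤ ENNReal.ofReal b) (hab : b ≤ a)
    (h : AbsolutelySumming a b (ContinuousLinearMap.id ℝ E)) : 2 ≤ b := by
  by_contra! hb2
  have hb0 : 0 < b := by linarith
  set T : Set ℝ := {θ | RadLower E θ}
  have hT : BddAbove T := ⟨1 - 1 / b, fun θ hθ => RadLower.le_of_conjE_cot_le hθ hb hb2 hbc⟩
  have h0T : (0 : ℝ) ∈ T := radLower_zero
  set γ := sSup T
  have hγ0 : 0 ≤ γ := le_csSup hT h0T
  have hγb : γ ≤ 1 - 1 / b :=
    csSup_le ⟨0, h0T⟩ fun θ hθ => RadLower.le_of_conjE_cot_le hθ hb hb2 hbc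
  have hγ2 : γ < 1 / 2 := by
    have : 1 / 2 < 1 / b := one_div_lt_one_div_of_lt hb0 hb2
    linarith
  have hb' : 1 ≤ 1 / (1 - γ) := by rw [le_div_iff₀ (by linarith)]; linarith
  have hbb' : 1 / (1 - γ) ≤ b := by
    rw [div_le_iff₀ (by linarith)]
    have : b * (1 / b) = 1 := by field_simp
    nlinarith
  have h' : AbsolutelySumming a (1 / (1 - γ)) (ContinuousLinearMap.id ℝ E) :=
    h.anti (by linarith) hbb'
  have ha : 0 < a := by linarith
  have hsup : ∃ ρ, γ < ρ ∧ SupLower E ρ := by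
    rcases hγ0.eq_or_lt with hγ | hγ
    · rw [← hγ] at h'
      norm_num at h'
      exact ⟨1 / a, by rw [← hγ]; positivity, h'.supLower_one (hb.trans hab)⟩
    · obtain ⟨θ, hθ1, hθ2⟩ := exists_between (max_lt hγ
        (sub_lt_self γ (by positivity : 0 < 1 / (2 * a))))
      obtain ⟨θ', hθ', hlt⟩ := exists_lt_of_lt_csSup ⟨0, h0T⟩ hθ2
      have h1 := max_lt_iff.1 hθ1
      refine ⟨θ + 1 / (2 * a), by linarith,
        h'.supLower hb' (hbb'.trans hab) hθ' h1.1 hlt ?_⟩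
      rw [one_div_one_div]
      linarith
  obtain ⟨ρ, hρ, hS⟩ := hsup
  have key : ∃ θ, 0 ≤ θ ∧ θ < 1 / 2 ∧ AvgLower E θ ∧ γ < ((1 - 2 * θ) * ρ + θ) / (2 - 2 * θ) := by
    have hlim : γ < ((1 - 2 * γ) * ρ + γ) / (2 - 2 * γ) := by
      rw [lt_div_iff₀ (by linarith)]
      nlinarith [mul_pos (by linarith : 0 < 1 - 2 * γ) (sub_pos.2 hρ)]
    rcases hγ0.eq_or_lt with hγ | hγ
    · exact ⟨0, le_rfl, by norm_num, avgLower_zero, by rwa [← hγ] at hlim ⊢⟩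
    · have hcont : ContinuousAt (fun θ : ℝ => ((1 - 2 * θ) * ρ + θ) / (2 - 2 * θ)) γ :=
        ContinuousAt.div (by fun_prop) (by fun_prop) (by linarith)
      have hev := ((hcont.eventually (lt_mem_nhds hlim)).and (lt_mem_nhds hγ)).filter_mono
        (nhdsWithin_le_nhds (s := Set.Iio γ))
      obtain ⟨θ, ⟨h1, h2⟩, h3⟩ := (hev.and self_mem_nhdsWithin).exists
      obtain ⟨θ', hθ', hlt⟩ := exists_lt_of_lt_csSup ⟨0, h0T⟩ h3
      have h3' : θ < γ := h3
      exact ⟨θ, h2.le, by linarith, RadLower.avgLower hθ' h2 hlt (by linarith), h1⟩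
  obtain ⟨θ, h1, h2, hA, h3⟩ := key
  exact absurd (le_csSup hT (hS.radLower (by linarith) hA h1 h2)) (not_le.2 h3)

end RademacherAverages

/-- if `b ≥ (cot E)*` then `id_E` is absolutely `(a,b)`-summing for no
`b ≤ a < ∞`, i.e. `inf{a : id_E is (a,b)-summing} = ∞`. -/
theorem stmt0 (E : Type*) [NormedAddCommGroup E] [NormedSpace ℝ E] [CompleteSpace E]
    (hE : ¬ FiniteDimensional ℝ E) (b : ℝ) (hb : 1 ≤ b)
    (hbc : conjE (cot E) ≤ ENNReal.ofReal b) :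
    ∀ a : ℝ, b ≤ a → ¬ AbsolutelySumming a b (ContinuousLinearMap.id ℝ E) := by
  exact fun a hab h => hE (h.finiteDimensional (h.two_le_of_conjE_cot_le hb hbc hab) hab)

end
end

section
/- Let E be an infinite dimensional Banach space and let b ≥ 1 satisfy b < (cot E)* (in particular cot E < ∞). Then inf{a : id_E is absolutely (a,b)-summing} = b·cot E / (b + cot E − b·cot E). More precisely: if a > b·cot E / (b + cot E − b·cot E) then id_E is absolutely (a,b)-summing, and if b ≤ a < b·cot E / (b + cot E − b·cot E) then id_E is not absolutely (a,b)-summing. -/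
open scoped ENNReal NNReal BigOperators ZeroAtInfty

noncomputable section

/-- A unit of `ℤ`, seen as a real number. -/
def sgn (u : ℤˣ) : ℝ := ((u : ℤ) : ℝ)

lemma sgn_one : sgn 1 = 1 := by simp [sgn]

lemma sgn_neg_one : sgn (-1) = -1 := by simp [sgn]

lemma sgn_neg (u : ℤˣ) : sgn (-u) = -sgn u := by simp [sgn]

lemma sgn_mul (u v : ℤˣ) : sgn (u * v) = sgn u * sgn v := by simp [sgn]

lemma abs_sgn (u : ℤˣ) : |sgn u| = 1 := by
  rcases Int.units_eq_one_or u with rfl | rfl <;> simp [sgn]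

lemma exists_sgn_mul_eq_abs (a : ℝ) : ∃ u : ℤˣ, sgn u * a = |a| := by
  rcases le_total 0 a with h | h
  · exact ⟨1, by simp [sgn, abs_of_nonneg h]⟩
  · exact ⟨-1, by simp [sgn, abs_of_nonpos h]⟩

lemma expect_units (f : ℤˣ → ℝ) : 𝔼 u, f u = (f 1 + f (-1)) / 2 := by
  rw [Fintype.expect_eq_sum_div_card, UnitsInt.univ, Finset.sum_pair (by decide)]
  simp

lemma expect_fin_succ_s1 {α : Type*} [Fintype α] {n : ℕ} (F : (Fin (n + 1) → α) → ℝ) :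
    𝔼 p, F p = 𝔼 a, 𝔼 q : Fin n → α, F (Fin.cons a q) := by
  rw [← Fintype.expect_equiv (Fin.consEquiv fun _ => α) (fun z => F (Fin.cons z.1 z.2)) F
    (fun _ => rfl), ← Finset.univ_product_univ, Finset.expect_product]

lemma rademacher_eq_sgn (k : ℕ) (t : ℝ) :
    Rademacher k t = sgn ((-1 : ℤˣ) ^ ⌊(2 : ℝ) ^ (k + 1) * t⌋) := by
  rcases Int.even_or_odd ⌊(2 : ℝ) ^ (k + 1) * t⌋ with h | h
  · rw [Rademacher, h.neg_one_zpow, h.neg_one_zpow, sgn_one]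
  · rw [Rademacher, h.neg_one_zpow, h.neg_one_zpow, sgn_neg_one]

lemma rademacher_succ_half (k : ℕ) (t : ℝ) : Rademacher (k + 1) (t / 2) = Rademacher k t := by
  unfold Rademacher
  congr 2
  ring

lemma rademacher_succ_half_add (k : ℕ) (t : ℝ) :
    Rademacher (k + 1) (1 / 2 + t / 2) = Rademacher k t := by
  have h : (2 : ℝ) ^ (k + 1 + 1) * (1 / 2 + t / 2)
      = 2 ^ (k + 1) * t + ((2 ^ (k + 1) : ℤ) : ℝ) := by push_cast; ring
  unfold Rademacher
  rw [h, Int.floor_add_intCast, zpow_add₀ (by norm_num),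
    (Even.neg_one_zpow (α := ℝ) (n := 2 ^ (k + 1)) (by simp [Int.even_pow])), mul_one]

lemma rademacher_zero_left {t : ℝ} (h0 : 0 < t) (h1 : t < 1) : Rademacher 0 (t / 2) = 1 := by
  have : ⌊(2 : ℝ) ^ (0 + 1) * (t / 2)⌋ = 0 := by
    rw [Int.floor_eq_iff]; constructor <;> norm_num <;> linarith
  simp only [Rademacher, this, zpow_zero]

lemma rademacher_zero_right {t : ℝ} (h0 : 0 < t) (h1 : t < 1) :
    Rademacher 0 (1 / 2 + t / 2) = -1 := by
  have : ⌊(2 : ℝ) ^ (0 + 1) * (1 / 2 + t / 2)⌋ = 1 := by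
    rw [Int.floor_eq_iff]; constructor <;> norm_num <;> linarith
  simp only [Rademacher, this, zpow_one]

lemma intervalIntegrable_rademacher {n : ℕ} (F : (Fin n → ℝ) → ℝ) (a b : ℝ) :
    IntervalIntegrable (fun t => F fun k => Rademacher k t) MeasureTheory.volume a b := by
  have hm : Measurable fun t : ℝ => F fun k : Fin n => Rademacher k t := by
    have h1 : Measurable fun t : ℝ => fun k : Fin n => ⌊(2 : ℝ) ^ ((k : ℕ) + 1) * t⌋ :=
      measurable_pi_iff.2 fun k => (measurable_const.mul measurable_id).floor
    exact (measurable_of_countable fun z : Fin n → ℤ => F fun k => (-1 : ℝ) ^ z k).comp h1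
  have hb : ∀ t : ℝ, ‖F fun k : Fin n => Rademacher k t‖
      ≤ ∑ σ : Fin n → ℤˣ, ‖F fun k => sgn (σ k)‖ := by
    intro t
    simp only [rademacher_eq_sgn]
    exact Finset.single_le_sum (f := fun σ : Fin n → ℤˣ => ‖F fun k => sgn (σ k)‖)
      (fun _ _ => norm_nonneg _)
      (Finset.mem_univ fun k : Fin n => (-1 : ℤˣ) ^ ⌊(2 : ℝ) ^ ((k : ℕ) + 1) * t⌋)
  rw [intervalIntegrable_iff]
  exact MeasureTheory.Measure.integrableOn_of_bounded (by simp)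
    hm.aestronglyMeasurable (Filter.Eventually.of_forall hb)

/-- The Rademacher functions are independent fair signs. -/
theorem integral_rademacher {n : ℕ} (F : (Fin n → ℝ) → ℝ) :
    ∫ t in (0 : ℝ)..1, F (fun k => Rademacher k t)
      = 𝔼 σ : Fin n → ℤˣ, F fun k => sgn (σ k) := by
  induction n with
  | zero =>
    have h : ∀ v : Fin 0 → ℝ, F v = F ![] := fun v => by rw [Subsingleton.elim v ![]]
    simp [h]
  | succ n ih =>
    have hne : ∀ᵐ t : ℝ, t ≠ 1 := MeasureTheory.Measure.ae_ne _ _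
    have h1 : ∫ t in (0 : ℝ)..1, F (fun k : Fin (n + 1) => Rademacher k (t / 2))
        = 𝔼 σ : Fin n → ℤˣ, F (Fin.cons 1 fun k => sgn (σ k)) := by
      rw [← ih fun v => F (Fin.cons 1 v)]
      refine intervalIntegral.integral_congr_ae ?_
      filter_upwards [hne] with t ht hmem
      rw [Set.uIoc_of_le zero_le_one] at hmem
      congr 1
      funext k
      refine Fin.cases ?_ (fun k => ?_) k
      · simpa using rademacher_zero_left hmem.1 (lt_of_le_of_ne hmem.2 ht)
      · simpa using rademacher_succ_half k t
    have h2 : ∫ t in (0 : ℝ)..1, F (fun k : Fin (n + 1) => Rademacher k (1 / 2 + t / 2))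
        = 𝔼 σ : Fin n → ℤˣ, F (Fin.cons (-1) fun k => sgn (σ k)) := by
      rw [← ih fun v => F (Fin.cons (-1) v)]
      refine intervalIntegral.integral_congr_ae ?_
      filter_upwards [hne] with t ht hmem
      rw [Set.uIoc_of_le zero_le_one] at hmem
      congr 1
      funext k
      refine Fin.cases ?_ (fun k => ?_) k
      · simpa using rademacher_zero_right hmem.1 (lt_of_le_of_ne hmem.2 ht)
      · simpa using rademacher_succ_half_add k t
    rw [intervalIntegral.integral_comp_div (fun t => F fun k : Fin (n + 1) => Rademacher k t)
      two_ne_zero] at h1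
    rw [intervalIntegral.integral_comp_add_div
      (fun t => F fun k : Fin (n + 1) => Rademacher k t) two_ne_zero] at h2
    norm_num at h1 h2
    rw [← intervalIntegral.integral_add_adjacent_intervals
      (intervalIntegrable_rademacher F 0 (1 / 2)) (intervalIntegrable_rademacher F (1 / 2) 1),
      expect_fin_succ_s1, expect_units]
    have hc : ∀ (u : ℤˣ) (q : Fin n → ℤˣ),
        (fun k : Fin (n + 1) => sgn ((Fin.cons u q : Fin (n + 1) → ℤˣ) k))
          = Fin.cons (sgn u) fun k => sgn (q k) := by
      intro u q
      funext k
      refine Fin.cases ?_ (fun k => ?_) k <;> simp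
    simp only [hc, sgn_one, sgn_neg_one]
    rw [← h1, ← h2]
    ring

lemma expect_sq_signed_sum {n : ℕ} (h : ℝ) (a : Fin n → ℝ) :
    𝔼 σ : Fin n → ℤˣ, (h + ∑ i, sgn (σ i) * a i) ^ 2 = h ^ 2 + ∑ i, a i ^ 2 := by
  induction n generalizing h with
  | zero => simp
  | succ n ih =>
    rw [expect_fin_succ_s1, expect_units]
    simp only [Fin.sum_univ_succ, Fin.cons_zero, Fin.cons_succ, ← add_assoc, ih, sgn_one,
      sgn_neg_one]
    ring

lemma le_finite_ciSup {τ : Type*} [Finite τ] (f : τ → ℝ) (t : τ) : f t ≤ ⨆ t, f t :=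
  le_ciSup (Set.finite_range f).bddAbove t

section Symmetrization

variable {τ K : Type*} [Finite τ]

lemma add_two_abs_le_expect_iSup (h f : τ → ℝ) (s t : τ) :
    ((h t + 2 * |f t|) + (h s - 2 * |f s|)) / 2
      ≤ 𝔼 u : ℤˣ, ⨆ t, (h t + 2 * (sgn u * f t)) := by
  rw [expect_units, sgn_one, sgn_neg_one]
  have a1 := le_finite_ciSup fun t => h t + 2 * (1 * f t)
  have a2 := le_finite_ciSup fun t => h t + 2 * (-1 * f t)
  have := le_abs_self (f s)
  have := neg_abs_le (f s)
  rcases le_total 0 (f t) with h0 | h0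
  · rw [abs_of_nonneg h0]
    have := a1 t
    have := a2 s
    linarith
  · rw [abs_of_nonpos h0]
    have := a1 s
    have := a2 t
    linarith

variable [Nonempty τ] [Fintype K] [Nonempty K]

lemma expect_iSup_abs_sub_expect_le (h : τ → ℝ) (f : τ → K → ℝ) :
    𝔼 k, ⨆ t, (h t + (|f t k| - 𝔼 k', |f t k'|))
      ≤ 𝔼 k, 𝔼 u : ℤˣ, ⨆ t, (h t + 2 * (sgn u * f t k)) := by
  set P : K → ℝ := fun k => 𝔼 u : ℤˣ, ⨆ t, (h t + 2 * (sgn u * f t k)) with hP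
  set S : K → K → ℝ := fun k k' => ⨆ t, (h t + (|f t k| - |f t k'|)) with hS
  have h1 : ∀ k, ⨆ t, (h t + (|f t k| - 𝔼 k', |f t k'|)) ≤ 𝔼 k', S k k' := by
    intro k
    refine ciSup_le fun t => ?_
    have : h t + (|f t k| - 𝔼 k', |f t k'|) = 𝔼 k', (h t + (|f t k| - |f t k'|)) := by
      rw [Finset.expect_add_distrib, Finset.expect_sub_distrib, Fintype.expect_const,
        Fintype.expect_const]
    rw [this]
    exact Finset.expect_le_expect fun k' _ => le_finite_ciSup (fun t => h t + (|f t k| - |f t k'|)) t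
  have h2 : ∀ k k', S k k' + S k' k ≤ P k + P k' := by
    intro k k'
    rw [← le_sub_iff_add_le]
    refine ciSup_le fun t => ?_
    rw [le_sub_comm]
    refine ciSup_le fun s => ?_
    have b1 := add_two_abs_le_expect_iSup h (fun t => f t k) s t
    have b2 := add_two_abs_le_expect_iSup h (fun t => f t k') t s
    simp only [hP]
    linarith
  have h3 : 𝔼 k, 𝔼 k', (S k k' + S k' k) ≤ 𝔼 k, 𝔼 k', (P k + P k') :=
    Finset.expect_le_expect fun k _ => Finset.expect_le_expect fun k' _ => h2 k k'
  simp only [Finset.expect_add_distrib, Fintype.expect_const] at h3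
  rw [Finset.expect_comm Finset.univ Finset.univ fun k k' => S k' k] at h3
  calc _ ≤ 𝔼 k, 𝔼 k', S k k' := Finset.expect_le_expect fun k _ => h1 k
    _ ≤ 𝔼 k, P k := by linarith

/-- Symmetrization and contraction: the maximal deviation of a sum of absolute values of
independently chosen terms is controlled by the maximal signed sum of the chosen terms. -/
theorem expect_iSup_sum_abs_le {m : ℕ} (h : τ → ℝ) (f : τ → Fin m → K → ℝ) :
    𝔼 c : Fin m → K, ⨆ t, (h t + ∑ j, (|f t j (c j)| - 𝔼 k, |f t j k|))
      ≤ 𝔼 c : Fin m → K, 𝔼 σ : Fin m → ℤˣ, ⨆ t, (h t + 2 * ∑ j, sgn (σ j) * f t j (c j)) := by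
  induction m generalizing h with
  | zero => simp
  | succ m ih =>
    calc 𝔼 c : Fin (m + 1) → K, ⨆ t, (h t + ∑ j, (|f t j (c j)| - 𝔼 k, |f t j k|))
        = 𝔼 k₀, 𝔼 c : Fin m → K, ⨆ t, ((h t + (|f t 0 k₀| - 𝔼 k, |f t 0 k|))
            + ∑ j : Fin m, (|f t j.succ (c j)| - 𝔼 k, |f t j.succ k|)) := by
          rw [expect_fin_succ_s1]
          simp only [Fin.sum_univ_succ, Fin.cons_zero, Fin.cons_succ, add_assoc]
      _ ≤ 𝔼 k₀, 𝔼 c : Fin m → K, 𝔼 σ : Fin m → ℤˣ,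
            ⨆ t, ((h t + (|f t 0 k₀| - 𝔼 k, |f t 0 k|))
              + 2 * ∑ j : Fin m, sgn (σ j) * f t j.succ (c j)) :=
          Finset.expect_le_expect fun k₀ _ => ih _ fun t j => f t j.succ
      _ = 𝔼 c : Fin m → K, 𝔼 σ : Fin m → ℤˣ, 𝔼 k₀,
            ⨆ t, ((h t + 2 * ∑ j : Fin m, sgn (σ j) * f t j.succ (c j))
              + (|f t 0 k₀| - 𝔼 k, |f t 0 k|)) := by
          rw [Finset.expect_comm]
          refine Finset.expect_congr rfl fun c _ => ?_
          rw [Finset.expect_comm]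
          simp only [add_right_comm]
      _ ≤ 𝔼 c : Fin m → K, 𝔼 σ : Fin m → ℤˣ, 𝔼 k₀, 𝔼 u : ℤˣ,
            ⨆ t, ((h t + 2 * ∑ j : Fin m, sgn (σ j) * f t j.succ (c j))
              + 2 * (sgn u * f t 0 k₀)) :=
          Finset.expect_le_expect fun c _ => Finset.expect_le_expect fun σ _ =>
            expect_iSup_abs_sub_expect_le _ fun t => f t 0
      _ = 𝔼 k₀, 𝔼 c : Fin m → K, 𝔼 u : ℤˣ, 𝔼 σ : Fin m → ℤˣ,
            ⨆ t, (h t + 2 * (sgn u * f t 0 k₀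
              + ∑ j : Fin m, sgn (σ j) * f t j.succ (c j))) := by
          refine Eq.trans ?_ (Finset.expect_comm _ _ _)
          refine Finset.expect_congr rfl fun c _ => ?_
          rw [Finset.expect_comm]
          refine Finset.expect_congr rfl fun k₀ _ => ?_
          rw [Finset.expect_comm]
          simp only [mul_add, add_comm, add_left_comm]
      _ = _ := by
          rw [expect_fin_succ_s1]
          refine Finset.expect_congr rfl fun k₀ _ => Finset.expect_congr rfl fun c _ => ?_
          rw [expect_fin_succ_s1]
          simp only [Fin.sum_univ_succ, Fin.cons_zero, Fin.cons_succ]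

end Symmetrization

lemma expect_comp_injective {ι κ : Type*} [Fintype ι] [DecidableEq ι] [Fintype κ] [DecidableEq κ]
    {e : ι → κ} (he : Function.Injective e) (G : (ι → ℤˣ) → ℝ) :
    𝔼 σ : κ → ℤˣ, G (σ ∘ e) = 𝔼 τ : ι → ℤˣ, G τ := by
  have h1 : ∀ τ : ι → ℤˣ, 𝔼 σ : κ → ℤˣ, G ((σ ∘ e) * τ) = 𝔼 σ : κ → ℤˣ, G (σ ∘ e) := by
    intro τ
    refine Fintype.expect_equiv (Equiv.mulRight (Function.extend e τ 1)) _ _ fun σ => ?_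
    congr 1
    funext i
    simp [he.extend_apply]
  calc 𝔼 σ : κ → ℤˣ, G (σ ∘ e) = 𝔼 τ : ι → ℤˣ, 𝔼 σ : κ → ℤˣ, G ((σ ∘ e) * τ) := by
        simp only [h1, Fintype.expect_const]
    _ = 𝔼 σ : κ → ℤˣ, 𝔼 τ : ι → ℤˣ, G τ := by
        rw [Finset.expect_comm]
        refine Finset.expect_congr rfl fun σ _ => ?_
        exact Fintype.expect_equiv (Equiv.mulLeft (σ ∘ e)) _ _ fun τ => rfl
    _ = _ := Fintype.expect_const _

lemma sum_expect_rpow_le {Ω κ : Type*} [Fintype Ω] [Nonempty Ω] [Fintype κ] {p : ℝ} (hp : 1 ≤ p)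
    (v : Ω → κ → ℝ) (hv : ∀ ω k, 0 ≤ v ω k) :
    (∑ k, (𝔼 ω, v ω k) ^ p) ^ (1 / p) ≤ 𝔼 ω, (∑ k, v ω k ^ p) ^ (1 / p) := by
  have hp0 : 0 < p := by linarith
  have h0 : (∑ k : κ, |(0 : κ → ℝ) k| ^ p) ^ (1 / p) ≤ 0 := by
    simp [Real.zero_rpow hp0.ne', Real.zero_rpow (inv_pos.2 hp0).ne']
  have h1 := Finset.le_sum_of_subadditive (fun f : κ → ℝ => (∑ k, |f k| ^ p) ^ (1 / p)) h0
    (fun f g => Real.Lp_add_le Finset.univ f g hp) Finset.univ v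
  have hc : (0 : ℝ) < Fintype.card Ω := by exact_mod_cast Fintype.card_pos
  simp only [Fintype.expect_eq_sum_div_card]
  rw [le_div_iff₀ hc]
  calc _ = (∑ k, |(∑ ω, v ω) k| ^ p) ^ (1 / p) := by
        simp only [Finset.sum_apply]
        have h2 : ∀ k, |∑ ω, v ω k| ^ p
            = ((∑ ω, v ω k) / Fintype.card Ω) ^ p * (Fintype.card Ω : ℝ) ^ p := by
          intro k
          have h3 : 0 ≤ ∑ ω, v ω k := Finset.sum_nonneg fun ω _ => hv ω k
          rw [abs_of_nonneg h3, ← Real.mul_rpow (div_nonneg h3 hc.le) hc.le, div_mul_cancel₀ _ hc.ne']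
        simp only [h2]
        rw [← Finset.sum_mul, Real.mul_rpow _ (Real.rpow_nonneg hc.le _), ← Real.rpow_mul hc.le,
          mul_one_div_cancel hp0.ne', Real.rpow_one]
        exact Finset.sum_nonneg fun k _ => Real.rpow_nonneg
          (div_nonneg (Finset.sum_nonneg fun ω _ => hv ω k) hc.le) _
    _ ≤ _ := h1
    _ = _ := by simp only [abs_of_nonneg (hv _ _)]

section Families

variable {E : Type*} [NormedAddCommGroup E] [NormedSpace ℝ E]
variable {ι κ : Type*} [Fintype ι] [Fintype κ]

/-- The largest norm of a signed sum of the members of `x` in `A`. -/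
def signSup (x : ι → E) (A : Finset ι) : ℝ :=
  ⨆ σ : ι → ℤˣ, ‖∑ i ∈ A, sgn (σ i) • x i‖

lemma norm_signed_sum_le_signSup (x : ι → E) (A : Finset ι) (σ : ι → ℤˣ) :
    ‖∑ i ∈ A, sgn (σ i) • x i‖ ≤ signSup x A :=
  le_finite_ciSup (fun σ : ι → ℤˣ => ‖∑ i ∈ A, sgn (σ i) • x i‖) σ

lemma signSup_nonneg (x : ι → E) (A : Finset ι) : 0 ≤ signSup x A :=
  (norm_nonneg _).trans (norm_signed_sum_le_signSup x A 1)

lemma exists_signSup_eq (x : ι → E) (A : Finset ι) :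
    ∃ σ : ι → ℤˣ, ‖∑ i ∈ A, sgn (σ i) • x i‖ = signSup x A :=
  exists_eq_ciSup_of_finite (f := fun σ : ι → ℤˣ => ‖∑ i ∈ A, sgn (σ i) • x i‖)

lemma sum_abs_apply_le_signSup (x : ι → E) (A : Finset ι) (φ : E →L[ℝ] ℝ) :
    ∑ i ∈ A, |φ (x i)| ≤ ‖φ‖ * signSup x A := by
  choose σ hσ using fun i => exists_sgn_mul_eq_abs (φ (x i))
  calc ∑ i ∈ A, |φ (x i)| = φ (∑ i ∈ A, sgn (σ i) • x i) := by simp [hσ]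
    _ ≤ ‖φ (∑ i ∈ A, sgn (σ i) • x i)‖ := le_abs_self _
    _ ≤ ‖φ‖ * ‖∑ i ∈ A, sgn (σ i) • x i‖ := φ.le_opNorm _
    _ ≤ _ := mul_le_mul_of_nonneg_left (norm_signed_sum_le_signSup x A σ) (norm_nonneg _)

variable [DecidableEq ι] [DecidableEq κ]

/-- The mean square of the norm of a random signed sum of the members of `x` in `A`. -/
def meanSq (x : ι → E) (A : Finset ι) : ℝ :=
  𝔼 σ : ι → ℤˣ, ‖∑ i ∈ A, sgn (σ i) • x i‖ ^ 2

lemma meanSq_nonneg (x : ι → E) (A : Finset ι) : 0 ≤ meanSq x A :=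
  Finset.expect_nonneg fun _ _ => by positivity

lemma meanSq_le_signSup_sq (x : ι → E) (A : Finset ι) : meanSq x A ≤ signSup x A ^ 2 :=
  Finset.expect_le Finset.univ_nonempty fun σ _ =>
    pow_le_pow_left₀ (norm_nonneg _) (norm_signed_sum_le_signSup x A σ) 2

lemma meanSq_comp_injective {e : ι → κ} (he : Function.Injective e) (x : κ → E) :
    meanSq (x ∘ e) Finset.univ = meanSq x (Finset.univ.image e) := by
  unfold meanSq
  rw [← expect_comp_injective he]
  refine Finset.expect_congr rfl fun σ _ => ?_
  rw [Finset.sum_image fun i _ j _ h => he h]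
  rfl

lemma sum_sq_apply_le_meanSq {n : ℕ} (x : Fin n → E) (A : Finset (Fin n)) {φ : E →L[ℝ] ℝ}
    (hφ : ‖φ‖ ≤ 1) : ∑ i ∈ A, φ (x i) ^ 2 ≤ meanSq x A := by
  have h := expect_sq_signed_sum 0 fun i => if i ∈ A then φ (x i) else 0
  have h1 : ∑ i ∈ A, φ (x i) ^ 2 = ∑ i, (if i ∈ A then φ (x i) else 0) ^ 2 := by
    simp [ite_pow, Finset.sum_ite_mem]
  rw [h1]
  rw [zero_pow two_ne_zero, zero_add] at h
  rw [← h]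
  refine Finset.expect_le_expect fun σ _ => ?_
  have h2 : 0 + ∑ i, sgn (σ i) * (if i ∈ A then φ (x i) else 0)
      = φ (∑ i ∈ A, sgn (σ i) • x i) := by
    simp [Finset.sum_ite_mem]
  rw [h2, ← sq_abs]
  refine pow_le_pow_left₀ (abs_nonneg _) ?_ 2
  exact (φ.le_opNorm _).trans (mul_le_of_le_one_left (norm_nonneg _) hφ)

lemma sum_abs_apply_le_sqrt {n : ℕ} (x : Fin n → E) (A : Finset (Fin n)) {φ : E →L[ℝ] ℝ}
    (hφ : ‖φ‖ ≤ 1) : ∑ i ∈ A, |φ (x i)| ≤ √(A.card * meanSq x A) := by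
  refine Real.le_sqrt_of_sq_le ?_
  have h := sq_sum_le_card_mul_sum_sq (s := A) (f := fun i => |φ (x i)|)
  simp only [sq_abs] at h
  exact h.trans (mul_le_mul_of_nonneg_left (sum_sq_apply_le_meanSq x A hφ) (by positivity))

lemma norm_sq_le_meanSq {n : ℕ} (x : Fin n → E) {A : Finset (Fin n)} {i : Fin n} (hi : i ∈ A) :
    ‖x i‖ ^ 2 ≤ meanSq x A := by
  obtain ⟨φ, hφ, hφx⟩ := exists_dual_vector'' ℝ (x i)
  have h1 := sum_sq_apply_le_meanSq x A hφ
  have h2 := Finset.single_le_sum (f := fun i => φ (x i) ^ 2) (fun _ _ => sq_nonneg _) hi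
  simp only [hφx] at h2
  exact h2.trans h1

lemma meanSq_mono {n : ℕ} (x : Fin n → E) {A B : Finset (Fin n)} (h : A ⊆ B) :
    meanSq x A ≤ meanSq x B := by
  have key : ∀ ε : Fin n → ℤˣ, meanSq x B
      = 𝔼 σ : Fin n → ℤˣ, ‖∑ i ∈ B, sgn (ε i * σ i) • x i‖ ^ 2 := fun ε =>
    (Fintype.expect_equiv (Equiv.mulLeft ε) _ _ fun σ => rfl).symm
  have h1 := key fun i => if i ∈ A then 1 else -1
  have h2 : meanSq x A ≤ (meanSq x B + meanSq x B) / 2 := by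
    nth_rw 2 [h1]
    unfold meanSq
    rw [← Finset.expect_add_distrib, Finset.expect_div]
    refine Finset.expect_le_expect fun σ _ => ?_
    have h3 : (2 : ℝ) • ∑ i ∈ A, sgn (σ i) • x i = ∑ i ∈ B, sgn (σ i) • x i
        + ∑ i ∈ B, sgn ((if i ∈ A then 1 else -1) * σ i) • x i := by
      rw [← Finset.sum_add_distrib, ← Finset.sum_sdiff h, Finset.sum_eq_zero (s := B \ A), zero_add,
        Finset.smul_sum]
      · refine Finset.sum_congr rfl fun i hi => ?_
        simp [hi, two_smul]
      · intro i hi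
        simp [(Finset.mem_sdiff.1 hi).2, sgn_neg]
    have h4 := norm_add_le (∑ i ∈ B, sgn (σ i) • x i)
      (∑ i ∈ B, sgn ((if i ∈ A then 1 else -1) * σ i) • x i)
    rw [← h3, norm_smul, Real.norm_two] at h4
    nlinarith [sq_nonneg (‖∑ i ∈ B, sgn (σ i) • x i‖
      - ‖∑ i ∈ B, sgn ((if i ∈ A then 1 else -1) * σ i) • x i‖),
      norm_nonneg (∑ i ∈ A, sgn (σ i) • x i)]
  linarith

end Families

section Cotype

variable {E : Type*} [NormedAddCommGroup E] [NormedSpace ℝ E]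

lemma integral_norm_sq_rademacher {n : ℕ} (x : Fin n → E) :
    ∫ t in (0 : ℝ)..1, ‖∑ k : Fin n, Rademacher k.1 t • x k‖ ^ 2 = meanSq x Finset.univ :=
  integral_rademacher fun v => ‖∑ k : Fin n, v k • x k‖ ^ 2

lemma rpow_one_div_sq {a s : ℝ} (ha : 0 ≤ a) : (a ^ (1 / s)) ^ 2 = a ^ (2 / s) := by
  rw [← Real.rpow_natCast, ← Real.rpow_mul ha]
  congr 1
  push_cast
  ring

lemma HasCotype.rpow_sum_le_meanSq {s : ℝ} (h : HasCotype s E) :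
    ∃ C > 0, ∀ (κ : Type) [Fintype κ] [DecidableEq κ] (y : κ → E),
      (∑ k, ‖y k‖ ^ s) ^ (2 / s) ≤ C * meanSq y Finset.univ := by
  obtain ⟨-, C, hC, hx⟩ := h
  refine ⟨C ^ 2, by positivity, fun κ _ _ y => ?_⟩
  let e := (Fintype.equivFin κ).symm
  have h1 := hx _ (y ∘ e)
  rw [integral_norm_sq_rademacher, meanSq_comp_injective e.injective, Finset.image_univ_equiv,
    ← Real.sqrt_eq_rpow] at h1
  have h2 : ∑ k, ‖(y ∘ e) k‖ ^ s = ∑ k, ‖y k‖ ^ s := e.sum_comp fun k => ‖y k‖ ^ s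
  rw [h2] at h1
  have h3 : 0 ≤ ∑ k, ‖y k‖ ^ s := Finset.sum_nonneg fun k _ => by positivity
  calc _ = ((∑ k, ‖y k‖ ^ s) ^ (1 / s)) ^ 2 := (rpow_one_div_sq h3).symm
    _ ≤ (C * √(meanSq y Finset.univ)) ^ 2 := pow_le_pow_left₀ (by positivity) h1 2
    _ = _ := by rw [mul_pow, Real.sq_sqrt (meanSq_nonneg _ _)]

lemma exists_meanSq_lt_of_not_hasCotype {s : ℝ} (hs : 2 ≤ s) (h : ¬ HasCotype s E) {C : ℝ}
    (hC : 0 < C) : ∃ (n : ℕ) (x : Fin n → E),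
      C * meanSq x Finset.univ < (∑ k, ‖x k‖ ^ s) ^ (2 / s) := by
  by_contra! hx
  refine h ⟨hs, √C, Real.sqrt_pos.2 hC, fun n x => ?_⟩
  have h3 : 0 ≤ ∑ k, ‖x k‖ ^ s := Finset.sum_nonneg fun k _ => by positivity
  rw [integral_norm_sq_rademacher, ← Real.sqrt_eq_rpow, ← Real.sqrt_mul hC.le]
  refine Real.le_sqrt_of_sq_le ?_
  rw [rpow_one_div_sq h3]
  exact hx n x

variable {ι κ : Type} [Fintype ι] [Fintype κ] [DecidableEq κ]

lemma signed_sum_fiberwise (x : ι → E) (g : ι → κ) (ε : κ → ℤˣ) (σ : κ → ι → ℤˣ) :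
    ∑ k, sgn (ε k) • ∑ i with g i = k, sgn (σ k i) • x i
      = ∑ i, sgn (ε (g i) * σ (g i) i) • x i := by
  rw [← Finset.sum_fiberwise Finset.univ g]
  refine Finset.sum_congr rfl fun k _ => ?_
  rw [Finset.smul_sum]
  refine Finset.sum_congr rfl fun i hi => ?_
  rw [(Finset.mem_filter.1 hi).2, sgn_mul, mul_smul]

/-- Cotype bounds the mean squares over the blocks of a partition. -/
lemma sum_meanSq_fiber_le [DecidableEq ι] {s C : ℝ} (hs : 2 ≤ s)
    (hC : ∀ y : κ → E, (∑ k, ‖y k‖ ^ s) ^ (2 / s) ≤ C * meanSq y Finset.univ)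
    (x : ι → E) (g : ι → κ) :
    (∑ k, meanSq x (Finset.univ.filter fun i => g i = k) ^ (s / 2)) ^ (2 / s)
      ≤ C * meanSq x Finset.univ := by
  set y : (ι → ℤˣ) → κ → E := fun σ k => ∑ i with g i = k, sgn (σ i) • x i with hy
  have h1 := sum_expect_rpow_le (by linarith : 1 ≤ s / 2) (fun σ k => ‖y σ k‖ ^ 2)
    fun σ k => by positivity
  rw [one_div_div] at h1
  refine h1.trans ?_
  have h2 : ∀ σ k, (‖y σ k‖ ^ 2) ^ (s / 2) = ‖y σ k‖ ^ s := by
    intro σ k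
    rw [← Real.rpow_natCast, ← Real.rpow_mul (norm_nonneg _)]
    congr 1
    push_cast
    ring
  simp only [h2]
  have h3 : 𝔼 σ, meanSq (y σ) Finset.univ = meanSq x Finset.univ := by
    unfold meanSq
    rw [Finset.expect_comm, ← Fintype.expect_const (ι := κ → ℤˣ)
      (𝔼 σ : ι → ℤˣ, ‖∑ i, sgn (σ i) • x i‖ ^ 2)]
    refine Finset.expect_congr rfl fun ε _ => ?_
    refine Fintype.expect_equiv (Equiv.mulLeft (ε ∘ g)) _ _ fun σ => ?_
    simp only [hy, signed_sum_fiberwise x g ε fun _ => σ]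
    rfl
  calc _ ≤ 𝔼 σ, C * meanSq (y σ) Finset.univ := Finset.expect_le_expect fun σ _ => hC (y σ)
    _ = _ := by rw [← Finset.mul_expect, h3]

/-- Cotype bounds the maximal signed sums over the blocks of a partition. -/
lemma sum_signSup_fiber_le {s C : ℝ} (hC0 : 0 ≤ C)
    (hC : ∀ y : κ → E, (∑ k, ‖y k‖ ^ s) ^ (2 / s) ≤ C * meanSq y Finset.univ)
    (x : ι → E) (g : ι → κ) :
    (∑ k, signSup x (Finset.univ.filter fun i => g i = k) ^ s) ^ (2 / s)
      ≤ C * signSup x Finset.univ ^ 2 := by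
  choose σ hσ using fun k => exists_signSup_eq x (Finset.univ.filter fun i => g i = k)
  simp only [← hσ]
  refine (hC _).trans (mul_le_mul_of_nonneg_left ?_ hC0)
  refine Finset.expect_le Finset.univ_nonempty fun ε _ => pow_le_pow_left₀ (norm_nonneg _) ?_ 2
  rw [signed_sum_fiberwise]
  exact norm_signed_sum_le_signSup x Finset.univ fun i => ε (g i) * σ (g i) i

end Cotype

/-- If the total of `ψ` over the blocks of any partition of `ι` is at most `L`, then after the
removal of at most half of the points, `ψ` of each set is at most proportional to its size. -/
lemma exists_large_subset_forall_le_card {ι : Type*} [Fintype ι] [DecidableEq ι]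
    {ψ : Finset ι → ℝ} (h0 : ∀ A, 0 ≤ ψ A) (hempty : ψ ∅ = 0) {L : ℝ} (hL : 0 < L)
    (hψ : ∀ g : ι → Finset ι, ∑ k, ψ (Finset.univ.filter fun i => g i = k) ≤ L) :
    ∃ B : Finset ι, Fintype.card ι ≤ 2 * B.card ∧
      ∀ A ⊆ B, ψ A * Fintype.card ι ≤ 2 * L * A.card := by
  classical
  let P : Finset (Finset ι) → Prop := fun F =>
    (F : Set (Finset ι)).PairwiseDisjoint id ∧ ∀ A ∈ F, 2 * L * A.card < ψ A * Fintype.card ι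
  have hPe : P ∅ := ⟨by simp, by simp⟩
  obtain ⟨F, -, hF⟩ := Finset.exists_le_maximal (Finset.univ.filter P) (by simpa using hPe)
  have hPF : P F := by simpa using hF.prop
  have hmem : ∀ i ∈ F.biUnion id, ∃ A ∈ F, i ∈ A := fun i hi => by simpa using hi
  let g : ι → Finset ι := fun i =>
    if h : ∃ A ∈ F, i ∈ A then h.choose else ∅
  have hg : ∀ A ∈ F, (Finset.univ.filter fun i => g i = A) = A := by
    intro A hA
    have hne : A ≠ ∅ := by
      rintro rfl
      have := hPF.2 ∅ hA
      simp [hempty] at this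
    ext i
    simp only [Finset.mem_filter, Finset.mem_univ, true_and]
    constructor
    · intro h
      by_cases h1 : ∃ A ∈ F, i ∈ A
      · simp only [g, dif_pos h1] at h
        exact h ▸ h1.choose_spec.2
      · simp only [g, dif_neg h1] at h
        exact absurd h.symm hne
    · intro hi
      have h1 : ∃ A ∈ F, i ∈ A := ⟨A, hA, hi⟩
      simp only [g, dif_pos h1]
      by_contra hdis
      exact Finset.disjoint_left.1 (hPF.1 h1.choose_spec.1 hA hdis) h1.choose_spec.2 hi
  have hsum : ∑ A ∈ F, ψ A ≤ L := by
    calc ∑ A ∈ F, ψ A = ∑ A ∈ F, ψ (Finset.univ.filter fun i => g i = A) :=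
          Finset.sum_congr rfl fun A hA => by rw [hg A hA]
      _ ≤ ∑ A, ψ (Finset.univ.filter fun i => g i = A) :=
          Finset.sum_le_sum_of_subset_of_nonneg (Finset.subset_univ F) fun A _ _ => h0 _
      _ ≤ L := hψ g
  have hcard : 2 * (F.biUnion id).card ≤ Fintype.card ι := by
    rw [Finset.card_biUnion hPF.1]
    have h1 : 2 * L * ∑ A ∈ F, (A.card : ℝ) ≤ L * Fintype.card ι := by
      rw [Finset.mul_sum]
      calc _ ≤ ∑ A ∈ F, ψ A * Fintype.card ι := Finset.sum_le_sum fun A hA => (hPF.2 A hA).le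
        _ = (∑ A ∈ F, ψ A) * Fintype.card ι := by rw [Finset.sum_mul]
        _ ≤ _ := mul_le_mul_of_nonneg_right hsum (Nat.cast_nonneg _)
    have h2 : 2 * ∑ A ∈ F, (A.card : ℝ) ≤ Fintype.card ι :=
      le_of_mul_le_mul_left (by linarith) hL
    exact_mod_cast h2
  refine ⟨(F.biUnion id)ᶜ, ?_, fun A hA => ?_⟩
  · rw [Finset.card_compl]
    omega
  · by_contra! hlt
    have hdisj : ∀ B ∈ F, Disjoint A B := fun B hB =>
      Finset.disjoint_left.2 fun i hi hiB =>
        Finset.mem_compl.1 (hA hi) (Finset.mem_biUnion.2 ⟨B, hB, hiB⟩)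
    have hins : P (insert A F) := by
      refine ⟨?_, ?_⟩
      · rw [Finset.coe_insert]
        exact hPF.1.insert fun B hB _ => hdisj B hB
      · intro B hB
        rcases Finset.mem_insert.1 hB with rfl | hB
        · exact hlt
        · exact hPF.2 B hB
    have hAF : A ∈ F :=
      hF.le_of_ge (by simpa using hins) (Finset.subset_insert A F) (Finset.mem_insert_self A F)
    have hAe : A = ∅ := by simpa using hdisj A hAF
    rw [hAe, hempty] at hlt
    simp at hlt

/-- Removing the elements one by one, smallest first. -/
lemma sum_le_sum_range_of_forall_exists_le {ι : Type*} [DecidableEq ι] {u : ι → ℝ} {w : ℕ → ℝ}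
    (A : Finset ι) (h : ∀ B ⊆ A, B.Nonempty → ∃ i ∈ B, u i ≤ w B.card) :
    ∑ i ∈ A, u i ≤ ∑ k ∈ Finset.range A.card, w (k + 1) := by
  induction hn : A.card generalizing A with
  | zero => simp [Finset.card_eq_zero.1 hn]
  | succ n ih =>
    obtain ⟨i, hi, hiw⟩ := h A subset_rfl (Finset.card_pos.1 (by omega))
    have h1 := ih (A.erase i) (fun B hB => h B (hB.trans (Finset.erase_subset i A)))
      (by rw [Finset.card_erase_of_mem hi]; omega)
    rw [← Finset.sum_erase_add A u hi, Finset.sum_range_succ]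
    rw [hn] at hiw
    exact add_le_add h1 hiw

lemma exists_fin_injective_image_eq {ι : Type*} [DecidableEq ι] (B : Finset ι) :
    ∃ e : Fin B.card → ι, Function.Injective e ∧ Finset.univ.image e = B := by
  refine ⟨fun k => (B.equivFin.symm k : ι), fun i j h => ?_, ?_⟩
  · exact B.equivFin.symm.injective (Subtype.ext h)
  · ext i
    simp only [Finset.mem_image, Finset.mem_univ, true_and]
    constructor
    · rintro ⟨k, rfl⟩
      exact (B.equivFin.symm k).2
    · intro hi
      exact ⟨B.equivFin ⟨i, hi⟩, by simp⟩

section Families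

variable {E : Type*} [NormedAddCommGroup E] [NormedSpace ℝ E]

lemma meanSq_const_smul {ι : Type*} [Fintype ι] [DecidableEq ι] (c : ℝ) (x : ι → E)
    (A : Finset ι) : meanSq (fun i => c • x i) A = c ^ 2 * meanSq x A := by
  unfold meanSq
  rw [Finset.mul_expect]
  refine Finset.expect_congr rfl fun σ _ => ?_
  rw [← sq_abs c, ← Real.norm_eq_abs, ← mul_pow, ← norm_smul, Finset.smul_sum]
  simp only [smul_comm c]

variable (E) in
/-- There are arbitrarily large finite families of vectors of norm at least one whose random signed
sums have root mean square at most the power `γ` of the cardinality. -/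
def HasMeanSqFamilies (γ : ℝ) : Prop :=
  ∀ N : ℕ, ∃ n ≥ N, ∃ x : Fin n → E, (∀ i, 1 ≤ ‖x i‖) ∧
    meanSq x Finset.univ ≤ ((n : ℝ) ^ γ) ^ 2

lemma hasMeanSqFamilies_of_not_hasCotype {s γ : ℝ} (hs : 2 ≤ s) (h : ¬ HasCotype s E)
    (hγ : 1 / s < γ) : HasMeanSqFamilies E γ := by
  intro N
  have hs0 : 0 < s := by linarith
  have hγ0 : 0 < γ := (by positivity : 0 < 1 / s).trans hγ
  have hγs : 1 < γ * s := by rwa [div_lt_iff₀ hs0] at hγ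
  set K : ℝ := ((N : ℝ) + 1) ^ γ with hK
  have hK1 : 1 ≤ K := Real.one_le_rpow (by linarith [Nat.cast_nonneg (α := ℝ) N]) hγ0.le
  have hsum : Summable fun k : ℕ => (((k + 1 : ℕ) : ℝ) ^ (γ * s))⁻¹ :=
    (summable_nat_add_iff 1).2 (Real.summable_nat_rpow_inv.2 hγs)
  set Z : ℝ := ∑' k : ℕ, (((k + 1 : ℕ) : ℝ) ^ (γ * s))⁻¹ with hZ
  have hZ0 : 0 < Z := hsum.tsum_pos (fun k => by positivity) 0 (by positivity)
  obtain ⟨n, x, hx⟩ := exists_meanSq_lt_of_not_hasCotype hs h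
    (C := (K ^ s * Z) ^ (2 / s)) (by positivity)
  by_contra! hcon
  set r : ℝ := √(meanSq x Finset.univ) with hr
  have hr0 : 0 ≤ r := Real.sqrt_nonneg _
  have hr2 : r ^ 2 = meanSq x Finset.univ := Real.sq_sqrt (meanSq_nonneg _ _)
  have hxr : ∀ i, ‖x i‖ ≤ r := fun i =>
    Real.le_sqrt_of_sq_le (norm_sq_le_meanSq x (Finset.mem_univ i))
  have key : ∀ B ⊆ (Finset.univ : Finset (Fin n)), B.Nonempty →
      ∃ i ∈ B, ‖x i‖ ≤ r * K * ((B.card : ℝ) ^ γ)⁻¹ := by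
    intro B _ hB
    by_contra! hlt
    obtain ⟨i0, hi0⟩ := hB
    have hc0 : (0 : ℝ) < B.card := by exact_mod_cast Finset.card_pos.2 ⟨i0, hi0⟩
    have hcγ : 0 < (B.card : ℝ) ^ γ := by positivity
    have hrpos : 0 < r := by
      refine lt_of_lt_of_le ?_ (hxr i0)
      exact lt_of_le_of_lt (by positivity) (hlt i0 hi0)
    have hKc : K < (B.card : ℝ) ^ γ := by
      have h1 := (hlt i0 hi0).trans_le (hxr i0)
      rw [mul_assoc, mul_lt_iff_lt_one_right hrpos, ← div_eq_mul_inv, div_lt_one hcγ] at h1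
      exact h1
    have hNc : (N : ℝ) + 1 < B.card :=
      (Real.rpow_lt_rpow_iff (by positivity) hc0.le hγ0).1 hKc
    obtain ⟨e, he, heB⟩ := exists_fin_injective_image_eq B
    have heB' : ∀ k, e k ∈ B := fun k => heB ▸ Finset.mem_image_of_mem e (Finset.mem_univ k)
    set c : ℝ := (r * K)⁻¹ * (B.card : ℝ) ^ γ with hc
    have hcpos : 0 < c := by positivity
    have hNB : N ≤ B.card := by
      have : (N : ℝ) ≤ B.card := by linarith
      exact_mod_cast this
    refine absurd (hcon B.card hNB (fun k => c • x (e k)) fun k => ?_) (not_lt.2 ?_)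
    · rw [norm_smul, Real.norm_of_nonneg hcpos.le]
      have h1 := mul_le_mul_of_nonneg_left (hlt _ (heB' k)).le hcpos.le
      have h2 : c * (r * K * ((B.card : ℝ) ^ γ)⁻¹) = 1 := by
        rw [hc]; field_simp
      linarith
    · rw [meanSq_const_smul c (fun k => x (e k)) Finset.univ]
      have h1 := meanSq_comp_injective he x
      have h2 : meanSq (fun k => x (e k)) Finset.univ ≤ r ^ 2 := by
        rw [hr2]
        exact h1.le.trans (meanSq_mono x (Finset.subset_univ _))
      calc _ ≤ c ^ 2 * r ^ 2 := mul_le_mul_of_nonneg_left h2 (by positivity)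
        _ = ((B.card : ℝ) ^ γ / K) ^ 2 := by rw [hc]; field_simp
        _ ≤ _ := pow_le_pow_left₀ (by positivity) (div_le_self hcγ.le hK1) 2
  have hle := sum_le_sum_range_of_forall_exists_le (u := fun i => ‖x i‖ ^ s)
    (w := fun k => r ^ s * K ^ s * ((k : ℝ) ^ (γ * s))⁻¹) Finset.univ fun B hB hne => by
      obtain ⟨i, hi, hix⟩ := key B hB hne
      refine ⟨i, hi, ?_⟩
      have h1 := Real.rpow_le_rpow (norm_nonneg _) hix hs0.le
      rwa [Real.mul_rpow (by positivity) (by positivity), Real.mul_rpow hr0 (by positivity),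
        Real.inv_rpow (by positivity), ← Real.rpow_mul (Nat.cast_nonneg _)] at h1
  rw [← Finset.mul_sum] at hle
  have h1 : ∑ k, ‖x k‖ ^ s ≤ r ^ s * (K ^ s * Z) := by
    rw [← mul_assoc]
    refine hle.trans (mul_le_mul_of_nonneg_left ?_ (by positivity))
    exact hsum.sum_le_tsum _ fun k _ => by positivity
  have h2 := Real.rpow_le_rpow (Finset.sum_nonneg fun k _ => by positivity) h1
    (by positivity : 0 ≤ 2 / s)
  rw [Real.mul_rpow (by positivity) (by positivity), ← Real.rpow_mul hr0,
    mul_div_cancel₀ _ hs0.ne', Real.rpow_two, hr2] at h2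
  linarith [mul_comm (meanSq x Finset.univ) ((K ^ s * Z) ^ (2 / s))]

end Families

lemma le_rpow_of_rpow_two_div_le {a C r s : ℝ} (hs : 0 < s) (ha : 0 ≤ a) (hC : 0 ≤ C) (hr : 0 ≤ r)
    (h : a ^ (2 / s) ≤ C * r ^ 2) : a ≤ (√C * r) ^ s := by
  have h1 := Real.rpow_le_rpow (by positivity) h (by positivity : 0 ≤ s / 2)
  rw [← Real.rpow_mul ha, (by field_simp : 2 / s * (s / 2) = 1), Real.rpow_one] at h1
  refine h1.trans_eq ?_
  rw [← Real.sq_sqrt hC, Real.sqrt_sq (Real.sqrt_nonneg C), ← mul_pow, ← Real.rpow_natCast,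
    ← Real.rpow_mul (by positivity)]
  congr 1
  push_cast
  ring

lemma exists_large_subset_forall_le_rpow {n : ℕ} {s R : ℝ} (hn : 0 < n) (hs : 1 ≤ s) (hR : 0 < R)
    {f : Finset (Fin n) → ℝ} (h0 : ∀ A, 0 ≤ f A) (hempty : f ∅ = 0)
    (hf : ∀ g : Fin n → Finset (Fin n),
      ∑ k, f (Finset.univ.filter fun i => g i = k) ^ s ≤ R ^ s) :
    ∃ B : Finset (Fin n), n ≤ 2 * B.card ∧
      ∀ A ⊆ B, f A ≤ 2 * R * (n : ℝ) ^ (-(1 / s)) * (A.card : ℝ) ^ (1 / s) := by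
  have hs0 : 0 < s := by linarith
  have hn0 : (0 : ℝ) < n := by exact_mod_cast hn
  obtain ⟨B, hB, hBA⟩ := exists_large_subset_forall_le_card (ψ := fun A => f A ^ s)
    (fun A => Real.rpow_nonneg (h0 A) s) (by simp [hempty, hs0.ne']) (L := R ^ s) (by positivity) hf
  rw [Fintype.card_fin] at hB
  refine ⟨B, hB, fun A hA => ?_⟩
  have h1 := hBA A hA
  rw [Fintype.card_fin] at h1
  rw [← Real.rpow_le_rpow_iff (h0 A) (by positivity) hs0,
    Real.mul_rpow (by positivity) (by positivity), Real.mul_rpow (by positivity) (by positivity),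
    Real.mul_rpow (by positivity) hR.le, ← Real.rpow_mul hn0.le,
    ← Real.rpow_mul (Nat.cast_nonneg _), neg_mul, one_div_mul_cancel hs0.ne', Real.rpow_one,
    Real.rpow_neg_one]
  have h2 : (2 : ℝ) ≤ 2 ^ s := by
    simpa using Real.rpow_le_rpow_of_exponent_le one_le_two hs
  calc f A ^ s ≤ 2 * R ^ s * A.card / n := (le_div_iff₀ hn0).2 h1
    _ = 2 * (R ^ s * (n : ℝ)⁻¹ * A.card) := by ring
    _ ≤ 2 ^ s * (R ^ s * (n : ℝ)⁻¹ * A.card) := by gcongr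
    _ = _ := by ring

lemma sum_range_rpow_neg_le {β : ℝ} (h0 : 0 ≤ β) (h1 : β < 1) (n : ℕ) :
    ∑ k ∈ Finset.range n, ((k + 1 : ℕ) : ℝ) ^ (-β) ≤ (n : ℝ) ^ (1 - β) / (1 - β) := by
  induction n with
  | zero => simp [Real.zero_rpow (by linarith : 1 - β ≠ 0)]
  | succ n ih =>
    rw [Finset.sum_range_succ]
    have hm : (0 : ℝ) < ((n + 1 : ℕ) : ℝ) := by positivity
    set m : ℝ := ((n + 1 : ℕ) : ℝ) with hmdef
    have hn : (n : ℝ) = m * (1 + -(1 / m)) := by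
      rw [hmdef]; field_simp; push_cast; ring
    have hm1 : 1 ≤ m := by rw [hmdef]; push_cast; linarith [Nat.cast_nonneg (α := ℝ) n]
    have hinv : 1 / m ≤ 1 := by rw [div_le_one hm]; exact hm1
    have hB := rpow_one_add_le_one_add_mul_self (s := -(1 / m)) (by linarith)
      (by linarith : 0 ≤ 1 - β) (by linarith : 1 - β ≤ 1)
    have h2 : (n : ℝ) ^ (1 - β) ≤ m ^ (1 - β) - (1 - β) * m ^ (-β) := by
      rw [hn, Real.mul_rpow hm.le (by linarith)]
      calc _ ≤ m ^ (1 - β) * (1 + (1 - β) * -(1 / m)) :=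
            mul_le_mul_of_nonneg_left hB (by positivity)
        _ = _ := by
          rw [sub_eq_add_neg, Real.rpow_add hm, Real.rpow_one]
          field_simp
          ring
    have h3 : (n : ℝ) ^ (1 - β) / (1 - β) ≤ (m ^ (1 - β) - (1 - β) * m ^ (-β)) / (1 - β) :=
      div_le_div_of_nonneg_right h2 (by linarith)
    have h4 : (m ^ (1 - β) - (1 - β) * m ^ (-β)) / (1 - β) = m ^ (1 - β) / (1 - β) - m ^ (-β) := by
      have : 1 - β ≠ 0 := by linarith
      field_simp
    linarith

section Families

variable (E : Type*) [NormedAddCommGroup E] [NormedSpace ℝ E]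

/-- There are arbitrarily large finite families of vectors of norm at least one all of whose signed
sums have norm at most the power `γ` of the cardinality. -/
def HasSignSupFamilies (γ : ℝ) : Prop :=
  ∀ N : ℕ, ∃ n ≥ N, ∃ x : Fin n → E, (∀ i, 1 ≤ ‖x i‖) ∧ signSup x Finset.univ ≤ (n : ℝ) ^ γ

/-- There are arbitrarily large finite families of vectors of norm at least one whose weak `ℓ_b`
norm is at most the power `γ` of the cardinality. -/
def HasWeakFamilies (b γ : ℝ) : Prop :=
  ∀ N : ℕ, ∃ n ≥ N, ∃ x : Fin n → E, (∀ i, 1 ≤ ‖x i‖) ∧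
    ∀ φ : E →L[ℝ] ℝ, ∑ i, |φ (x i)| ^ b ≤ ((n : ℝ) ^ γ * ‖φ‖) ^ b

variable {E}

lemma exists_le_rpow_nat (K : ℝ) {ε : ℝ} (hε : 0 < ε) : ∃ N : ℕ, ∀ n ≥ N, K ≤ (n : ℝ) ^ ε := by
  have h := (tendsto_rpow_atTop hε).comp (tendsto_natCast_atTop_atTop (R := ℝ))
  exact Filter.eventually_atTop.1 (h.eventually_ge_atTop K)

lemma HasSignSupFamilies.hasWeakFamilies {s b γ γ' : ℝ} (hs : HasCotype s E) (hb : 1 ≤ b)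
    (hbs : b * (1 - 1 / s) < 1) (hγs : 1 / s ≤ γ) (h : HasSignSupFamilies E γ)
    (hγ : γ + 1 / b - 1 < γ') : HasWeakFamilies E b γ' := by
  intro N
  have hs2 : 2 ≤ s := hs.1
  have hs0 : 0 < s := by linarith
  have hb0 : 0 < b := by linarith
  have hs1 : 1 / s ≤ 1 := by rw [div_le_one hs0]; linarith
  set β : ℝ := b * (1 - 1 / s) with hβ
  have hβ0 : 0 ≤ β := mul_nonneg hb0.le (by linarith)
  obtain ⟨C, hC, hcot⟩ := hs.rpow_sum_le_meanSq
  set D : ℝ := 2 * √C * 2 ^ (γ - 1 / s) with hD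
  have hD0 : 0 < D := by positivity
  obtain ⟨N1, hN1⟩ := exists_le_rpow_nat (D * (1 / (1 - β)) ^ (1 / b))
    (by linarith : 0 < γ' - (γ + 1 / b - 1))
  obtain ⟨n, hn, x, hx1, hx⟩ := h (2 * (N + N1 + 1))
  have hn0 : 0 < n := by omega
  have hn0' : (0 : ℝ) < n := by exact_mod_cast hn0
  obtain ⟨B, hB, hBA⟩ := exists_large_subset_forall_le_rpow (s := s) (R := √C * (n : ℝ) ^ γ) hn0
    (by linarith) (by positivity) (f := signSup x) (signSup_nonneg x) (by simp [signSup])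
    fun g => by
      refine le_rpow_of_rpow_two_div_le hs0 (Finset.sum_nonneg fun k _ => ?_) hC.le
        (by positivity) ?_
      · exact Real.rpow_nonneg (signSup_nonneg _ _) _
      · refine (sum_signSup_fiber_le hC.le (hcot _) x g).trans ?_
        gcongr
        exact signSup_nonneg _ _
  have hB0 : (0 : ℝ) < B.card := by
    have : 0 < B.card := by omega
    exact_mod_cast this
  have hBA' : ∀ A ⊆ B, signSup x A ≤ D * (B.card : ℝ) ^ (γ - 1 / s) * (A.card : ℝ) ^ (1 / s) := by
    intro A hA
    refine (hBA A hA).trans ?_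
    refine mul_le_mul_of_nonneg_right ?_ (by positivity)
    have h1 : (n : ℝ) ≤ 2 * B.card := by exact_mod_cast hB
    calc 2 * (√C * (n : ℝ) ^ γ) * (n : ℝ) ^ (-(1 / s)) = 2 * √C * (n : ℝ) ^ (γ - 1 / s) := by
          rw [sub_eq_add_neg, Real.rpow_add hn0']; ring
      _ ≤ 2 * √C * (2 * B.card : ℝ) ^ (γ - 1 / s) := by
          gcongr
      _ = _ := by rw [Real.mul_rpow zero_le_two hB0.le, hD]; ring
  obtain ⟨e, he, heB⟩ := exists_fin_injective_image_eq B
  refine ⟨B.card, by omega, fun k => x (e k), fun k => hx1 _, fun φ => ?_⟩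
  have hsum : ∑ i, |φ (x (e i))| ^ b = ∑ i ∈ B, |φ (x i)| ^ b := by
    conv_rhs => rw [← heB]
    rw [Finset.sum_image fun i _ j _ h => he h]
  rw [hsum]
  set d : ℝ := ‖φ‖ * (D * (B.card : ℝ) ^ (γ - 1 / s)) with hd
  have hd0 : 0 ≤ d := by positivity
  have hle := sum_le_sum_range_of_forall_exists_le (u := fun i => |φ (x i)| ^ b)
    (w := fun k => d ^ b * (k : ℝ) ^ (-β)) B fun A hA hne => by
      obtain ⟨i, hi, him⟩ := A.exists_min_image (fun i => |φ (x i)|) hne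
      refine ⟨i, hi, ?_⟩
      have hA0 : (0 : ℝ) < A.card := by exact_mod_cast hne.card_pos
      have h1 : A.card * |φ (x i)| ≤ d * (A.card : ℝ) ^ (1 / s) := by
        calc A.card * |φ (x i)| = ∑ j ∈ A, |φ (x i)| := by simp
          _ ≤ ∑ j ∈ A, |φ (x j)| := Finset.sum_le_sum him
          _ ≤ ‖φ‖ * signSup x A := sum_abs_apply_le_signSup x A φ
          _ ≤ _ := by
            rw [hd, mul_assoc]
            exact mul_le_mul_of_nonneg_left (hBA' A hA) (norm_nonneg _)
      have h2 : |φ (x i)| ≤ d * (A.card : ℝ) ^ (1 / s - 1) := by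
        rw [Real.rpow_sub_one hA0.ne', ← mul_div_assoc, le_div_iff₀ hA0]
        linarith
      refine (Real.rpow_le_rpow (abs_nonneg _) h2 hb0.le).trans_eq ?_
      rw [Real.mul_rpow hd0 (by positivity), ← Real.rpow_mul hA0.le]
      congr 2
      rw [hβ]; ring
  rw [← Finset.mul_sum] at hle
  refine hle.trans ?_
  refine (mul_le_mul_of_nonneg_left (sum_range_rpow_neg_le hβ0 hbs B.card) (by positivity)).trans ?_
  have hNc := hN1 B.card (by omega)
  have hβb : (B.card : ℝ) ^ (1 - β) = ((B.card : ℝ) ^ (1 / b - 1 + 1 / s)) ^ b := by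
    rw [← Real.rpow_mul hB0.le]
    congr 1
    rw [hβ]; field_simp; ring
  have h1β : 0 < 1 - β := by linarith
  set W : ℝ := (1 / (1 - β)) ^ (1 / b) with hW
  have hW0 : 0 ≤ W := Real.rpow_nonneg (one_div_pos.2 h1β).le _
  have hcb : 1 / (1 - β) = W ^ b := by
    rw [hW, ← Real.rpow_mul (one_div_pos.2 h1β).le, one_div_mul_cancel hb0.ne', Real.rpow_one]
  have hc0 : 0 ≤ (B.card : ℝ) ^ (1 / b - 1 + 1 / s) := Real.rpow_nonneg hB0.le _
  rw [div_eq_mul_one_div, hcb, hβb, ← Real.mul_rpow hc0 hW0, ← Real.mul_rpow hd0 (mul_nonneg hc0 hW0)]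
  refine Real.rpow_le_rpow (mul_nonneg hd0 (mul_nonneg hc0 hW0)) ?_ hb0.le
  have hfin : d * ((B.card : ℝ) ^ (1 / b - 1 + 1 / s) * W)
      = D * W * (B.card : ℝ) ^ (γ + 1 / b - 1) * ‖φ‖ := by
    have h1 : (B.card : ℝ) ^ (γ + 1 / b - 1)
        = (B.card : ℝ) ^ (γ - 1 / s) * (B.card : ℝ) ^ (1 / b - 1 + 1 / s) := by
      rw [← Real.rpow_add hB0]
      congr 1
      ring
    rw [hd, h1]
    ring
  have hpow : (B.card : ℝ) ^ (γ' - (γ + 1 / b - 1)) * (B.card : ℝ) ^ (γ + 1 / b - 1)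
      = (B.card : ℝ) ^ γ' := by rw [← Real.rpow_add hB0, sub_add_cancel]
  rw [hfin, ← hpow]
  exact mul_le_mul_of_nonneg_right
    (mul_le_mul_of_nonneg_right hNc (Real.rpow_nonneg hB0.le _)) (norm_nonneg _)

end Families

section Selection

variable {E : Type*} [NormedAddCommGroup E] [NormedSpace ℝ E]

lemma expect_norm_le_sqrt_meanSq {ι : Type*} [Fintype ι] [DecidableEq ι] (x : ι → E)
    (A : Finset ι) : 𝔼 σ : ι → ℤˣ, ‖∑ i ∈ A, sgn (σ i) • x i‖ ≤ √(meanSq x A) := by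
  refine Real.le_sqrt_of_sq_le ?_
  have h := Finset.expect_mul_sq_le_sq_mul_sq Finset.univ
    (fun σ : ι → ℤˣ => ‖∑ i ∈ A, sgn (σ i) • x i‖) fun _ => (1 : ℝ)
  simpa [meanSq] using h

/-- A random choice of one vector from each of `m` blocks yields a family whose signed sums are
uniformly small. -/
lemma exists_selection_signSup_le {n m M : ℕ} (hM : 0 < M) {s D : ℝ}
    (x : Fin n → E) (e : Fin m × Fin M → Fin n) (he : Function.Injective e)
    (hD : ∀ A ⊆ Finset.univ.image e, √(meanSq x A) ≤ D * (A.card : ℝ) ^ (1 / s)) :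
    ∃ c : Fin m → Fin M, signSup (fun j => x (e (j, c j))) Finset.univ ≤
      √(m * M : ℝ) * (D * (m * M : ℝ) ^ (1 / s)) / M + 2 * (D * (m : ℝ) ^ (1 / s)) := by
  have hM0 : (0 : ℝ) < M := by exact_mod_cast hM
  have : NeZero M := ⟨hM.ne'⟩
  let T := (Fin m → Fin M) × (Fin m → ℤˣ)
  choose Φ hΦ hΦx using fun t : T =>
    exists_dual_vector'' ℝ (∑ j, sgn (t.2 j) • x (e (j, t.1 j)))
  set f : T → Fin m → Fin M → ℝ := fun t j k => Φ t (x (e (j, k))) with hf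
  have hexp := expect_iSup_sum_abs_le (fun _ : T => (0 : ℝ)) f
  have hmean : ∀ t, ∑ j, 𝔼 k, |f t j k| ≤ √(m * M : ℝ) * (D * (m * M : ℝ) ^ (1 / s)) / M := by
    intro t
    have h1 : ∑ j, 𝔼 k, |f t j k| = (∑ i ∈ Finset.univ.image e, |Φ t (x i)|) / M := by
      rw [Finset.sum_image fun i _ j _ h => he h, Fintype.sum_prod_type, Finset.sum_div]
      refine Finset.sum_congr rfl fun j _ => ?_
      rw [Fintype.expect_eq_sum_div_card, Fintype.card_fin]
    have hcard : (((Finset.univ.image e).card : ℕ) : ℝ) = m * M := by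
      rw [Finset.card_image_of_injective _ he]
      simp
    have h2 := sum_abs_apply_le_sqrt x (Finset.univ.image e) (hΦ t)
    rw [Real.sqrt_mul (Nat.cast_nonneg _), hcard] at h2
    have h3 := hD _ (subset_refl (Finset.univ.image e))
    rw [hcard] at h3
    rw [h1]
    gcongr
    exact h2.trans (mul_le_mul_of_nonneg_left h3 (Real.sqrt_nonneg _))
  have hsup : 𝔼 c : Fin m → Fin M,
      ⨆ t, ((0 : ℝ) + ∑ j, (|f t j (c j)| - 𝔼 k, |f t j k|)) ≤ 2 * (D * (m : ℝ) ^ (1 / s)) := by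
    refine hexp.trans (Finset.expect_le Finset.univ_nonempty fun c _ => ?_)
    have hinj : Function.Injective fun j => e (j, c j) := fun i j h => (Prod.ext_iff.1 (he h)).1
    have h1 : ∀ σ : Fin m → ℤˣ, ⨆ t, ((0 : ℝ) + 2 * ∑ j, sgn (σ j) * f t j (c j))
        ≤ 2 * ‖∑ j, sgn (σ j) • x (e (j, c j))‖ := by
      intro σ
      refine ciSup_le fun t => ?_
      have h2 : ∑ j, sgn (σ j) * f t j (c j) = Φ t (∑ j, sgn (σ j) • x (e (j, c j))) := by
        simp [hf]
      rw [zero_add, h2]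
      refine mul_le_mul_of_nonneg_left ?_ zero_le_two
      refine (le_abs_self _).trans (((Φ t).le_opNorm _).trans ?_)
      exact mul_le_of_le_one_left (norm_nonneg _) (hΦ t)
    refine (Finset.expect_le_expect fun σ _ => h1 σ).trans ?_
    rw [← Finset.mul_expect]
    refine mul_le_mul_of_nonneg_left ?_ zero_le_two
    refine (expect_norm_le_sqrt_meanSq (fun j => x (e (j, c j))) Finset.univ).trans ?_
    have h3 := meanSq_comp_injective hinj x
    have h4 := hD (Finset.univ.image fun j => e (j, c j)) fun i hi => by
      obtain ⟨j, -, rfl⟩ := Finset.mem_image.1 hi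
      exact Finset.mem_image_of_mem e (Finset.mem_univ _)
    rw [← h3, Finset.card_image_of_injective _ hinj, Finset.card_univ, Fintype.card_fin] at h4
    exact h4
  obtain ⟨c, -, hc⟩ := Finset.exists_le_of_expect_le Finset.univ_nonempty hsup
  refine ⟨c, ?_⟩
  obtain ⟨σ, hσ⟩ := exists_signSup_eq (fun j => x (e (j, c j))) Finset.univ
  have h1 : signSup (fun j => x (e (j, c j))) Finset.univ ≤ ∑ j, |f (c, σ) j (c j)| := by
    have h2 := hΦx (c, σ)
    simp only [RCLike.ofReal_real_eq_id, id_eq] at h2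
    rw [← hσ, ← h2, map_sum]
    refine Finset.sum_le_sum fun j _ => ?_
    rw [map_smul, smul_eq_mul]
    refine (le_abs_self _).trans ?_
    rw [abs_mul, abs_sgn, one_mul]
  have h2 := le_finite_ciSup
    (fun t : T => (0 : ℝ) + ∑ j, (|f t j (c j)| - 𝔼 k, |f t j k|)) (c, σ)
  simp only [Finset.sum_sub_distrib, zero_add] at h2 hc
  linarith [hmean (c, σ)]

lemma HasMeanSqFamilies.hasSignSupFamilies {s γ γ' : ℝ} {p : ℕ} (hs : HasCotype s E)
    (hp : 1 / 2 ≤ p * (1 / 2 - 1 / s)) (hγs : 1 / s ≤ γ) (h : HasMeanSqFamilies E γ)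
    (hγ : (p + 1) * (γ - 1 / s) + 1 / s < γ') : HasSignSupFamilies E γ' := by
  intro N
  have hs0 : 0 < s := by linarith [hs.1]
  obtain ⟨C, hC, hcot⟩ := hs.rpow_sum_le_meanSq
  set K : ℝ := 3 * (2 * √C * ((2 : ℝ) ^ (p + 2)) ^ (γ - 1 / s)) with hK
  obtain ⟨N1, hN1⟩ := exists_le_rpow_nat K
    (by linarith : 0 < γ' - ((p + 1) * (γ - 1 / s) + 1 / s))
  obtain ⟨n, hn, x, hx1, hx⟩ := h (2 * (N + N1 + 1) ^ (p + 1))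
  have hNN : 0 < (N + N1 + 1) ^ (p + 1) := by positivity
  have hn0 : 0 < n := by omega
  have hn0' : (0 : ℝ) < n := by exact_mod_cast hn0
  obtain ⟨m, hmN, hm1, hm2⟩ : ∃ m ≥ N + N1 + 1, 2 * m ^ (p + 1) ≤ n ∧
      n < 2 * (m + 1) ^ (p + 1) := by
    have hle : N + N1 + 1 ≤ n := by
      have := Nat.le_self_pow (n := p + 1) (by omega) (N + N1 + 1)
      omega
    refine ⟨Nat.findGreatest (fun m => 2 * m ^ (p + 1) ≤ n) n, Nat.le_findGreatest hle hn,
      Nat.findGreatest_spec (P := fun m => 2 * m ^ (p + 1) ≤ n) hle hn, ?_⟩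
    by_contra! hlt
    have h1 : Nat.findGreatest (fun m => 2 * m ^ (p + 1) ≤ n) n + 1 ≤ n := by
      have := Nat.le_self_pow (n := p + 1) (by omega)
        (Nat.findGreatest (fun m => 2 * m ^ (p + 1) ≤ n) n + 1)
      omega
    have := Nat.le_findGreatest (P := fun m => 2 * m ^ (p + 1) ≤ n) h1 hlt
    omega
  have hm0 : (0 : ℝ) < m := by
    have : 0 < m := by omega
    exact_mod_cast this
  obtain ⟨B, hB, hBA⟩ := exists_large_subset_forall_le_rpow (s := s) (R := √C * (n : ℝ) ^ γ) hn0
    (by linarith [hs.1]) (by positivity) (f := fun A => √(meanSq x A))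
    (fun A => Real.sqrt_nonneg _) (by simp [meanSq])
    fun g => by
      refine le_rpow_of_rpow_two_div_le hs0 (Finset.sum_nonneg fun k _ => ?_) hC.le
        (by positivity) ?_
      · exact Real.rpow_nonneg (Real.sqrt_nonneg _) _
      · have h1 := sum_meanSq_fiber_le hs.1 (hcot _) x g
        have h2 : ∀ A, √(meanSq x A) ^ s = meanSq x A ^ (s / 2) := fun A => by
          rw [Real.sqrt_eq_rpow, ← Real.rpow_mul (meanSq_nonneg _ _)]
          congr 1
          ring
        simp only [h2]
        exact h1.trans (mul_le_mul_of_nonneg_left hx hC.le)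
  set D : ℝ := 2 * (√C * (n : ℝ) ^ γ) * (n : ℝ) ^ (-(1 / s)) with hD
  obtain ⟨e0, he0, he0B⟩ := exists_fin_injective_image_eq B
  have hcard : m * m ^ p ≤ B.card := by
    rw [← pow_succ']
    omega
  let e : Fin m × Fin (m ^ p) → Fin n := e0 ∘ Fin.castLE hcard ∘ finProdFinEquiv
  have he : Function.Injective e :=
    he0.comp ((Fin.castLE_injective hcard).comp finProdFinEquiv.injective)
  have heB : Finset.univ.image e ⊆ B := fun i hi => by
    obtain ⟨j, -, rfl⟩ := Finset.mem_image.1 hi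
    exact he0B ▸ Finset.mem_image_of_mem e0 (Finset.mem_univ _)
  obtain ⟨c, hc⟩ := exists_selection_signSup_le (pow_pos (by omega : 0 < m) p) x e he
    fun A hA => hBA A (hA.trans heB)
  refine ⟨m, by omega, fun j => x (e (j, c j)), fun j => hx1 _, hc.trans ?_⟩
  have hm1' : (1 : ℝ) ≤ m := by
    have : 1 ≤ m := by omega
    exact_mod_cast this
  have hD0 : 0 ≤ D := by positivity
  have hmm : (m : ℝ) * ((m ^ p : ℕ) : ℝ) = (m : ℝ) ^ ((p : ℝ) + 1) := by
    rw [Real.rpow_add_one hm0.ne', Real.rpow_natCast, Nat.cast_pow, mul_comm]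
  have hfirst : √(m * (m ^ p : ℕ) : ℝ) * (m * (m ^ p : ℕ) : ℝ) ^ (1 / s) / (m ^ p : ℕ)
      ≤ (m : ℝ) ^ (1 / s) := by
    rw [hmm, Real.sqrt_eq_rpow, ← Real.rpow_mul hm0.le, ← Real.rpow_mul hm0.le, Nat.cast_pow,
      ← Real.rpow_natCast (m : ℝ) p, ← Real.rpow_add hm0, ← Real.rpow_sub hm0]
    refine Real.rpow_le_rpow_of_exponent_le hm1' ?_
    linarith
  have hnm : (n : ℝ) ≤ 2 ^ (p + 2) * (m : ℝ) ^ ((p : ℝ) + 1) := by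
    have h1 : n ≤ 2 * (m + m) ^ (p + 1) :=
      hm2.le.trans (Nat.mul_le_mul_left 2 (Nat.pow_le_pow_left (by omega) _))
    have h2 : (n : ℝ) ≤ 2 * ((m : ℝ) + m) ^ (p + 1) := by exact_mod_cast h1
    refine h2.trans_eq ?_
    rw [Real.rpow_add_one hm0.ne', Real.rpow_natCast, ← two_mul, mul_pow]
    ring
  have hDm : 3 * D ≤ K * (m : ℝ) ^ ((p + 1) * (γ - 1 / s)) := by
    have h1 : D = 2 * √C * (n : ℝ) ^ (γ - 1 / s) := by
      rw [hD, sub_eq_add_neg, Real.rpow_add hn0']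
      ring
    have h2 := Real.rpow_le_rpow hn0'.le hnm (by linarith : 0 ≤ γ - 1 / s)
    rw [Real.mul_rpow (by positivity) (by positivity), ← Real.rpow_mul hm0.le] at h2
    have h3 := mul_le_mul_of_nonneg_left h2 (by positivity : 0 ≤ 3 * (2 * √C))
    rw [h1, hK]
    linarith
  have hKm := hN1 m (by omega)
  calc _ = D * (√(m * (m ^ p : ℕ) : ℝ) * (m * (m ^ p : ℕ) : ℝ) ^ (1 / s) / (m ^ p : ℕ))
        + 2 * (D * (m : ℝ) ^ (1 / s)) := by ring
    _ ≤ D * (m : ℝ) ^ (1 / s) + 2 * (D * (m : ℝ) ^ (1 / s)) := by gcongr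
    _ = 3 * D * (m : ℝ) ^ (1 / s) := by ring
    _ ≤ (m : ℝ) ^ (γ' - ((p + 1) * (γ - 1 / s) + 1 / s)) * (m : ℝ) ^ ((p + 1) * (γ - 1 / s))
        * (m : ℝ) ^ (1 / s) := by
      refine mul_le_mul_of_nonneg_right (hDm.trans ?_) (by positivity)
      exact mul_le_mul_of_nonneg_right hKm (by positivity)
    _ = _ := by
      rw [← Real.rpow_add hm0, ← Real.rpow_add hm0]
      congr 1
      ring

end Selection

section DvoretzkyRogers

variable {V F : Type*} [NormedAddCommGroup V] [InnerProductSpace ℝ V] [FiniteDimensional ℝ V]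
  [NormedAddCommGroup F] [NormedSpace ℝ F]

lemma det_id_add_starProjection (W : Submodule ℝ V) :
    (ContinuousLinearMap.id ℝ V + W.starProjection).det = 2 ^ Module.finrank ℝ W := by
  set f : V →ₗ[ℝ] V := ((ContinuousLinearMap.id ℝ V + W.starProjection : V →L[ℝ] V) : V →ₗ[ℝ] V) with hf
  have hfx : ∀ x, f x = x + W.starProjection x := fun x => rfl
  have hW : W ≤ W.comap f := fun x hx =>
    W.add_mem hx (W.starProjection_apply_mem x)
  have h1 : f.restrict hW = (2 : ℝ) • LinearMap.id := by
    ext x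
    have : W.starProjection (x : V) = x := Submodule.starProjection_eq_self_iff.2 x.2
    simp [hfx, this, two_smul]
  have h2 : W.mapQ W f hW = LinearMap.id := by
    refine Submodule.linearMap_qext _ (LinearMap.ext fun x => ?_)
    simp only [LinearMap.comp_apply, Submodule.mapQ_apply, Submodule.mkQ_apply, LinearMap.id_apply]
    rw [Submodule.Quotient.eq, hfx, add_sub_cancel_left]
    exact W.starProjection_apply_mem x
  change LinearMap.det f = _
  rw [LinearMap.det_eq_det_mul_det W f hW, h1, h2, LinearMap.det_smul, LinearMap.det_id,
    LinearMap.det_id, mul_one, mul_one]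

/-- An operator of maximal determinant in the unit ball is bounded below somewhere on every subspace
of at least half the dimension. -/
lemma exists_norm_le_one_forall_subspace [FiniteDimensional ℝ F]
    (hVF : Module.finrank ℝ V = Module.finrank ℝ F) :
    ∃ T : V →L[ℝ] F, ‖T‖ ≤ 1 ∧ ∀ W : Submodule ℝ V, 0 < Module.finrank ℝ W →
      Module.finrank ℝ V ≤ 2 * Module.finrank ℝ W → ∃ f ∈ W, ‖f‖ = 1 ∧ 2 / 5 ≤ ‖T f‖ := by
  have J : F ≃L[ℝ] V := ContinuousLinearEquiv.ofFinrankEq hVF.symm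
  have : ProperSpace (V →L[ℝ] F) := FiniteDimensional.proper ℝ _
  set δ : (V →L[ℝ] F) → ℝ := fun T => |((J : F →L[ℝ] V).comp T).det| with hδ
  have hcont : Continuous δ := by
    refine continuous_abs.comp (ContinuousLinearMap.continuous_det.comp ?_)
    exact continuous_const.clm_comp continuous_id
  obtain ⟨T, hT, hmax⟩ := (isCompact_closedBall (0 : V →L[ℝ] F) 1).exists_isMaxOn
    ⟨0, by simp⟩ hcont.continuousOn
  have hmul : ∀ (S : V →L[ℝ] F) (c : ℝ) (A : V →L[ℝ] V),
      δ (c • S.comp A) = |c| ^ Module.finrank ℝ V * (δ S * |A.det|) := by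
    intro S c A
    have h1 : (J : F →L[ℝ] V).comp (c • S.comp A) = c • ((J : F →L[ℝ] V).comp S).comp A := by
      ext x
      simp
    have h2 : ∀ A B : V →L[ℝ] V, (A.comp B).det = A.det * B.det := fun A B =>
      LinearMap.det_comp (A : V →ₗ[ℝ] V) B
    have h3 : ∀ A : V →L[ℝ] V, (c • A).det = c ^ Module.finrank ℝ V * A.det := fun A =>
      LinearMap.det_smul c (A : V →ₗ[ℝ] V)
    simp only [hδ]
    rw [h1, h3, h2, abs_mul, abs_mul, abs_pow]
  have hTpos : 0 < δ T := by
    set c : ℝ := (‖(J.symm : V →L[ℝ] F)‖ + 1)⁻¹ with hc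
    have hc0 : 0 < c := by positivity
    have hmem : c • (J.symm : V →L[ℝ] F) ∈ Metric.closedBall (0 : V →L[ℝ] F) 1 := by
      rw [mem_closedBall_zero_iff, norm_smul, Real.norm_of_nonneg hc0.le, hc, inv_mul_le_one₀]
      · linarith
      · positivity
    refine lt_of_lt_of_le ?_ (hmax hmem)
    have h1 := hmul J.symm c (ContinuousLinearMap.id ℝ V)
    rw [ContinuousLinearMap.comp_id] at h1
    rw [h1]
    have h2 : δ (J.symm : V →L[ℝ] F) = 1 := by
      simp only [hδ]
      rw [ContinuousLinearEquiv.coe_comp_coe_symm]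
      change |LinearMap.det (LinearMap.id : V →ₗ[ℝ] V)| = 1
      simp
    have h3 : (ContinuousLinearMap.id ℝ V).det = 1 := LinearMap.det_id
    rw [h2, h3]
    simp only [abs_one, mul_one]
    positivity
  refine ⟨T, by simpa using hT, fun W hW0 hW => ?_⟩
  by_contra! hlt
  have hsmall : ∀ f ∈ W, ‖T f‖ ≤ 2 / 5 * ‖f‖ := by
    intro f hf
    rcases eq_or_ne f 0 with rfl | hf0
    · simp
    · have h1 := hlt (‖f‖⁻¹ • f) (W.smul_mem _ hf) (norm_smul_inv_norm (𝕜 := ℝ) hf0)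
      have hpos : 0 < ‖f‖ := norm_pos_iff.2 hf0
      rw [map_smul, norm_smul, norm_inv, norm_norm, inv_mul_lt_iff₀ hpos] at h1
      linarith
  have hT1 : ‖T‖ ≤ 1 := by simpa using hT
  set T' : V →L[ℝ] F := (5 / 7 : ℝ) • T.comp (ContinuousLinearMap.id ℝ V + W.starProjection)
  have hT' : T' ∈ Metric.closedBall (0 : V →L[ℝ] F) 1 := by
    rw [mem_closedBall_zero_iff]
    refine ContinuousLinearMap.opNorm_le_bound _ zero_le_one fun v => ?_
    have h1 : T' v = (5 / 7 : ℝ) • (T v + T (W.starProjection v)) := by simp [T']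
    rw [h1, norm_smul, Real.norm_of_nonneg (by norm_num)]
    have h2 := norm_add_le (T v) (T (W.starProjection v))
    have h3 := hsmall _ (W.starProjection_apply_mem v)
    have h4 : ‖W.starProjection v‖ ≤ ‖v‖ := W.norm_starProjection_apply_le v
    have h5 : ‖T v‖ ≤ ‖v‖ :=
      (T.le_opNorm v).trans (mul_le_of_le_one_left (norm_nonneg _) hT1)
    linarith
  have h1 : δ T' ≤ δ T := hmax hT'
  rw [hmul, det_id_add_starProjection, abs_of_nonneg (by norm_num : (0 : ℝ) ≤ 5 / 7),
    abs_of_nonneg (by positivity : (0 : ℝ) ≤ 2 ^ Module.finrank ℝ W)] at h1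
  have h2 : (5 / 7 : ℝ) ^ (2 * Module.finrank ℝ W) ≤ (5 / 7 : ℝ) ^ Module.finrank ℝ V :=
    pow_le_pow_of_le_one (by norm_num) (by norm_num) hW
  have h3 : (5 / 7 : ℝ) ^ (2 * Module.finrank ℝ W) * 2 ^ Module.finrank ℝ W
      = (50 / 49) ^ Module.finrank ℝ W := by
    rw [pow_mul, ← mul_pow]
    norm_num
  have h4 : (1 : ℝ) < (50 / 49) ^ Module.finrank ℝ W := one_lt_pow₀ (by norm_num) hW0.ne'
  have h5 : (5 / 7 : ℝ) ^ (2 * Module.finrank ℝ W) * (δ T * 2 ^ Module.finrank ℝ W) ≤ δ T :=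
    (mul_le_mul_of_nonneg_right h2 (by positivity)).trans h1
  have h6 : δ T * (50 / 49) ^ Module.finrank ℝ W ≤ δ T := by
    rw [← h3]
    linarith
  nlinarith

lemma exists_orthonormal_forall_le_norm {T : V →L[ℝ] F}
    (hT : ∀ W : Submodule ℝ V, 0 < Module.finrank ℝ W →
      Module.finrank ℝ V ≤ 2 * Module.finrank ℝ W → ∃ f ∈ W, ‖f‖ = 1 ∧ 2 / 5 ≤ ‖T f‖) {m : ℕ}
    (hm : Module.finrank ℝ V = 2 * m) (k : ℕ) (hk : k ≤ m) :
    ∃ f : Fin k → V, Orthonormal ℝ f ∧ ∀ i, 2 / 5 ≤ ‖T (f i)‖ := by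
  induction k with
  | zero => exact ⟨fun i => i.elim0, ⟨fun i => i.elim0, fun i => i.elim0⟩, fun i => i.elim0⟩
  | succ k ih =>
    obtain ⟨f, hf, hfT⟩ := ih (by omega)
    set W : Submodule ℝ V := (Submodule.span ℝ (Set.range f))ᗮ with hW
    have hrank : k + Module.finrank ℝ W = 2 * m := by
      rw [← hm, ← Submodule.finrank_add_finrank_orthogonal (Submodule.span ℝ (Set.range f)),
        finrank_span_eq_card hf.linearIndependent, Fintype.card_fin]
    obtain ⟨g, hgW, hg1, hgT⟩ := hT W (by omega) (by omega)
    have hfg : ∀ i, inner ℝ (f i) g = 0 := fun i =>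
      hgW _ (Submodule.subset_span (Set.mem_range_self i))
    refine ⟨Fin.snoc f g, ⟨fun i => ?_, fun i j hij => ?_⟩, fun i => ?_⟩
    · refine Fin.lastCases ?_ (fun i => ?_) i
      · simpa using hg1
      · simpa using hf.1 i
    · induction i using Fin.lastCases with
      | last =>
        induction j using Fin.lastCases with
        | last => exact absurd rfl hij
        | cast j => simpa [real_inner_comm] using hfg j
      | cast i =>
        induction j using Fin.lastCases with
        | last => simpa using hfg i
        | cast j => simpa using hf.2 fun h => hij (by rw [h])
    · refine Fin.lastCases ?_ (fun i => ?_) i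
      · simpa using hgT
      · simpa using hfT i

variable {E : Type*} [NormedAddCommGroup E] [NormedSpace ℝ E]

/-- The Dvoretzky–Rogers lemma, in a form with an absolute constant. -/
lemma exists_one_le_norm_sum_sq_apply_le (hE : ¬ FiniteDimensional ℝ E) (m : ℕ) :
    ∃ x : Fin m → E, (∀ i, 1 ≤ ‖x i‖) ∧
      ∀ φ : E →L[ℝ] ℝ, ∑ i, φ (x i) ^ 2 ≤ (5 / 2 * ‖φ‖) ^ 2 := by
  have hrank : ((2 * m : ℕ) : Cardinal) ≤ Module.rank ℝ E :=
    (Cardinal.natCast_le_aleph0).trans (not_lt.1 fun h => hE (Module.rank_lt_aleph0_iff.1 h))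
  obtain ⟨S, hS, hlin⟩ := exists_finset_linearIndependent_of_le_rank hrank
  let F : Submodule ℝ E := Submodule.span ℝ (S : Set E)
  have : FiniteDimensional ℝ F := FiniteDimensional.span_finset ℝ S
  have hF : Module.finrank ℝ F = 2 * m := (finrank_span_finset_eq_card hlin).trans hS
  let V := EuclideanSpace ℝ (Fin (2 * m))
  have hV : Module.finrank ℝ V = 2 * m := finrank_euclideanSpace_fin
  obtain ⟨T, hT1, hT⟩ := exists_norm_le_one_forall_subspace (V := V) (hV.trans hF.symm)
  obtain ⟨f, hf, hfT⟩ := exists_orthonormal_forall_le_norm hT hV m le_rfl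
  refine ⟨fun i => (5 / 2 : ℝ) • (T (f i) : E), fun i => ?_, fun φ => ?_⟩
  · rw [norm_smul, Real.norm_of_nonneg (by norm_num)]
    have h1 : 2 / 5 ≤ ‖(T (f i) : E)‖ := hfT i
    linarith
  · let ψ : V →L[ℝ] ℝ := (φ.comp F.subtypeL).comp T
    let v : V := (InnerProductSpace.toDual ℝ V).symm ψ
    have hv : ∀ i, inner ℝ (f i) v = φ (T (f i)) := fun i => by
      rw [real_inner_comm]
      exact InnerProductSpace.toDual_symm_apply
    have hvn : ‖v‖ ≤ ‖φ‖ := by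
      rw [LinearIsometryEquiv.norm_map]
      refine ContinuousLinearMap.opNorm_le_bound _ (norm_nonneg _) fun w => ?_
      have h1 : ‖(T w : E)‖ ≤ ‖w‖ :=
        (T.le_opNorm w).trans (mul_le_of_le_one_left (norm_nonneg _) hT1)
      exact (φ.le_opNorm _).trans (mul_le_mul_of_nonneg_left h1 (norm_nonneg _))
    have h1 := hf.sum_inner_products_le v (s := Finset.univ)
    simp only [hv, Real.norm_eq_abs, sq_abs] at h1
    have h2 : ‖v‖ ^ 2 ≤ ‖φ‖ ^ 2 := pow_le_pow_left₀ (norm_nonneg _) hvn 2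
    simp only [map_smul, smul_eq_mul, mul_pow, ← Finset.mul_sum]
    linarith

lemma hasWeakFamilies_of_not_finiteDimensional (hE : ¬ FiniteDimensional ℝ E) {b γ : ℝ}
    (hb : 1 ≤ b) (hb2 : b ≤ 2) (hγ : 1 / b - 1 / 2 < γ) : HasWeakFamilies E b γ := by
  intro N
  have hb0 : 0 < b := by linarith
  obtain ⟨N1, hN1⟩ := exists_le_rpow_nat (5 / 2) (by linarith : 0 < γ - (1 / b - 1 / 2))
  set n : ℕ := N + N1 + 1 with hn
  have hn0 : (0 : ℝ) < n := by positivity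
  obtain ⟨x, hx1, hx⟩ := exists_one_le_norm_sum_sq_apply_le hE n
  refine ⟨n, by omega, x, hx1, fun φ => ?_⟩
  have h1 := Real.rpow_sum_le_const_mul_sum_rpow_of_nonneg (f := fun i => |φ (x i)| ^ b)
    Finset.univ (by rw [le_div_iff₀ hb0]; linarith : 1 ≤ 2 / b) fun i _ => by positivity
  have h2 : ∀ i, (|φ (x i)| ^ b) ^ (2 / b) = φ (x i) ^ 2 := fun i => by
    rw [← Real.rpow_mul (abs_nonneg _), mul_div_cancel₀ _ hb0.ne', Real.rpow_two, sq_abs]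
  simp only [h2, Finset.card_univ, Fintype.card_fin] at h1
  have hS0 : 0 ≤ ∑ i, |φ (x i)| ^ b := Finset.sum_nonneg fun i _ => by positivity
  have h3 : (∑ i, |φ (x i)| ^ b) ^ (2 / b) ≤ (((n : ℝ) ^ γ * ‖φ‖) ^ b) ^ (2 / b) := by
    refine h1.trans ((mul_le_mul_of_nonneg_left (hx φ) (by positivity)).trans ?_)
    rw [← Real.rpow_mul (by positivity), mul_div_cancel₀ _ hb0.ne', Real.rpow_two]
    have h4 : (n : ℝ) ^ (2 / b - 1) = ((n : ℝ) ^ (1 / b - 1 / 2)) ^ 2 := by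
      rw [← Real.rpow_natCast, ← Real.rpow_mul hn0.le]
      congr 1
      push_cast
      ring
    rw [h4, ← mul_pow, ← mul_assoc]
    refine pow_le_pow_left₀ (by positivity) (mul_le_mul_of_nonneg_right ?_ (norm_nonneg _)) 2
    calc _ ≤ (n : ℝ) ^ (1 / b - 1 / 2) * (n : ℝ) ^ (γ - (1 / b - 1 / 2)) :=
          mul_le_mul_of_nonneg_left (hN1 n (by omega)) (by positivity)
      _ = _ := by
        rw [← Real.rpow_add hn0]
        congr 1
        ring
  exact (Real.rpow_le_rpow_iff hS0 (by positivity) (by positivity)).1 h3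

end DvoretzkyRogers

section Summing

variable {E : Type*} [NormedAddCommGroup E]

/-- The double sequence obtained by extending finite families by zero. -/
def zeroExtend {n : ℕ → ℕ} (x : ∀ k, Fin (n k) → E) (p : ℕ × ℕ) : E :=
  if h : p.2 < n p.1 then x p.1 ⟨p.2, h⟩ else 0

lemma hasSum_comp_zeroExtend {n : ℕ → ℕ} (x : ∀ k, Fin (n k) → E) {G : E → ℝ} (hG : G 0 = 0)
    (k : ℕ) : HasSum (fun j => G (zeroExtend x (k, j))) (∑ i, G (x k i)) := by
  have h1 : ∑ i, G (x k i) = ∑ j ∈ Finset.range (n k), G (zeroExtend x (k, j)) := by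
    rw [Finset.sum_range]
    refine Finset.sum_congr rfl fun i _ => ?_
    simp [zeroExtend]
  rw [h1]
  refine hasSum_sum_of_ne_finset_zero fun j hj => ?_
  have h2 : ¬ j < n k := by simpa using hj
  simp [zeroExtend, h2, hG]

lemma summable_comp_zeroExtend_iff {n : ℕ → ℕ} (x : ∀ k, Fin (n k) → E) {G : E → ℝ} (hG : G 0 = 0)
    (h0 : ∀ v, 0 ≤ G v) :
    (Summable fun j : ℕ => G (zeroExtend x (Nat.unpair j))) ↔ Summable fun k => ∑ i, G (x k i) := by
  have h1 := Nat.pairEquiv.symm.summable_iff (f := fun p => G (zeroExtend x p))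
  have h2 := summable_prod_of_nonneg (f := fun p => G (zeroExtend x p)) fun p => h0 _
  have h3 : ∀ k, ∑' j, G (zeroExtend x (k, j)) = ∑ i, G (x k i) := fun k =>
    (hasSum_comp_zeroExtend x hG k).tsum_eq
  simp only [h3] at h2
  exact h1.trans (h2.trans
    (and_iff_right fun k => (hasSum_comp_zeroExtend x hG k).summable))

variable [NormedSpace ℝ E]

lemma HasWeakFamilies.not_absolutelySumming {a b γ : ℝ} (ha : 0 < a) (hb : 0 < b)
    (h : HasWeakFamilies E b γ) (hγ : γ < 1 / a) :
    ¬ AbsolutelySumming a b (ContinuousLinearMap.id ℝ E) := by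
  intro hsum
  have hε : 0 < (1 / a - γ) * b := mul_pos (by linarith) hb
  choose N hN using fun k : ℕ => exists_le_rpow_nat (2 ^ k) hε
  choose n hn x hx1 hx using fun k => h (N k + 1)
  have hn0 : ∀ k, (0 : ℝ) < n k := fun k => by
    have := hn k
    have h1 : 0 < n k := by omega
    exact_mod_cast h1
  set c : ℕ → ℝ := fun k => (n k : ℝ) ^ (-(1 / a)) with hc
  have hc0 : ∀ k, 0 < c k := fun k => Real.rpow_pos_of_pos (hn0 k) _
  let y : ∀ k, Fin (n k) → E := fun k i => c k • x k i
  have hweak : WeaklySummable b fun j => zeroExtend y (Nat.unpair j) := by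
    intro φ
    refine (summable_comp_zeroExtend_iff y (G := fun v => |φ v| ^ b) (by simp [hb.ne'])
      fun v => by positivity).2 ?_
    refine Summable.of_nonneg_of_le (fun k => Finset.sum_nonneg fun i _ => by positivity)
      (fun k => ?_) (summable_geometric_two.mul_left (‖φ‖ ^ b))
    have h1 : ∑ i, |φ (y k i)| ^ b = c k ^ b * ∑ i, |φ (x k i)| ^ b := by
      rw [Finset.mul_sum]
      refine Finset.sum_congr rfl fun i _ => ?_
      rw [map_smul, smul_eq_mul, abs_mul, abs_of_pos (hc0 k),
        Real.mul_rpow (hc0 k).le (abs_nonneg _)]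
    rw [h1]
    have h2 := hN k (n k) (by have := hn k; omega)
    have h3 : (n k : ℝ) ^ ((1 / a - γ) * b) * (c k ^ b * ((n k : ℝ) ^ γ) ^ b) = 1 := by
      rw [hc, ← Real.rpow_mul (hn0 k).le, ← Real.rpow_mul (hn0 k).le, ← Real.rpow_add (hn0 k),
        ← Real.rpow_add (hn0 k)]
      convert Real.rpow_zero _ using 2
      ring
    have h4 : c k ^ b * ((n k : ℝ) ^ γ) ^ b ≤ (1 / 2) ^ k := by
      rw [one_div_pow, le_div_iff₀ (by positivity), mul_comm, ← h3]
      exact mul_le_mul_of_nonneg_right h2 (by have := (hc0 k).le; positivity)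
    calc _ ≤ c k ^ b * ((n k : ℝ) ^ γ * ‖φ‖) ^ b :=
          mul_le_mul_of_nonneg_left (hx k φ) (Real.rpow_nonneg (hc0 k).le _)
      _ = ‖φ‖ ^ b * (c k ^ b * ((n k : ℝ) ^ γ) ^ b) := by
          rw [Real.mul_rpow (by positivity) (norm_nonneg _)]
          ring
      _ ≤ _ := mul_le_mul_of_nonneg_left h4 (by positivity)
  have hs := (summable_comp_zeroExtend_iff y (G := fun v => ‖v‖ ^ a) (by simp [ha.ne'])
      fun v => by positivity).1 (hsum _ hweak)
  have hone : ∀ k, 1 ≤ ∑ i, ‖y k i‖ ^ a := by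
    intro k
    have h1 : ∀ i ∈ Finset.univ, (n k : ℝ)⁻¹ ≤ ‖y k i‖ ^ a := fun i _ => by
      rw [norm_smul, Real.norm_of_nonneg (hc0 k).le,
        Real.mul_rpow (hc0 k).le (norm_nonneg _), hc, ← Real.rpow_mul (hn0 k).le, neg_mul,
        one_div_mul_cancel ha.ne', Real.rpow_neg_one]
      exact le_mul_of_one_le_right (by positivity) (Real.one_le_rpow (hx1 k i) ha.le)
    have h2 := Finset.card_nsmul_le_sum _ _ _ h1
    rwa [Finset.card_univ, Fintype.card_fin, nsmul_eq_mul, mul_inv_cancel₀ (hn0 k).ne'] at h2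
  exact absurd (ge_of_tendsto' hs.tendsto_atTop_zero hone) (by norm_num)

lemma AbsolutelySumming.mono {a a' b : ℝ} (ha : 0 < a) (haa : a ≤ a')
    (h : AbsolutelySumming a b (ContinuousLinearMap.id ℝ E)) :
    AbsolutelySumming a' b (ContinuousLinearMap.id ℝ E) := by
  intro x hx
  have h1 := h x hx
  refine h1.of_norm_bounded_eventually_nat ?_
  filter_upwards [h1.tendsto_atTop_zero.eventually_le_const one_pos] with j hj
  have h2 : ‖(ContinuousLinearMap.id ℝ E) (x j)‖ ≤ 1 := by
    by_contra! hlt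
    exact absurd hj (not_le.2 (Real.one_lt_rpow hlt ha))
  rw [Real.norm_of_nonneg (by positivity)]
  exact Real.rpow_le_rpow_of_exponent_ge_of_imp (norm_nonneg _) h2 haa fun _ h0 => absurd h0 (ha.trans_le haa).ne'

lemma WeaklySummable.exists_sum_rpow_le {b : ℝ} (hb : 1 ≤ b) {x : ℕ → E}
    (hx : WeaklySummable b x) :
    ∃ K ≥ 0, ∀ (φ : E →L[ℝ] ℝ) (s : Finset ℕ), ∑ j ∈ s, |φ (x j)| ^ b ≤ (K * ‖φ‖) ^ b := by
  have hb0 : 0 < b := by linarith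
  set p : ℝ≥0∞ := ENNReal.ofReal b with hp
  have hpr : p.toReal = b := ENNReal.toReal_ofReal hb0.le
  have : Fact (1 ≤ p) := ⟨by rw [hp, ← ENNReal.ofReal_one]; exact ENNReal.ofReal_le_ofReal hb⟩
  have hp0 : p ≠ 0 := (zero_lt_one.trans_le this.out).ne'
  have hmem : ∀ φ : E →L[ℝ] ℝ, Memℓp (fun j => φ (x j)) p := fun φ => by
    refine memℓp_gen ?_
    rw [hpr]
    exact hx φ
  let g : (E →L[ℝ] ℝ) →ₗ[ℝ] lp (fun _ : ℕ => ℝ) p :=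
    { toFun := fun φ => ⟨fun j => φ (x j), hmem φ⟩
      map_add' := fun φ ψ => rfl
      map_smul' := fun c φ => rfl }
  have hg : Continuous g := by
    refine g.continuous_of_seq_closed_graph fun u φ y hu hy => ?_
    ext j
    have h1 : Filter.Tendsto (fun k => u k (x j)) Filter.atTop (nhds (φ (x j))) :=
      ((ContinuousLinearMap.apply ℝ ℝ (x j)).continuous.tendsto φ).comp hu
    have h2 : Filter.Tendsto (fun k => u k (x j)) Filter.atTop (nhds (y j)) := by
      rw [tendsto_iff_norm_sub_tendsto_zero] at hy ⊢
      exact squeeze_zero (fun _ => norm_nonneg _)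
        (fun k => lp.norm_apply_le_norm hp0 ((g ∘ u) k - y) j) hy
    exact tendsto_nhds_unique h2 h1
  let G : (E →L[ℝ] ℝ) →L[ℝ] lp (fun _ : ℕ => ℝ) p := ⟨g, hg⟩
  refine ⟨‖G‖, norm_nonneg G, fun φ s => ?_⟩
  have h1 := lp.sum_rpow_le_norm_rpow (by rw [hpr]; exact hb0) (G φ) s
  rw [hpr] at h1
  exact h1.trans (Real.rpow_le_rpow (norm_nonneg _) (G.le_opNorm φ) hb0.le)

lemma signSup_le {ι : Type*} [Fintype ι] [DecidableEq ι] {x : ι → E} {M : ℝ}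
    (h : ∀ φ : E →L[ℝ] ℝ, ‖φ‖ ≤ 1 → ∑ i, |φ (x i)| ≤ M) : signSup x Finset.univ ≤ M := by
  obtain ⟨σ, hσ⟩ := exists_signSup_eq x Finset.univ
  obtain ⟨φ, hφ, hφx⟩ := exists_dual_vector'' ℝ (∑ i, sgn (σ i) • x i)
  simp only [RCLike.ofReal_real_eq_id, id_eq] at hφx
  rw [← hσ, ← hφx, map_sum]
  refine (Finset.sum_le_sum fun j _ => ?_).trans (h φ hφ)
  rw [map_smul, smul_eq_mul]
  refine (le_abs_self _).trans ?_
  rw [abs_mul, abs_sgn, one_mul]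

/-- Hölder's inequality against powers of the norms. -/
lemma sum_norm_rpow_mul_abs_le {ι : Type*} [Fintype ι] {a b : ℝ} (hb : 1 ≤ b)
    (x : ι → E) (φ : E →L[ℝ] ℝ) :
    ∑ i, ‖x i‖ ^ (a * (1 - 1 / b)) * |φ (x i)|
      ≤ (∑ i, ‖x i‖ ^ a) ^ (1 - 1 / b) * (∑ i, |φ (x i)| ^ b) ^ (1 / b) := by
  have hb0 : 0 < b := by linarith
  have h := Real.inner_le_weight_mul_Lp_of_nonneg Finset.univ hb (fun i => ‖x i‖ ^ a)
    (fun i => |φ (x i)| * ‖x i‖ ^ (-(a / b))) (fun i => by positivity) fun i => by positivity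
  rw [← one_div] at h
  convert h using 1
  · refine Finset.sum_congr rfl fun i _ => ?_
    rcases eq_or_ne (x i) 0 with h0 | h0
    · simp [h0]
    · have hpos : 0 < ‖x i‖ := norm_pos_iff.2 h0
      rw [mul_left_comm, ← Real.rpow_add hpos, mul_comm]
      congr 2
      ring
  · congr 2
    refine Finset.sum_congr rfl fun i _ => ?_
    rcases eq_or_ne (x i) 0 with h0 | h0
    · simp [h0, hb0.ne']
    · have hpos : 0 < ‖x i‖ := norm_pos_iff.2 h0
      rw [Real.mul_rpow (abs_nonneg _) (by positivity), ← Real.rpow_mul hpos.le, mul_left_comm,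
        ← Real.rpow_add hpos, neg_mul, div_mul_cancel₀ _ hb0.ne', add_neg_cancel, Real.rpow_zero,
        mul_one]

lemma HasCotype.absolutelySumming {s a b : ℝ} (hs : HasCotype s E) (ha : 0 < a) (hb : 1 ≤ b)
    (hab : 1 / a = 1 / b - 1 + 1 / s) :
    AbsolutelySumming a b (ContinuousLinearMap.id ℝ E) := by
  intro x hx
  have hs0 : 0 < s := by linarith [hs.1]
  have hb0 : 0 < b := by linarith
  obtain ⟨K, hK0, hK⟩ := hx.exists_sum_rpow_le hb
  obtain ⟨C, hC, hcot⟩ := hs.rpow_sum_le_meanSq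
  refine summable_of_sum_range_le (c := (√C * K) ^ a) (fun j => by positivity) fun N => ?_
  simp only [ContinuousLinearMap.id_apply]
  rw [Finset.sum_range fun j => ‖x j‖ ^ a]
  set S : ℝ := ∑ j : Fin N, ‖x j‖ ^ a with hS
  have hS0 : 0 ≤ S := Finset.sum_nonneg fun j _ => by positivity
  set y : Fin N → E := fun j => ‖x j‖ ^ (a * (1 - 1 / b)) • x j with hy
  have hexp : a * (1 - 1 / b) + 1 = a / s := by
    have h1 : a * (1 / a) = a * (1 / b - 1 + 1 / s) := by rw [hab]
    rw [mul_one_div_cancel ha.ne'] at h1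
    rw [div_eq_mul_one_div a s]
    linarith
  have hynorm : ∀ j, ‖y j‖ ^ s = ‖x j‖ ^ a := fun j => by
    have hne : a * (1 - 1 / b) + 1 ≠ 0 := by rw [hexp]; positivity
    rw [hy, norm_smul, Real.norm_of_nonneg (by positivity), ← Real.rpow_add_one' (norm_nonneg _) hne,
      hexp, ← Real.rpow_mul (norm_nonneg _), div_mul_cancel₀ _ hs0.ne']
  have hsup : signSup y Finset.univ ≤ S ^ (1 - 1 / b) * K := by
    refine signSup_le fun φ hφ => ?_
    have h1 := sum_norm_rpow_mul_abs_le (a := a) hb (fun j : Fin N => (x j)) φ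
    have h2 : ∑ j, |φ (y j)| = ∑ j : Fin N, ‖x j‖ ^ (a * (1 - 1 / b)) * |φ (x j)| := by
      refine Finset.sum_congr rfl fun j _ => ?_
      rw [hy, map_smul, smul_eq_mul, abs_mul, abs_of_nonneg (by positivity)]
    rw [h2]
    refine h1.trans (mul_le_mul_of_nonneg_left ?_ (by positivity))
    have h3 := hK φ (Finset.range N)
    rw [Finset.sum_range fun j => |φ (x j)| ^ b] at h3
    have h4 : (∑ j : Fin N, |φ (x j)| ^ b) ≤ K ^ b :=
      h3.trans (Real.rpow_le_rpow (by positivity) (mul_le_of_le_one_right hK0 hφ) hb0.le)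
    refine (Real.rpow_le_rpow (Finset.sum_nonneg fun j _ => by positivity) h4
      (by positivity)).trans_eq ?_
    rw [← Real.rpow_mul hK0, mul_one_div_cancel hb0.ne', Real.rpow_one]
  have hmain : S ≤ (√C * (S ^ (1 - 1 / b) * K)) ^ s := by
    refine le_rpow_of_rpow_two_div_le hs0 hS0 hC.le (by positivity) ?_
    have h1 := hcot _ y
    simp only [hynorm] at h1
    refine h1.trans (mul_le_mul_of_nonneg_left ?_ hC.le)
    exact (meanSq_le_signSup_sq _ _).trans (pow_le_pow_left₀ (signSup_nonneg _ _) hsup 2)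
  rcases hS0.eq_or_lt with h0 | hpos
  · rw [← h0]
    positivity
  · have h1 := Real.rpow_le_rpow hS0 hmain (by positivity : 0 ≤ 1 / s)
    rw [← Real.rpow_mul (by positivity), mul_one_div_cancel hs0.ne', Real.rpow_one] at h1
    have h2 : S ^ (1 / s) = S ^ (1 / a) * S ^ (1 - 1 / b) := by
      rw [← Real.rpow_add hpos, hab]
      congr 1
      ring
    have h3 : S ^ (1 / a) ≤ √C * K := by
      refine le_of_mul_le_mul_right ?_ (by positivity : 0 < S ^ (1 - 1 / b))
      linarith
    have h4 := Real.rpow_le_rpow (by positivity) h3 ha.le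
    rwa [← Real.rpow_mul hS0, one_div_mul_cancel ha.ne', Real.rpow_one] at h4

end Summing

section Cot

variable {E : Type*} [NormedAddCommGroup E] [NormedSpace ℝ E]

lemma HasCotype.cot_le {q : ℝ} (h : HasCotype q E) : cot E ≤ ENNReal.ofReal q :=
  sInf_le ⟨q, h, rfl⟩

lemma two_le_cot_toReal (h : cot E ≠ ∞) : 2 ≤ (cot E).toReal := by
  refine (ENNReal.ofReal_le_iff_le_toReal h).1 (le_sInf ?_)
  rintro _ ⟨q, hq, rfl⟩
  exact ENNReal.ofReal_le_ofReal hq.1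

lemma not_hasCotype_of_lt_cot {s : ℝ} (hs : s < (cot E).toReal) : ¬ HasCotype s E := fun h =>
  not_le.2 hs (ENNReal.toReal_le_of_le_ofReal (by linarith [h.1]) h.cot_le)

lemma exists_hasCotype_near_cot (h : cot E ≠ ∞) {ε : ℝ} (hε : 0 < ε) :
    ∃ s, HasCotype s E ∧ (cot E).toReal ≤ s ∧ 1 / (cot E).toReal - ε < 1 / s := by
  have hQ2 := two_le_cot_toReal h
  set Q := (cot E).toReal with hQ
  have hQ0 : 0 < Q := by linarith
  have hδ : 0 < min ε (1 / (2 * Q)) := lt_min hε (by positivity)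
  set δ := min ε (1 / (2 * Q)) with hδdef
  have h1 : δ < 1 / Q :=
    (min_le_right _ _).trans_lt (one_div_lt_one_div_of_lt hQ0 (by linarith))
  have h2 : Q < 1 / (1 / Q - δ) := by
    rw [lt_one_div hQ0 (by linarith)]
    linarith
  have h3 : cot E < ENNReal.ofReal (1 / (1 / Q - δ)) := by
    rw [← ENNReal.ofReal_toReal h]
    exact (ENNReal.ofReal_lt_ofReal_iff (hQ0.trans h2)).2 h2
  obtain ⟨_, ⟨s, hs, rfl⟩, hlt⟩ := sInf_lt_iff.1 h3
  have hs0 : 0 < s := by linarith [hs.1]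
  refine ⟨s, hs, ENNReal.toReal_le_of_le_ofReal hs0.le hs.cot_le, ?_⟩
  have h4 : s < 1 / (1 / Q - δ) := (ENNReal.ofReal_lt_ofReal_iff (hQ0.trans h2)).1 hlt
  rw [lt_one_div hs0 (by linarith)] at h4
  linarith [min_le_left ε (1 / (2 * Q))]

lemma cot_ne_top_of_lt_conjE {b : ℝ} (hb : 1 ≤ b) (h : ENNReal.ofReal b < conjE (cot E)) :
    cot E ≠ ∞ := by
  intro htop
  rw [htop, conjE] at h
  rw [ENNReal.top_sub ENNReal.one_ne_top, ENNReal.div_top, add_zero] at h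
  exact absurd h (not_lt.2 (ENNReal.one_le_ofReal.2 hb))

lemma mul_cot_lt_of_lt_conjE {b : ℝ} (hb : 1 ≤ b) (h : ENNReal.ofReal b < conjE (cot E)) :
    b * (cot E).toReal < b + (cot E).toReal := by
  have hne := cot_ne_top_of_lt_conjE hb h
  have hQ2 := two_le_cot_toReal hne
  rw [← ENNReal.ofReal_toReal hne, conjE] at h
  set Q := (cot E).toReal
  have h1 : (1 : ℝ≥0∞) + 1 / (ENNReal.ofReal Q - 1) = ENNReal.ofReal (1 + 1 / (Q - 1)) := by
    rw [ENNReal.ofReal_add zero_le_one (by rw [one_div_nonneg]; linarith),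
      ENNReal.ofReal_div_of_pos (by linarith), ENNReal.ofReal_sub _ zero_le_one, ENNReal.ofReal_one]
  rw [h1, ENNReal.ofReal_lt_ofReal_iff_of_nonneg (by linarith), ← sub_lt_iff_lt_add',
    lt_div_iff₀ (by linarith)] at h
  linarith

lemma hasWeakFamilies_of_lt (hE : ¬ FiniteDimensional ℝ E) (hcot : cot E ≠ ∞) {b γ : ℝ}
    (hb : 1 ≤ b) (hbc : b * (cot E).toReal < b + (cot E).toReal)
    (hγ : 1 / b - 1 + 1 / (cot E).toReal < γ) : HasWeakFamilies E b γ := by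
  have hQ2 := two_le_cot_toReal hcot
  have hnear := fun {ε : ℝ} (hε : 0 < ε) => exists_hasCotype_near_cot hcot hε
  have hnot := fun {s : ℝ} (hs : s < (cot E).toReal) => not_hasCotype_of_lt_cot hs
  set Q := (cot E).toReal
  have hQ0 : 0 < Q := by linarith
  have hb0 : 0 < b := by linarith
  rcases hQ2.eq_or_lt with hQ | hQ
  · rw [← hQ] at hbc hγ
    exact hasWeakFamilies_of_not_finiteDimensional hE hb (by linarith) (by linarith)
  have hhalf : 0 < 1 / 2 - 1 / Q := sub_pos.2 (one_div_lt_one_div_of_lt two_pos hQ)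
  obtain ⟨p, hp⟩ := exists_nat_ge (1 / 2 / (1 / 2 - 1 / Q))
  rw [div_le_iff₀ hhalf] at hp
  set δ := γ - (1 / b - 1 + 1 / Q) with hδ
  have hδ0 : 0 < δ := by linarith
  set η := δ / (4 * (p + 2)) with hη
  have hη0 : 0 < η := by positivity
  have hηδ : 4 * (p + 2) * η = δ := by
    rw [hη]
    field_simp
  have hθ : 0 < 1 / b - 1 + 1 / Q := by
    have h1 : 1 / b - 1 + 1 / Q = (b + Q - b * Q) / (b * Q) := by
      field_simp
      ring
    rw [h1]
    exact div_pos (by linarith) (by positivity)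
  obtain ⟨s, hs, hQs, hs1⟩ := hnear (lt_min hη0 hθ)
  have hsη : 1 / Q - η < 1 / s := by linarith [min_le_left η (1 / b - 1 + 1 / Q)]
  have hsθ : 1 - 1 / b < 1 / s := by linarith [min_le_right η (1 / b - 1 + 1 / Q)]
  have hsQ : 1 / s ≤ 1 / Q := one_div_le_one_div_of_le hQ0 hQs
  have hbs : b * (1 - 1 / s) < 1 := by
    have h1 := mul_lt_mul_of_pos_left (by linarith : 1 - 1 / s < 1 / b) hb0
    rwa [mul_one_div_cancel hb0.ne'] at h1
  have hfam : HasMeanSqFamilies E (1 / Q + η) := by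
    have hpos : 0 < 1 / Q + η := by positivity
    have h1 : 1 / (1 / Q + η) < Q := by
      rw [one_div_lt hpos hQ0]
      linarith
    obtain ⟨r, hr, hrQ⟩ := exists_between (max_lt hQ h1)
    have hr2 : 2 < r := (le_max_left _ _).trans_lt hr
    refine hasMeanSqFamilies_of_not_hasCotype hr2.le (hnot hrQ) ?_
    rw [one_div_lt (by linarith) hpos]
    exact (le_max_right _ _).trans_lt hr
  have hsup : HasSignSupFamilies E (1 / Q + δ / 2) := by
    refine hfam.hasSignSupFamilies hs (p := p) ?_ (by linarith) ?_
    · exact hp.trans (mul_le_mul_of_nonneg_left (by linarith) (Nat.cast_nonneg p))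
    · have h1 : ((p : ℝ) + 1) * (1 / Q + η - 1 / s) ≤ (p + 1) * (2 * η) :=
        mul_le_mul_of_nonneg_left (by linarith) (by positivity)
      linarith
  exact hsup.hasWeakFamilies hs hb hbs (by linarith) (by linarith)

end Cot

/-- if `b < (cot E)*` then
`inf{a : id_E is (a,b)-summing} = b·cot E / (b + cot E − b·cot E)`; more precisely `id_E`
is `(a,b)`-summing for `a` above this bound and not `(a,b)`-summing for `b ≤ a` below it. -/
theorem stmt1 (E : Type*) [NormedAddCommGroup E] [NormedSpace ℝ E] [CompleteSpace E]
    (hE : ¬ FiniteDimensional ℝ E) (b : ℝ) (hb : 1 ≤ b)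
    (hbc : ENNReal.ofReal b < conjE (cot E)) :
    sInf {a : ℝ | b ≤ a ∧ AbsolutelySumming a b (ContinuousLinearMap.id ℝ E)}
        = b * (cot E).toReal / (b + (cot E).toReal - b * (cot E).toReal) ∧
    (∀ a : ℝ, b * (cot E).toReal / (b + (cot E).toReal - b * (cot E).toReal) < a →
        AbsolutelySumming a b (ContinuousLinearMap.id ℝ E)) ∧
    (∀ a : ℝ, b ≤ a → a < b * (cot E).toReal / (b + (cot E).toReal - b * (cot E).toReal) →
        ¬ AbsolutelySumming a b (ContinuousLinearMap.id ℝ E)) := by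
  have hcot := cot_ne_top_of_lt_conjE hb hbc
  have hbQ := mul_cot_lt_of_lt_conjE hb hbc
  have hQ2 := two_le_cot_toReal hcot
  have hnear := fun {ε : ℝ} (hε : 0 < ε) => exists_hasCotype_near_cot hcot hε
  have hweak := fun {γ : ℝ} => hasWeakFamilies_of_lt (γ := γ) hE hcot hb hbQ
  set Q := (cot E).toReal
  have hQ0 : 0 < Q := by linarith
  have hb0 : 0 < b := by linarith
  have hden : 0 < b + Q - b * Q := by linarith
  set a₀ := b * Q / (b + Q - b * Q) with ha₀
  have ha₀0 : 0 < a₀ := div_pos (by positivity) hden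
  have hinv : 1 / a₀ = 1 / b - 1 + 1 / Q := by
    rw [ha₀, one_div_div]
    field_simp
    ring
  have hba₀ : b ≤ a₀ := by
    rw [ha₀, le_div_iff₀ hden]
    exact mul_le_mul_of_nonneg_left (by nlinarith) hb0.le
  have hupper : ∀ a : ℝ, a₀ < a → AbsolutelySumming a b (ContinuousLinearMap.id ℝ E) := by
    intro a ha
    have ha0 : 0 < a := ha₀0.trans ha
    obtain ⟨s, hs, -, hs1⟩ := hnear (sub_pos.2 (one_div_lt_one_div_of_lt ha₀0 ha))
    have h1 : 1 / a < 1 / b - 1 + 1 / s := by linarith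
    have h2 : 0 < 1 / b - 1 + 1 / s := (by positivity : 0 < 1 / a).trans h1
    refine AbsolutelySumming.mono (one_div_pos.2 h2) ?_
      (hs.absolutelySumming (one_div_pos.2 h2) hb (one_div_one_div _))
    exact (one_div_le h2 ha0).2 h1.le
  have hlower : ∀ a : ℝ, b ≤ a → a < a₀ →
      ¬ AbsolutelySumming a b (ContinuousLinearMap.id ℝ E) := by
    intro a hba ha
    have ha0 : 0 < a := hb0.trans_le hba
    obtain ⟨γ, hγ1, hγ2⟩ := exists_between (one_div_lt_one_div_of_lt ha0 ha)
    exact (hweak (hinv ▸ hγ1)).not_absolutelySumming ha0 hb0 hγ2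
  refine ⟨?_, hupper, hlower⟩
  refine csInf_eq_of_forall_ge_of_forall_gt_exists_lt ⟨a₀ + 1, by linarith, hupper _ (by linarith)⟩
    (fun a ha => ?_) fun w hw => ?_
  · by_contra! hlt
    exact hlower a ha.1 hlt ha.2
  · obtain ⟨a, ha1, ha2⟩ := exists_between hw
    exact ⟨a, ⟨by linarith, hupper a ha1⟩, ha2⟩

end
end
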